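/- A circular-arc graph is a normal Helly circular-arc (NHCA) graph if and only if it contains no induced subgraph isomorphic to a wheel W_n (n ≥ 4), the 3-sun S_3, a rising sun R_n (n ≥ 4), the umbrella, or the tent. -/

import Mathlib

open Set

noncomputable section

instance : Fact ((0:ℝ) < 1) := ⟨one_pos⟩

/-- A point on the circle (of circumference 1). -/
abbrev Circ : Type := AddCircle (1 : ℝ)

/-- An arc of the circle, described by its beginning point `s` and its ending point `t`
(the arc is traversed clockwise, i.e. in the positive circular direction, from `s` to `t`). -/
structure Arc where
  s : Circ
  t : Circ

/-- The set of points of the open arc: the points strictly between `s` and `t`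
in the circular order. -/
def Arc.pts (A : Arc) : Set Circ := {x | sbtw A.s x A.t}

/-- The length of an arc: the representative in `(0, 1]` of `t - s`. -/
def Arc.length (A : Arc) : ℝ := ((AddCircle.equivIoc (1:ℝ) 0) (A.t - A.s) : ℝ)

/-- A circular-arc (CA) model: a finite family of arcs of the circle such that all
endpoints of the arcs are pairwise distinct (in particular each arc has two distinct
endpoints, hence no arc covers the whole circle). -/
structure CAModel (V : Type) [Fintype V] where
  arc : V → Arc
  endpoints_distinct : Function.Injective
    (fun p : V × Bool => if p.2 then (arc p.1).s else (arc p.1).t)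

namespace CAModel

variable {V : Type} [Fintype V]

/-- The arcs of `u` and `v` intersect. -/
def Inter (M : CAModel V) (u v : V) : Prop := ((M.arc u).pts ∩ (M.arc v).pts).Nonempty

/-- The intersection graph of the model: two distinct arcs are adjacent iff they have
nonempty intersection. -/
def interGraph (M : CAModel V) : SimpleGraph V :=
  SimpleGraph.fromRel fun u v => M.Inter u v

/-- `M` is a model of the graph `G`: the arcs are in correspondence with the vertices of `G`
and two vertices are adjacent iff their arcs are distinct and intersect. -/
def IsModelOf (M : CAModel V) (G : SimpleGraph V) : Prop :=
  ∀ u v, G.Adj u v ↔ u ≠ v ∧ M.Inter u v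

/-- Helly model: every subfamily of pairwise intersecting arcs has a common point. -/
def Helly (M : CAModel V) : Prop :=
  ∀ S : Set V, (∀ u ∈ S, ∀ v ∈ S, M.Inter u v) → ∃ p : Circ, ∀ v ∈ S, p ∈ (M.arc v).pts

/-- Normal model: no two arcs together cover the whole circle. -/
def Normal (M : CAModel V) : Prop :=
  ∀ u v : V, u ≠ v → (M.arc u).pts ∪ (M.arc v).pts ≠ Set.univ

/-- No three arcs together cover the whole circle. -/
def NoThreeCover (M : CAModel V) : Prop :=
  ∀ u v w : V, u ≠ v → u ≠ w → v ≠ w →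
    (M.arc u).pts ∪ (M.arc v).pts ∪ (M.arc w).pts ≠ Set.univ

/-- Proper model: no arc is properly contained in another arc. -/
def Proper (M : CAModel V) : Prop :=
  ∀ u v : V, u ≠ v → ¬ (M.arc u).pts ⊂ (M.arc v).pts

/-- Unit model: all arcs have the same length. -/
def IsUnit (M : CAModel V) : Prop :=
  ∀ u v : V, (M.arc u).length = (M.arc v).length

/-- Interval model: some point of the circle is covered by no arc. -/
def IsIntervalModel (M : CAModel V) : Prop :=
  ∃ p : Circ, ∀ v : V, p ∉ (M.arc v).pts

/-- A universal arc: it intersects every other arc of the model. -/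
def UniversalArc (M : CAModel V) (v : V) : Prop :=
  ∀ w, w ≠ v → M.Inter v w

end CAModel

section GraphClasses

variable {V : Type} [Fintype V]

def IsCAGraph (G : SimpleGraph V) : Prop := ∃ M : CAModel V, M.IsModelOf G
def IsHCAGraph (G : SimpleGraph V) : Prop := ∃ M : CAModel V, M.Helly ∧ M.IsModelOf G
def IsNCAGraph (G : SimpleGraph V) : Prop := ∃ M : CAModel V, M.Normal ∧ M.IsModelOf G
def IsNHCAGraph (G : SimpleGraph V) : Prop :=
  ∃ M : CAModel V, M.Normal ∧ M.Helly ∧ M.IsModelOf G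
def IsPCAGraph (G : SimpleGraph V) : Prop := ∃ M : CAModel V, M.Proper ∧ M.IsModelOf G
def IsNPCAGraph (G : SimpleGraph V) : Prop :=
  ∃ M : CAModel V, M.Normal ∧ M.Proper ∧ M.IsModelOf G
def IsPHCAGraph (G : SimpleGraph V) : Prop :=
  ∃ M : CAModel V, M.Proper ∧ M.Helly ∧ M.IsModelOf G
def IsUCAGraph (G : SimpleGraph V) : Prop := ∃ M : CAModel V, M.IsUnit ∧ M.IsModelOf G
def IsUHCAGraph (G : SimpleGraph V) : Prop :=
  ∃ M : CAModel V, M.IsUnit ∧ M.Helly ∧ M.IsModelOf G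
def IsIntervalGraph (G : SimpleGraph V) : Prop :=
  ∃ M : CAModel V, M.IsIntervalModel ∧ M.IsModelOf G

end GraphClasses
/-! ### Some small graphs -/

/-- The claw `K_{1,3}`: vertex `0` is adjacent to `1`, `2`, `3`, which are pairwise
non-adjacent. -/
def claw : SimpleGraph (Fin 4) := SimpleGraph.fromRel fun u _ => u = 0

/-- The `n`-wheel `W_n`: a chordless cycle on `n` vertices plus one extra vertex adjacent
to all of them (intended for `n ≥ 4`). -/
def wheel (n : ℕ) : SimpleGraph (Fin n ⊕ Unit) :=
  SimpleGraph.fromRel fun u v =>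
    (∃ x, u = Sum.inr x) ∨
    (∃ i j : Fin n, u = Sum.inl i ∧ v = Sum.inl j ∧ ((i : ℕ) + 1) % n = (j : ℕ))

/-- The 3-sun `S_3`: vertices `0,1,2` (the `v_i`'s) are pairwise adjacent, vertices
`3,4,5` (the `w_i`'s) are pairwise non-adjacent, and `w_i` is adjacent exactly to
`v_i` and `v_{i+1 (mod 3)}`. -/
def sun3 : SimpleGraph (Fin 6) :=
  SimpleGraph.fromRel fun u v =>
    ((u : ℕ) < 3 ∧ (v : ℕ) < 3) ∨
    (3 ≤ (u : ℕ) ∧ ((v : ℕ) = (u : ℕ) - 3 ∨ (v : ℕ) = ((u : ℕ) - 2) % 3))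

/-- The tent: the complement of the 3-sun. -/
def tent : SimpleGraph (Fin 6) := sun3ᶜ

/-- The `n`-rising sun `R_n` (intended for `n ≥ 4`): vertices `inl 0, …, inl (n-1)`
are `v_1, …, v_n` where `v_2, …, v_{n-1}` form a path in this order and `v_1`, `v_n`
are adjacent to all the `v`'s; `inr 0 = w_1` is adjacent exactly to `v_1, v_2`;
`inr 1 = w_{n-1}` is adjacent exactly to `v_{n-1}, v_n`; and `inr 2 = w_n` is adjacent
exactly to `v_n, v_1`. -/
def risingSun (n : ℕ) : SimpleGraph (Fin n ⊕ Fin 3) :=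
  SimpleGraph.fromRel fun u v =>
    match u, v with
    | Sum.inl a, Sum.inl b => (a : ℕ) = 0 ∨ (a : ℕ) = n - 1 ∨ (b : ℕ) = (a : ℕ) + 1
    | Sum.inr w, Sum.inl a =>
        ((w : ℕ) = 0 ∧ ((a : ℕ) = 0 ∨ (a : ℕ) = 1)) ∨
        ((w : ℕ) = 1 ∧ ((a : ℕ) = n - 2 ∨ (a : ℕ) = n - 1)) ∨
        ((w : ℕ) = 2 ∧ ((a : ℕ) = n - 1 ∨ (a : ℕ) = 0))
    | _, _ => False

/-- The umbrella: a path `0,1,2,3,4`, a vertex `5` adjacent to all of `0,…,4`, and a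
vertex `6` adjacent only to `2`. -/
def umbrella : SimpleGraph (Fin 7) :=
  SimpleGraph.fromRel fun u v =>
    ((u : ℕ) < 5 ∧ (v : ℕ) = (u : ℕ) + 1 ∧ (v : ℕ) < 5) ∨
    ((u : ℕ) = 5 ∧ (v : ℕ) < 5) ∨
    ((u : ℕ) = 6 ∧ (v : ℕ) = 2)

namespace NH

section Graph
variable {V : Type}

/-- `w` is outside the closed neighbourhood of `x`. -/
def Far (G : SimpleGraph V) (x w : V) : Prop := w ≠ x ∧ ¬ G.Adj x w

theorem Far.symm {G : SimpleGraph V} {x w : V} (h : Far G x w) : Far G w x :=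
  ⟨h.1.symm, fun h' => h.2 h'.symm⟩

/-- `b` can be reached from `a` by a walk all of whose vertices satisfy `P`. -/
inductive Reach (G : SimpleGraph V) (P : V → Prop) : V → V → Prop
  | refl {a : V} : P a → Reach G P a a
  | tail {a b c : V} : Reach G P a b → G.Adj b c → P c → Reach G P a c

namespace Reach
variable {G : SimpleGraph V} {P Q : V → Prop} {a b c : V}

theorem left (h : Reach G P a b) : P a := by
  induction h with
  | refl h => exact h
  | tail _ _ _ ih => exact ih

theorem right (h : Reach G P a b) : P b := by
  cases h with
  | refl h => exact h
  | tail _ _ h => exact h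

theorem trans (h : Reach G P a b) (h' : Reach G P b c) : Reach G P a c := by
  induction h' with
  | refl _ => exact h
  | tail _ hadj hP ih => exact .tail ih hadj hP

theorem single (hab : G.Adj a b) (ha : P a) (hb : P b) : Reach G P a b := .tail (.refl ha) hab hb

theorem head (hab : G.Adj a b) (ha : P a) (h : Reach G P b c) : Reach G P a c :=
  (single hab ha h.left).trans h

theorem symm (h : Reach G P a b) : Reach G P b a := by
  induction h with
  | refl h => exact .refl h
  | tail h1 hadj hP ih => exact head hadj.symm hP ih

theorem mono (hPQ : ∀ v, P v → Q v) (h : Reach G P a b) : Reach G Q a b := by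
  induction h with
  | refl h => exact .refl (hPQ _ h)
  | tail h1 hadj hP ih => exact .tail ih hadj (hPQ _ hP)

/-- First exit of a walk from a set. -/
theorem exit {S : V → Prop} (h : Reach G P a b) (ha : S a) (hb : ¬ S b) :
    ∃ k e, Reach G (fun v => P v ∧ S v) a k ∧ G.Adj k e ∧ P e ∧ ¬ S e := by
  induction h with
  | refl h => exact absurd ha hb
  | @tail b c h1 hadj hP ih =>
    by_cases hSb : S b
    · by_cases hall : Reach G (fun v => P v ∧ S v) a b
      · exact ⟨b, c, hall, hadj, hP, hb⟩
      · -- some earlier exit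
        clear ih hb hP hadj
        have : ∀ b, Reach G P a b → ¬ Reach G (fun v => P v ∧ S v) a b →
            ∃ k e, Reach G (fun v => P v ∧ S v) a k ∧ G.Adj k e ∧ P e ∧ ¬ S e := by
          intro b hb
          induction hb with
          | refl h => intro hn; exact absurd (.refl ⟨h, ha⟩) hn
          | @tail b c h1 hadj hP ih =>
            intro hn
            by_cases hr : Reach G (fun v => P v ∧ S v) a b
            · by_cases hSc : S c
              · exact absurd (.tail hr hadj ⟨hP, hSc⟩) hn
              · exact ⟨b, c, hr, hadj, hP, hSc⟩
            · exact ih hr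
        exact this b h1 hall
    · exact ih hSb

end Reach

/-- Chordality: the attachments of a connected set avoiding `N[x]` to `N(x)` form a clique. -/
def CH (G : SimpleGraph V) : Prop :=
  ∀ x u v a b, G.Adj x u → G.Adj x v → u ≠ v → ¬ G.Adj u v → G.Adj u a → G.Adj v b →
    ¬ Reach G (Far G x) a b

/-- Freeness of asteroidal triples. -/
def ATF (G : SimpleGraph V) : Prop :=
  ∀ x y z, Reach G (Far G z) x y → Reach G (Far G x) y z → Reach G (Far G y) z x → False

/-- The root condition. -/
def Root (G : SimpleGraph V) (W : Finset V) (r : V) : Prop :=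
  ∀ x y, Reach G (fun v => v ∈ W ∧ Far G y v) x r → Reach G (fun v => v ∈ W ∧ Far G x v) y r → False

/-- `lt` restricted to `W` is a strict order whose comparabilities are the non-edges. -/
structure OrderOn (G : SimpleGraph V) (W : Finset V) (lt : V → V → Prop) : Prop where
  trans : ∀ x ∈ W, ∀ y ∈ W, ∀ z ∈ W, lt x y → lt y z → lt x z
  comp : ∀ x ∈ W, ∀ y ∈ W, Far G x y ↔ lt x y ∨ lt y x

namespace OrderOn
variable {G : SimpleGraph V} {W : Finset V} {lt : V → V → Prop}

theorem far (h : OrderOn G W lt) {x y : V} (hx : x ∈ W) (hy : y ∈ W) (hl : lt x y) : Far G x y :=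
  (h.comp x hx y hy).2 (Or.inl hl)

theorem irrefl (h : OrderOn G W lt) {x : V} (hx : x ∈ W) : ¬ lt x x :=
  fun hl => (h.far hx hx hl).1 rfl

theorem asymm (h : OrderOn G W lt) {x y : V} (hx : x ∈ W) (hy : y ∈ W) (hl : lt x y) : ¬ lt y x :=
  fun hl' => h.irrefl hx (h.trans x hx y hy x hx hl hl')

theorem rev (h : OrderOn G W lt) : OrderOn G W (fun x y => lt y x) where
  trans x hx y hy z hz h1 h2 := h.trans z hz y hy x hx h2 h1
  comp x hx y hy := by rw [h.comp x hx y hy]; exact or_comm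

theorem mono (h : OrderOn G W lt) {W' : Finset V} (hW : W' ⊆ W) : OrderOn G W' lt where
  trans x hx y hy z hz := h.trans x (hW hx) y (hW hy) z (hW hz)
  comp x hx y hy := h.comp x (hW hx) y (hW hy)

/-- A connected set outside `N[x]` lies on one side of `x`. -/
theorem side (h : OrderOn G W lt) {P : V → Prop} {x a b : V} (hP : ∀ v, P v → v ∈ W ∧ Far G x v)
    (hx : x ∈ W) (hr : Reach G P a b) (ha : lt a x) : lt b x := by
  induction hr with
  | refl _ => exact ha
  | @tail b c h1 hadj hPc ih =>
    have hb := hP _ h1.right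
    have hc := hP _ hPc
    rcases (h.comp c hc.1 x hx).1 hc.2.symm with h2 | h2
    · exact h2
    · exact absurd hadj (h.far hb.1 hc.1 (h.trans _ hb.1 _ hx _ hc.1 ih h2)).2

end OrderOn

/-- Gluing two orders along a clique. -/
theorem glue {G : SimpleGraph V} (A U B : Finset V) (lt1 lt2 : V → V → Prop)
    [DecidableEq V]
    (hAU : ∀ v ∈ A, v ∉ U) (hAB : ∀ v ∈ A, v ∉ B) (hUB : ∀ v ∈ U, v ∉ B)
    (hU : ∀ u ∈ U, ∀ v ∈ U, ¬ Far G u v)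
    (hno : ∀ a ∈ A, ∀ b ∈ B, ¬ G.Adj a b)
    (h1 : OrderOn G (A ∪ U) lt1) (h2 : OrderOn G (U ∪ B) lt2)
    (h1' : ∀ a ∈ A, ∀ u ∈ U, ¬ lt1 u a) (h2' : ∀ b ∈ B, ∀ u ∈ U, ¬ lt2 b u) :
    ∃ lt, OrderOn G (A ∪ U ∪ B) lt ∧ (∀ x ∈ A ∪ U, ∀ y ∈ A ∪ U, lt x y → lt1 x y) ∧
      (∀ x ∈ A, ∀ y ∈ B, lt x y) := by
  have hUU1 : ∀ u ∈ U, ∀ v ∈ U, ¬ lt1 u v := fun u hu v hv hl =>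
    hU u hu v hv (h1.far (by simp [hu]) (by simp [hv]) hl)
  have hUU2 : ∀ u ∈ U, ∀ v ∈ U, ¬ lt2 u v := fun u hu v hv hl =>
    hU u hu v hv (h2.far (by simp [hu]) (by simp [hv]) hl)
  refine ⟨fun x y => (x ∈ A ∧ y ∈ A ∪ U ∧ lt1 x y) ∨ (x ∈ U ∪ B ∧ y ∈ B ∧ lt2 x y) ∨
    (x ∈ A ∧ y ∈ B), ⟨?_, ?_⟩, ?_, ?_⟩
  · intro x hx y hy z hz hxy hyz
    have t1 := h1.trans x
    have t2 := h2.trans x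
    simp only [Finset.mem_union] at *
    grind
  · intro x hx y hy
    have c1 := h1.comp x
    have c2 := h2.comp x
    have f1 : x ∈ A → y ∈ B → Far G x y := fun hx' hy' =>
      ⟨fun h => hAB x hx' (h ▸ hy'), hno x hx' y hy'⟩
    have f2 : y ∈ A → x ∈ B → Far G x y := fun hx' hy' =>
      ⟨fun h => hAB y hx' (h ▸ hy'), fun h => hno y hx' x hy' h.symm⟩
    simp only [Finset.mem_union] at *
    grind
  · intro x hx y hy h
    simp only [Finset.mem_union] at *
    grind
  · intro x hx y hy
    exact Or.inr (Or.inr ⟨hx, hy⟩)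

end Graph
end NH

namespace NH
section Order
variable {V : Type}
open Classical in
/-- Component of `r` in `W` minus the closed neighbourhood of `x`. -/
noncomputable def compOf (G : SimpleGraph V) (W : Finset V) (x r : V) : Finset V :=
  W.filter (fun w => Reach G (fun v => v ∈ W ∧ Far G x v) r w)

open Classical in
/-- Attachment set of the component. -/
noncomputable def attOf (G : SimpleGraph V) (W : Finset V) (x r : V) : Finset V :=
  W.filter (fun q => q ∉ compOf G W x r ∧ ∃ c ∈ compOf G W x r, G.Adj c q)

open Classical in
/-- The rest. -/
noncomputable def restOf (G : SimpleGraph V) (W : Finset V) (x r : V) : Finset V :=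
  W.filter (fun q => q ∉ compOf G W x r ∧ q ∉ attOf G W x r)

/-- Summary of the decomposition. -/
structure Sep (G : SimpleGraph V) (W : Finset V) (x r : V) (C Q D : Finset V) : Prop where
  mem : ∀ v, v ∈ W ↔ v ∈ C ∨ v ∈ Q ∨ v ∈ D
  cq : ∀ v ∈ C, v ∉ Q
  cd : ∀ v ∈ C, v ∉ D
  qd : ∀ v ∈ Q, v ∉ D
  rC : r ∈ C
  xD : x ∈ D
  far : ∀ c ∈ C, Far G x c
  adj : ∀ q ∈ Q, G.Adj x q
  cliq : ∀ u ∈ Q, ∀ v ∈ Q, u ≠ v → G.Adj u v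
  no : ∀ c ∈ C, ∀ d ∈ D, ¬ G.Adj c d
  nb : ∀ q ∈ Q, ∃ c ∈ C, G.Adj c q
  conn : ∀ c ∈ C, ∀ c' ∈ C, Reach G (fun v => v ∈ C) c c'
  max : ∀ c, Reach G (fun v => v ∈ W ∧ Far G x v) r c → c ∈ C
  reach : ∀ c ∈ C, Reach G (fun v => v ∈ W ∧ Far G x v) r c

theorem sep {G : SimpleGraph V} (hCH : CH G) {W : Finset V} {x r : V} (hx : x ∈ W) (hr : r ∈ W)
    (hf : Far G x r) : Sep G W x r (compOf G W x r) (attOf G W x r) (restOf G W x r) := by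
  classical
  have memC : ∀ c, c ∈ compOf G W x r ↔ Reach G (fun v => v ∈ W ∧ Far G x v) r c := by
    intro c
    simp only [compOf, Finset.mem_filter]
    exact ⟨fun h => h.2, fun h => ⟨h.right.1, h⟩⟩
  have memQ : ∀ q, q ∈ attOf G W x r ↔
      q ∈ W ∧ q ∉ compOf G W x r ∧ ∃ c ∈ compOf G W x r, G.Adj c q := by
    intro q; simp [attOf]
  have memD : ∀ q, q ∈ restOf G W x r ↔
      q ∈ W ∧ q ∉ compOf G W x r ∧ q ∉ attOf G W x r := by
    intro q; simp [restOf]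
  have rC : r ∈ compOf G W x r := (memC r).2 (.refl ⟨hr, hf⟩)
  have far : ∀ c ∈ compOf G W x r, Far G x c := fun c hc => ((memC c).1 hc).right.2
  have adj : ∀ q ∈ attOf G W x r, G.Adj x q := by
    intro q hq
    obtain ⟨hqW, hqC, c, hc, hcq⟩ := (memQ q).1 hq
    by_contra hn
    apply hqC
    refine (memC q).2 (.tail ((memC c).1 hc) hcq ⟨hqW, ?_, hn⟩)
    rintro rfl
    exact (far c hc).2 hcq.symm
  have conn1 : ∀ c ∈ compOf G W x r, Reach G (fun v => v ∈ compOf G W x r) r c := by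
    intro c hc
    have h := (memC c).1 hc
    clear hc
    induction h with
    | refl h => exact .refl rC
    | tail h1 ha hP ih => exact .tail ih ha ((memC _).2 (.tail h1 ha hP))
  have conn : ∀ c ∈ compOf G W x r, ∀ c' ∈ compOf G W x r,
      Reach G (fun v => v ∈ compOf G W x r) c c' :=
    fun c hc c' hc' => (conn1 c hc).symm.trans (conn1 c' hc')
  have subW : ∀ c ∈ compOf G W x r, c ∈ W := fun c hc => ((memC c).1 hc).right.1
  refine ⟨?_, ?_, ?_, ?_, rC, ?_, far, adj, ?_, ?_, ?_, conn, fun c h => (memC c).2 h,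
    fun c h => (memC c).1 h⟩
  · intro v
    rw [memD, memQ]
    have := subW v
    tauto
  · intro v hv hq; exact ((memQ v).1 hq).2.1 hv
  · intro v hv hq; exact ((memD v).1 hq).2.1 hv
  · intro v hv hq; exact ((memD v).1 hq).2.2 hv
  · rw [memD]
    exact ⟨hx, fun h => (far x h).1 rfl, fun h => G.irrefl (adj x h)⟩
  · intro u hu v hv huv
    by_contra hn
    obtain ⟨-, -, c, hc, hcu⟩ := (memQ u).1 hu
    obtain ⟨-, -, c', hc', hcv⟩ := (memQ v).1 hv
    exact hCH x u v c c' (adj u hu) (adj v hv) huv hn hcu.symm hcv.symm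
      ((conn c hc c' hc').mono far)
  · intro c hc d hd hcd
    obtain ⟨hdW, hdC, hdQ⟩ := (memD d).1 hd
    exact hdQ ((memQ d).2 ⟨hdW, hdC, c, hc, hcd⟩)
  · intro q hq; exact ((memQ q).1 hq).2.2

/-- Some vertex of `C` is complete to `Q`. -/
theorem Sep.complete {G : SimpleGraph V} (hCH : CH G) {W : Finset V} {x r : V} {C Q D : Finset V}
    (h : Sep G W x r C Q D) : ∃ c ∈ C, ∀ q ∈ Q, G.Adj c q := by
  classical
  obtain ⟨c, hc, hmax⟩ := Finset.exists_max_image C (fun c => (Q.filter (G.Adj c)).card) ⟨r, h.rC⟩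
  refine ⟨c, hc, ?_⟩
  by_contra! hq
  obtain ⟨q, hqQ, hcq⟩ := hq
  obtain ⟨d, hd, hdq⟩ := h.nb q hqQ
  have hcf : Far G q c := ⟨fun e => h.cq c hc (e ▸ hqQ), fun e => hcq e.symm⟩
  obtain ⟨k, e, hr, hke, heC, heS⟩ := (h.conn c hc d hd).exit (S := fun v => Far G q v) hcf
    (fun hf => hf.2 hdq.symm)
  have hqe : G.Adj q e := by
    by_contra hn
    exact heS ⟨fun e' => h.cq e heC (e' ▸ hqQ), hn⟩
  have hsub : Q.filter (G.Adj c) ⊂ Q.filter (G.Adj e) := by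
    refine Finset.ssubset_iff_of_subset ?_ |>.2 ⟨q, by simp [hqQ, hqe.symm], by simp [hcq]⟩
    intro q0 h0
    simp only [Finset.mem_filter] at h0 ⊢
    refine ⟨h0.1, ?_⟩
    by_contra hn
    have hne : q ≠ q0 := fun e' => hcq (e' ▸ h0.2)
    refine hCH q q0 e c k (h.cliq q hqQ q0 h0.1 hne) hqe ?_ (fun h' => hn h'.symm) h0.2.symm hke.symm
      (hr.mono (fun v hv => hv.2))
    rintro rfl
    exact h.cq _ heC h0.1
  exact absurd (hmax e heC) (not_le.2 (Finset.card_lt_card hsub))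

theorem Root.mono {G : SimpleGraph V} {W W' : Finset V} {r : V} (h : Root G W r) (hW : W' ⊆ W) :
    Root G W' r := fun x y h1 h2 =>
  h x y (h1.mono fun v hv => ⟨hW hv.1, hv.2⟩) (h2.mono fun v hv => ⟨hW hv.1, hv.2⟩)

/-- Rooted existence of orders at size below `n`. -/
def Eprop (G : SimpleGraph V) (n : ℕ) : Prop :=
  ∀ W : Finset V, W.card = n → ∀ r ∈ W, Root G W r →
    ∃ lt, OrderOn G W lt ∧ ∀ x ∈ W, ¬ lt x r

/-- Unrooted existence. -/
def Tprop (G : SimpleGraph V) (n : ℕ) : Prop :=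
  ∀ W : Finset V, W.card = n → ∃ lt, OrderOn G W lt

theorem E_case1 {G : SimpleGraph V} (hCH : CH G) {n : ℕ} (hE : ∀ m < n, Eprop G m)
    {W : Finset V} (hW : W.card = n) {r : V} (hroot : Root G W r) {x : V}
    {C Q D : Finset V} (h : Sep G W x r C Q D) (hC : 1 < C.card) (hD : 1 < D.card) :
    ∃ lt, OrderOn G W lt ∧ ∀ x ∈ W, ¬ lt x r := by
  classical
  have hWeq : W = C ∪ Q ∪ D := by ext v; simp [h.mem v, or_assoc]
  obtain ⟨d, hd, hdx⟩ := Finset.exists_mem_ne hD x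
  have hsub1 : C ∪ Q ∪ {x} ⊂ W := by
    refine (Finset.ssubset_iff_of_subset ?_).2 ⟨d, (h.mem d).2 (by tauto), ?_⟩
    · intro v; simp only [Finset.mem_union, Finset.mem_singleton, h.mem v]
      have := h.xD
      grind
    · have := h.cd d; have := h.qd d; simp; grind
  obtain ⟨lt1, ho1, hm1⟩ := hE _ (hW ▸ Finset.card_lt_card hsub1) _ rfl r (by simp [h.rC])
    (hroot.mono hsub1.1)
  obtain ⟨c0, hc0, hc0Q⟩ := h.complete hCH
  obtain ⟨c1, hc1, hc10⟩ := Finset.exists_mem_ne hC c0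
  have hsub2 : Q ∪ D ∪ {c0} ⊂ W := by
    refine (Finset.ssubset_iff_of_subset ?_).2 ⟨c1, (h.mem c1).2 (by tauto), ?_⟩
    · intro v; simp only [Finset.mem_union, Finset.mem_singleton, h.mem v]
      grind
    · have := h.cd c1; have := h.cq c1; simp; grind
  have hCfar : ∀ y ∈ D, ∀ c ∈ C, Far G y c := fun y hy c hc =>
    ⟨fun e => h.cd c hc (e ▸ hy), fun e => h.no c hc y hy e.symm⟩
  have hCW : ∀ c ∈ C, c ∈ W := fun c hc => (h.mem c).2 (Or.inl hc)
  have hroot2 : Root G (Q ∪ D ∪ {c0}) c0 := by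
    intro y y' h1 h2
    have hyD : ∀ y, y ∈ Q ∪ D ∪ {c0} → Far G y c0 → y ∈ D := by
      intro y hy hf
      simp only [Finset.mem_union, Finset.mem_singleton] at hy
      rcases hy with (hy | hy) | hy
      · exact absurd (hc0Q y hy).symm hf.2
      · exact hy
      · exact absurd hy.symm hf.1
    have hy := hyD y h1.left.1 h2.right.2
    have hy' := hyD y' h2.left.1 h1.right.2
    refine hroot y y' ?_ ?_
    · exact (h1.mono fun v hv => ⟨hsub2.1 hv.1, hv.2⟩).trans
        ((h.conn c0 hc0 r h.rC).mono fun v hv => ⟨hCW v hv, hCfar y' hy' v hv⟩)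
    · exact (h2.mono fun v hv => ⟨hsub2.1 hv.1, hv.2⟩).trans
        ((h.conn c0 hc0 r h.rC).mono fun v hv => ⟨hCW v hv, hCfar y hy v hv⟩)
  obtain ⟨lt2, ho2, hm2⟩ := hE _ (hW ▸ Finset.card_lt_card hsub2) _ rfl c0 (by simp) hroot2
  have hCx : ∀ c ∈ C, lt1 c x := by
    have hrx : lt1 r x := by
      rcases (ho1.comp r (by simp [h.rC]) x (by simp)).1 (h.far r h.rC).symm with h' | h'
      · exact h'
      · exact absurd h' (hm1 x (by simp))
    intro c hc
    exact ho1.side (P := fun v => v ∈ C) (fun v hv => ⟨by simp [hv], h.far v hv⟩) (by simp)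
      (h.conn r h.rC c hc) hrx
  obtain ⟨lt, ho, hl1, hl2⟩ := glue C Q D lt1 lt2 h.cq h.cd h.qd
    (fun u hu v hv hf => hf.2 (h.cliq u hu v hv hf.1.symm)) h.no
    (ho1.mono Finset.subset_union_left) (ho2.mono Finset.subset_union_left)
    (by
      intro c hc q hq hl
      have := ho1.trans q (by simp [hq]) c (by simp [hc]) x (by simp) hl (hCx c hc)
      exact (ho1.far (by simp [hq]) (by simp) this).2 (h.adj q hq).symm)
    (by
      intro b hb q hq hl
      have hcb : lt2 c0 b := by
        rcases (ho2.comp c0 (by simp) b (by simp [hb])).1 (hCfar b hb c0 hc0).symm with h' | h'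
        · exact h'
        · exact absurd h' (hm2 b (by simp [hb]))
      have := ho2.trans c0 (by simp) b (by simp [hb]) q (by simp [hq]) hcb hl
      exact (ho2.far (by simp) (by simp [hq]) this).2 (hc0Q q hq))
  rw [← hWeq] at ho
  refine ⟨lt, ho, ?_⟩
  intro v hv hl
  have hrW := hCW r h.rC
  by_cases hvD : v ∈ D
  · exact ho.asymm hrW hv (hl2 r h.rC v hvD) hl
  · have hv' : v ∈ C ∪ Q := by have := (h.mem v).1 hv; simp; tauto
    exact hm1 v (Finset.mem_union_left _ hv') (hl1 v hv' r (by simp [h.rC]) hl)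

set_option maxHeartbeats 4000000 in
theorem E_case2 {G : SimpleGraph V} (hCH : CH G) (hATF : ATF G) {n : ℕ}
    (hE : ∀ m < n, Eprop G m) (hT : ∀ m < n, Tprop G m)
    {W : Finset V} (hW : W.card = n) {r : V} (hr : r ∈ W) (hroot : Root G W r)
    (hcase : ∀ x ∈ W, Far G r x → (compOf G W x r).card ≤ 1 ∨ (restOf G W x r).card ≤ 1) :
    ∃ lt, OrderOn G W lt ∧ ∀ x ∈ W, ¬ lt x r := by
  classical
  have hsep : ∀ x ∈ W, Far G r x → Sep G W x r _ _ _ := fun x hx hf => sep hCH hx hr hf.symm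
  -- two vertices whose rest is trivial
  have key : ∀ x ∈ W, ∀ y ∈ W, Far G r x → Far G r y → (restOf G W x r).card ≤ 1 →
      (restOf G W y r).card ≤ 1 → x = y := by
    intro x hx y hy hfx hfy hDx hDy
    by_contra hne
    have sx := hsep x hx hfx
    have sy := hsep y hy hfy
    have hDx' : ∀ v ∈ restOf G W x r, v = x := fun v hv =>
      Finset.card_le_one.1 hDx v hv x sx.xD
    have hDy' : ∀ v ∈ restOf G W y r, v = y := fun v hv =>
      Finset.card_le_one.1 hDy v hv y sy.xD
    by_cases hxy : G.Adj x y
    · have hyQ : y ∈ attOf G W x r := by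
        rcases (sx.mem y).1 hy with h | h | h
        · exact absurd hxy (sx.far y h).2
        · exact h
        · exact absurd (hDx' y h).symm hne
      obtain ⟨c, hc, hcy⟩ := sx.nb y hyQ
      have hcW : c ∈ W := (sx.mem c).2 (Or.inl hc)
      have hyQ' : ∀ v ∈ W, G.Adj y v → v ∈ attOf G W y r := by
        intro v hv hyv
        rcases (sy.mem v).1 hv with h | h | h
        · exact absurd hyv (sy.far v h).2
        · exact h
        · exact absurd hyv (hDy' v h ▸ G.irrefl)
      exact (sx.far c hc).2 (sy.cliq x (hyQ' x hx hxy.symm) c (hyQ' c hcW hcy.symm)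
        (sx.far c hc).1.symm)
    · have hyC : y ∈ compOf G W x r := by
        rcases (sx.mem y).1 hy with h | h | h
        · exact h
        · exact absurd (sx.adj y h) hxy
        · exact absurd (hDx' y h).symm hne
      have hxC : x ∈ compOf G W y r := by
        rcases (sy.mem x).1 hx with h | h | h
        · exact h
        · exact absurd (sy.adj x h).symm hxy
        · exact absurd (hDy' x h) hne
      exact hroot x y (sy.reach x hxC).symm (sx.reach y hyC).symm
  have hpos : ∀ W' : Finset V, W' ⊆ W → r ∉ W' → W'.card < n := by
    intro W' h1 h2
    rw [← hW]
    exact Finset.card_lt_card ((Finset.ssubset_iff_of_subset h1).2 ⟨r, hr, h2⟩)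
  by_cases h2a : ∀ x ∈ W, ¬ Far G r x
  · obtain ⟨lt, ho⟩ := hT _ (hpos (W.erase r) (Finset.erase_subset _ _) (by simp)) _ rfl
    refine ⟨fun x y => x ≠ r ∧ y ≠ r ∧ lt x y, ⟨?_, ?_⟩, ?_⟩
    · rintro x hx y hy z hz ⟨h1, h2, h3⟩ ⟨h4, h5, h6⟩
      exact ⟨h1, h5, ho.trans x (by simp [*]) y (by simp [*]) z (by simp [*]) h3 h6⟩
    · intro x hx y hy
      by_cases hxr : x = r
      · subst hxr; simp [h2a y hy]
      · by_cases hyr : y = r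
        · subst hyr; simp; exact fun h => h2a x hx h.symm
        · rw [ho.comp x (by simp [*]) y (by simp [*])]; simp [*]
    · intro x _ h; exact h.2.1 rfl
  push Not at h2a
  by_cases h2b : ∃ z ∈ W, Far G r z ∧ (compOf G W z r).card ≤ 1
  · obtain ⟨z, hzW, hfz, hCz⟩ := h2b
    have sz := hsep z hzW hfz
    have hCz' : ∀ v ∈ compOf G W z r, v = r := fun v hv =>
      Finset.card_le_one.1 hCz v hv r sz.rC
    have hSQ : ∀ s ∈ W, G.Adj r s → s ∈ attOf G W z r := by
      intro s hs hrs
      rcases (sz.mem s).1 hs with h | h | h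
      · exact absurd hrs (hCz' s h ▸ G.irrefl)
      · exact h
      · exact absurd hrs (sz.no r sz.rC s h)
    have hScl : ∀ s ∈ W, ∀ t ∈ W, G.Adj r s → G.Adj r t → ¬ Far G s t :=
      fun s hs t ht h1 h2 hf => hf.2 (sz.cliq s (hSQ s hs h1) t (hSQ t ht h2) hf.1.symm)
    have hO : ∀ x ∈ W, Far G r x → (∃ s ∈ W, G.Adj r s ∧ ¬ G.Adj x s) →
        (restOf G W x r).card ≤ 1 := by
      rintro x hx hfx ⟨s, hs, hrs, hxs⟩
      refine (hcase x hx hfx).resolve_left fun hC => ?_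
      have sx := hsep x hx hfx
      have hCx' : ∀ v ∈ compOf G W x r, v = r := fun v hv =>
        Finset.card_le_one.1 hC v hv r sx.rC
      rcases (sx.mem s).1 hs with h | h | h
      · exact absurd hrs (hCx' s h ▸ G.irrefl)
      · exact hxs (sx.adj s h)
      · exact absurd hrs (sx.no r sx.rC s h)
    by_cases hOe : ∃ x ∈ W, Far G r x ∧ ∃ s ∈ W, G.Adj r s ∧ ¬ G.Adj x s
    · obtain ⟨x1, hx1, hfx1, s0, hs0, hrs0, hxs0⟩ := hOe
      have huniq : ∀ x ∈ W, Far G r x → x ≠ x1 → ∀ s ∈ W, G.Adj r s → G.Adj x s := by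
        intro x hx hfx hne s hs hrs
        by_contra hn
        exact hne (key x hx x1 hx1 hfx hfx1 (hO x hx hfx ⟨s, hs, hrs, hn⟩)
          (hO x1 hx1 hfx1 ⟨s0, hs0, hrs0, hxs0⟩))
      set Z : Finset V := W.filter (Far G r) with hZ
      have hZm : ∀ v, v ∈ Z ↔ v ∈ W ∧ Far G r v := fun v => by simp [hZ]
      have hrootZ : Root G Z x1 := by
        intro y y' h1 h2
        have hy := (hZm y).1 h1.left.1
        have hy' := (hZm y').1 h2.left.1
        have a1 := huniq y hy.1 hy.2 h2.right.2.1.symm s0 hs0 hrs0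
        have a2 := huniq y' hy'.1 hy'.2 h1.right.2.1.symm s0 hs0 hrs0
        have hs0x : Far G x1 s0 := ⟨by rintro rfl; exact hfx1.2 hrs0, hxs0⟩
        refine hATF y y' x1 ?_ (h2.mono fun v hv => hv.2) (h1.symm.mono fun v hv => hv.2)
        exact .tail (.single a1 h2.right.2.symm hs0x) a2.symm h1.right.2.symm
      obtain ⟨lt, ho, hm⟩ := hE _ (hpos Z (Finset.filter_subset _ _)
        (fun h => ((hZm r).1 h).2.1 rfl)) Z rfl x1 ((hZm x1).2 ⟨hx1, hfx1⟩) hrootZ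
      refine ⟨fun x y => (x = r ∧ y ∈ Z) ∨ (x ∈ Z ∧ y ∈ Z ∧ lt y x) ∨
        (G.Adj r x ∧ y = x1 ∧ ¬ G.Adj x y), ⟨?_, ?_⟩, ?_⟩
      · intro x hx y hy w hw h1 h2
        have t := ho.trans w
        have := hm w
        have nr := (hZm r)
        have ny := (hZm y)
        have := G.irrefl (v := r)
        rcases h1 with ⟨rfl, h1⟩ | ⟨h1, h1', h1''⟩ | ⟨h1, rfl, h1'⟩
        · rcases h2 with ⟨rfl, h2⟩ | ⟨h2, h2', h2''⟩ | ⟨h2, rfl, h2'⟩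
          · exact Or.inl ⟨rfl, h2⟩
          · exact Or.inl ⟨rfl, h2'⟩
          · exact absurd h2 (ny.1 h1).2.2
        · rcases h2 with ⟨rfl, h2⟩ | ⟨h2, h2', h2''⟩ | ⟨h2, rfl, h2'⟩
          · exact absurd rfl (ny.1 h1').2.1
          · exact Or.inr (Or.inl ⟨h1, h2', t h2' y h1' x h1 h2'' h1''⟩)
          · exact absurd h2 (ny.1 h1').2.2
        · rcases h2 with ⟨rfl, h2⟩ | ⟨h2, h2', h2''⟩ | ⟨h2, rfl, h2'⟩
          · exact absurd rfl hfx1.1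
          · exact absurd h2'' (this h2')
          · exact absurd h2 hfx1.2
      · intro x hx y hy
        have cl := hScl x hx y hy
        have c := ho.comp x
        have u1 := huniq x hx
        have u2 := huniq y hy
        have zx := hZm x
        have zy := hZm y
        have hx1Z := (hZm x1).2 ⟨hx1, hfx1⟩
        by_cases hxr : x = r
        · subst hxr
          constructor
          · intro h; exact Or.inl (Or.inl ⟨rfl, zy.2 ⟨hy, h⟩⟩)
          · rintro ((h | h | h) | (h | h | h))
            · exact (zy.1 h.2).2
            · exact (zy.1 h.2.1).2
            · exact absurd h.1 G.irrefl
            · exact (zx.1 h.2).2.symm.elim (fun h _ => absurd rfl h)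
            · exact absurd rfl (zx.1 h.2.1).2.1
            · exact absurd h.2.1.symm hfx1.1
        · by_cases hyr : y = r
          · subst hyr
            constructor
            · intro h; exact Or.inr (Or.inl ⟨rfl, zx.2 ⟨hx, h.symm⟩⟩)
            · rintro ((h | h | h) | (h | h | h))
              · exact absurd h.1 hxr
              · exact (zx.1 h.1).2.symm
              · exact absurd h.2.1.symm hfx1.1
              · exact (zx.1 h.2).2.symm
              · exact (zx.1 h.2.1).2.symm
              · exact absurd h.1 G.irrefl
          · by_cases hxZ : x ∈ Z
            · by_cases hyZ : y ∈ Z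
              · rw [c hxZ y hyZ]
                have h1 := (zx.1 hxZ).2.2
                have h2 := (zy.1 hyZ).2.2
                simp [hxr, hyr, hxZ, hyZ, h1, h2, or_comm]
              · have hy' : G.Adj r y := by
                  by_contra hn; exact hyZ (zy.2 ⟨hy, hyr, hn⟩)
                have h1 := (zx.1 hxZ).2.2
                by_cases hxx : x = x1
                · subst hxx
                  constructor
                  · intro h; exact Or.inr (Or.inr (Or.inr ⟨hy', rfl, fun h' => h.2 h'.symm⟩))
                  · rintro ((h | h | h) | (h | h | h))
                    · exact absurd h.1 hxr
                    · exact absurd h.2.1 hyZ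
                    · exact absurd h.1 h1
                    · exact absurd h.1 hyr
                    · exact absurd h.1 hyZ
                    · exact Far.symm ⟨by rintro rfl; exact hyZ hxZ, h.2.2⟩
                · have := u1 (zx.1 hxZ).2 hxx y hy hy'
                  constructor
                  · intro h; exact absurd this h.2
                  · rintro ((h | h | h) | (h | h | h))
                    · exact absurd h.1 hxr
                    · exact absurd h.2.1 hyZ
                    · exact absurd h.1 h1
                    · exact absurd h.1 hyr
                    · exact absurd h.1 hyZ
                    · exact absurd h.2.1 hxx
            · have hx' : G.Adj r x := by
                by_contra hn; exact hxZ (zx.2 ⟨hx, hxr, hn⟩)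
              by_cases hyZ : y ∈ Z
              · have h1 := (zy.1 hyZ).2.2
                by_cases hyx : y = x1
                · subst hyx
                  constructor
                  · intro h; exact Or.inl (Or.inr (Or.inr ⟨hx', rfl, h.2⟩))
                  · rintro ((h | h | h) | (h | h | h))
                    · exact absurd h.1 hxr
                    · exact absurd h.1 hxZ
                    · exact ⟨by rintro rfl; exact hxZ hyZ, h.2.2⟩
                    · exact absurd h.1 hyr
                    · exact absurd h.2.1 hxZ
                    · exact absurd h.1 h1
                · have := u2 (zy.1 hyZ).2 hyx x hx hx'
                  constructor
                  · intro h; exact absurd this.symm h.2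
                  · rintro ((h | h | h) | (h | h | h))
                    · exact absurd h.1 hxr
                    · exact absurd h.1 hxZ
                    · exact absurd h.2.1 hyx
                    · exact absurd h.1 hyr
                    · exact absurd h.2.1 hxZ
                    · exact absurd h.1 h1
              · have hy' : G.Adj r y := by
                  by_contra hn; exact hyZ (zy.2 ⟨hy, hyr, hn⟩)
                have hn := cl hx' hy'
                have e1 : y ≠ x1 := by rintro rfl; exact hyZ hx1Z
                have e2 : x ≠ x1 := by rintro rfl; exact hxZ hx1Z
                simp [hxr, hyr, hxZ, hyZ, e1, e2, hn]
      · rintro x hx (h | h | h)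
        · exact ((hZm r).1 h.2).2.1 rfl
        · exact ((hZm r).1 h.2.1).2.1 rfl
        · exact hfx1.1 h.2.1.symm
    · push Not at hOe
      set Z : Finset V := W.filter (Far G r) with hZ
      have hZm : ∀ v, v ∈ Z ↔ v ∈ W ∧ Far G r v := fun v => by simp [hZ]
      obtain ⟨lt, ho⟩ := hT _ (hpos Z (Finset.filter_subset _ _)
        (fun h => ((hZm r).1 h).2.1 rfl)) Z rfl
      have hrZ : r ∉ Z := fun h => ((hZm r).1 h).2.1 rfl
      refine ⟨fun x y => (x = r ∧ y ∈ Z) ∨ (x ∈ Z ∧ y ∈ Z ∧ lt x y), ⟨?_, ?_⟩, ?_⟩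
      · intro x hx y hy w hw h1 h2
        have t := ho.trans x
        grind
      · intro x hx y hy
        have c := ho.comp x
        have zx := hZm x
        have zy := hZm y
        by_cases hxZ : x ∈ Z <;> by_cases hyZ : y ∈ Z
        · rw [c hxZ y hyZ]; grind
        · by_cases hyr : y = r
          · subst hyr
            exact iff_of_true (zx.1 hxZ).2.symm (Or.inr (Or.inl ⟨rfl, hxZ⟩))
          · have hy' : G.Adj r y := by
              by_contra hn; exact hyZ (zy.2 ⟨hy, hyr, hn⟩)
            have := hOe x hx (zx.1 hxZ).2 y hy hy'
            refine iff_of_false (fun h => h.2 this) ?_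
            grind
        · by_cases hxr : x = r
          · subst hxr
            exact iff_of_true (zy.1 hyZ).2 (Or.inl (Or.inl ⟨rfl, hyZ⟩))
          · have hx' : G.Adj r x := by
              by_contra hn; exact hxZ (zx.2 ⟨hx, hxr, hn⟩)
            have := hOe y hy (zy.1 hyZ).2 x hx hx'
            refine iff_of_false (fun h => h.2 this.symm) ?_
            grind
        · refine iff_of_false ?_ (by grind)
          intro h
          have hx' : G.Adj r x ∨ x = r := by
            by_contra hn; push Not at hn; exact hxZ (zx.2 ⟨hx, hn.2, hn.1⟩)
          have hy' : G.Adj r y ∨ y = r := by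
            by_contra hn; push Not at hn; exact hyZ (zy.2 ⟨hy, hn.2, hn.1⟩)
          rcases hx' with hx' | rfl <;> rcases hy' with hy' | rfl
          · exact hScl x hx y hy hx' hy' h
          · exact h.2 hx'.symm
          · exact h.2 hy'
          · exact h.1 rfl
      · rintro x hx (h | h)
        · exact hrZ h.2
        · exact hrZ h.2.1
  · push Not at h2b
    have hDall : ∀ x ∈ W, Far G r x → (restOf G W x r).card ≤ 1 := fun x hx hf =>
      (hcase x hx hf).resolve_left (not_le.2 (h2b x hx hf))
    obtain ⟨x1, hx1, hfx1⟩ := h2a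
    have honly : ∀ x ∈ W, Far G r x → x = x1 := fun x hx hf =>
      key x hx x1 hx1 hf hfx1 (hDall x hx hf) (hDall x1 hx1 hfx1)
    have hrootZ : Root G (W.erase r) x1 := by
      intro y y' h1 h2
      have hadj : ∀ y, y ∈ W.erase r → Far G y x1 → G.Adj y r := by
        intro y hy hf
        by_contra hn
        have hy := Finset.mem_erase.1 hy
        exact hf.1 (honly y hy.2 ⟨hy.1, fun h => hn h.symm⟩).symm
      have a1 := hadj y h1.left.1 h2.right.2
      have a2 := hadj y' h2.left.1 h1.right.2
      refine hATF y y' x1 ?_ (h2.mono fun v hv => hv.2) (h1.symm.mono fun v hv => hv.2)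
      exact .tail (.single a1 h2.right.2.symm hfx1.symm) a2.symm h1.right.2.symm
    obtain ⟨lt, ho, hm⟩ := hE _ (hpos (W.erase r) (Finset.erase_subset _ _) (by simp)) _ rfl x1
      (by simp [hx1, hfx1.1]) hrootZ
    refine ⟨fun x y => (x = r ∧ y = x1) ∨ (x ≠ r ∧ y ≠ r ∧ lt y x), ⟨?_, ?_⟩, ?_⟩
    · intro x hx y hy w hw h1 h2
      have t := ho.trans w
      have m := hm w
      have := hfx1.1
      simp only [Finset.mem_erase] at t m
      grind
    · intro x hx y hy
      have c := ho.comp x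
      simp only [Finset.mem_erase] at c
      by_cases hxr : x = r
      · subst hxr
        constructor
        · intro h; exact Or.inl (Or.inl ⟨rfl, honly y hy h⟩)
        · rintro ((h | h) | (h | h))
          · exact h.2 ▸ hfx1
          · exact absurd rfl h.1
          · exact absurd h.2.symm hfx1.1
          · exact absurd rfl h.2.1
      · by_cases hyr : y = r
        · subst hyr
          constructor
          · intro h; exact Or.inr (Or.inl ⟨rfl, honly x hx h.symm⟩)
          · rintro ((h | h) | (h | h))
            · exact absurd h.1 hxr
            · exact absurd rfl h.2.1
            · exact h.2 ▸ hfx1.symm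
            · exact absurd rfl h.1
        · rw [c ⟨hxr, hx⟩ y ⟨hyr, hy⟩]
          simp [hxr, hyr, or_comm]
    · rintro x hx (h | h)
      · exact hfx1.1 h.2.symm
      · exact h.2.1 rfl

theorem T_step {G : SimpleGraph V} (hCH : CH G) (hATF : ATF G) {n : ℕ}
    (hE : Eprop G n) (hT : ∀ m < n, Tprop G m) : Tprop G n := by
  classical
  intro W hW
  by_cases hcomp : ∀ x ∈ W, ∀ y ∈ W, ¬ Far G x y
  · exact ⟨fun _ _ => False, ⟨by simp, by simpa using hcomp⟩⟩
  push Not at hcomp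
  obtain ⟨r0, hr0, w0, hw0, hf0⟩ := hcomp
  obtain ⟨⟨r, w⟩, hp, hmax⟩ := Finset.exists_max_image
    ((W ×ˢ W).filter (fun p => Far G p.1 p.2)) (fun p => (compOf G W p.1 p.2).card)
    ⟨(r0, w0), by simp [hr0, hw0, hf0]⟩
  simp only [Finset.mem_filter, Finset.mem_product] at hp hmax
  obtain ⟨⟨hr, hw⟩, hf⟩ := hp
  have s := sep hCH hr hw hf
  set C := compOf G W r w with hC
  set Q := attOf G W r w with hQ
  set D := restOf G W r w with hD
  have hsubW : ∀ c ∈ C, c ∈ W := fun c hc => (s.mem c).2 (Or.inl hc)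
  have hDQ : ∀ d ∈ D, ∀ q ∈ Q, G.Adj d q := by
    intro d hd q hq
    by_contra hn
    have hdW : d ∈ W := (s.mem d).2 (by tauto)
    have hqW : q ∈ W := (s.mem q).2 (by tauto)
    have hdq : Far G d q := ⟨fun e => s.qd q hq (e ▸ hd), hn⟩
    have s2 := sep hCH hdW hqW hdq
    obtain ⟨c0, hc0, hcq⟩ := s.nb q hq
    have hCd : ∀ c ∈ C, c ∈ W ∧ Far G d c := fun c hc =>
      ⟨hsubW c hc, fun e => s.cd c hc (e ▸ hd), fun e => s.no c hc d hd e.symm⟩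
    have hss : C ⊂ compOf G W d q := by
      refine (Finset.ssubset_iff_of_subset ?_).2 ⟨q, s2.rC, fun h => s.cq q h hq⟩
      intro c hc
      exact s2.max c (.head hcq.symm ⟨hqW, hdq⟩ ((s.conn c0 hc0 c hc).mono hCd))
    exact absurd (hmax (d, q) ⟨⟨hdW, hqW⟩, hdq⟩) (not_le.2 (Finset.card_lt_card hss))
  by_cases hD1 : D.card ≤ 1
  · have hD' : ∀ v ∈ D, v = r := fun v hv => Finset.card_le_one.1 hD1 v hv r s.xD
    have hroot : Root G W r := by
      intro y y' h1 h2
      have hyC : ∀ y ∈ W, Far G y r → y ∈ C := by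
        intro y hy hf
        rcases (s.mem y).1 hy with h | h | h
        · exact h
        · exact absurd (s.adj y h).symm hf.2
        · exact absurd (hD' y h).symm hf.1
      have hy := hyC y h1.left.1 h2.right.2
      have hy' := hyC y' h2.left.1 h1.right.2
      exact hATF y y' r ((s.conn y hy y' hy').mono s.far) (h2.mono fun v hv => hv.2)
        (h1.symm.mono fun v hv => hv.2)
    obtain ⟨lt, ho, -⟩ := hE W hW r hr hroot
    exact ⟨lt, ho⟩
  · have hWeq : W = C ∪ Q ∪ D := by ext v; simp [s.mem v, or_assoc]
    obtain ⟨d, hd, hdx⟩ := Finset.exists_mem_ne (not_le.1 hD1) r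
    have hsub1 : C ∪ Q ∪ {r} ⊂ W := by
      refine (Finset.ssubset_iff_of_subset ?_).2 ⟨d, (s.mem d).2 (by tauto), ?_⟩
      · intro v; simp only [Finset.mem_union, Finset.mem_singleton, s.mem v]
        have := s.xD
        grind
      · have := s.cd d; have := s.qd d; simp; grind
    have hsub2 : D ⊂ W := by
      refine (Finset.ssubset_iff_of_subset ?_).2 ⟨w, hw, s.cd w s.rC⟩
      intro v hv; exact (s.mem v).2 (by tauto)
    obtain ⟨lt1, ho1, hwr⟩ : ∃ lt1, OrderOn G (C ∪ Q ∪ {r}) lt1 ∧ lt1 w r := by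
      obtain ⟨lt, ho⟩ := hT _ (hW ▸ Finset.card_lt_card hsub1) _ rfl
      rcases (ho.comp w (by simp [s.rC]) r (by simp)).1 hf.symm with h | h
      · exact ⟨lt, ho, h⟩
      · exact ⟨_, ho.rev, h⟩
    obtain ⟨lt2, ho2⟩ := hT _ (hW ▸ Finset.card_lt_card hsub2) _ rfl
    have hCx : ∀ c ∈ C, lt1 c r := fun c hc =>
      ho1.side (P := fun v => v ∈ C) (fun v hv => ⟨by simp [hv], s.far v hv⟩) (by simp)
        (s.conn w s.rC c hc) hwr
    obtain ⟨lt, ho, -⟩ := glue C Q D lt1 (fun x y => x ∈ D ∧ y ∈ D ∧ lt2 x y) s.cq s.cd s.qd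
      (fun u hu v hv hf => hf.2 (s.cliq u hu v hv hf.1.symm)) s.no
      (ho1.mono Finset.subset_union_left)
      (by
        refine ⟨?_, ?_⟩
        · rintro x hx y hy z hz ⟨h1, h2, h3⟩ ⟨h4, h5, h6⟩
          exact ⟨h1, h5, ho2.trans x h1 y h2 z h5 h3 h6⟩
        · intro x hx y hy
          simp only [Finset.mem_union] at hx hy
          by_cases hxD : x ∈ D <;> by_cases hyD : y ∈ D
          · rw [ho2.comp x hxD y hyD]; tauto
          · have := hDQ x hxD y (by tauto)
            exact iff_of_false (fun h => h.2 this) (by tauto)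
          · have := hDQ y hyD x (by tauto)
            exact iff_of_false (fun h => h.2 this.symm) (by tauto)
          · have := s.cliq x (by tauto) y (by tauto)
            exact iff_of_false (fun h => h.2 (this h.1.symm)) (by tauto))
      (by
        intro c hc q hq hl
        have := ho1.trans q (by simp [hq]) c (by simp [hc]) r (by simp) hl (hCx c hc)
        exact (ho1.far (by simp [hq]) (by simp) this).2 (s.adj q hq).symm)
      (by
        rintro b hb q hq ⟨_, h, _⟩
        exact s.qd q hq h)
    exact ⟨lt, hWeq ▸ ho⟩

theorem exists_order {G : SimpleGraph V} (hCH : CH G) (hATF : ATF G) (n : ℕ) :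
    Eprop G n ∧ Tprop G n := by
  induction n using Nat.strong_induction_on with
  | _ n ih =>
    have hE : Eprop G n := by
      intro W hW r hr hroot
      by_cases hcase : ∀ x ∈ W, Far G r x →
          (compOf G W x r).card ≤ 1 ∨ (restOf G W x r).card ≤ 1
      · exact E_case2 hCH hATF (fun m hm => (ih m hm).1) (fun m hm => (ih m hm).2) hW hr hroot hcase
      · push Not at hcase
        obtain ⟨x, hx, hf, h1, h2⟩ := hcase
        exact E_case1 hCH (fun m hm => (ih m hm).1) hW hroot (sep hCH hx hr hf.symm) h1 h2
    exact ⟨hE, T_step hCH hATF hE (fun m hm => (ih m hm).2)⟩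

end Order
end NH

namespace NH
section Paths
variable {V : Type}

/-- A walk of length `n` from `u` to `v` inside `P`. -/
def PathIn (G : SimpleGraph V) (P : V → Prop) (n : ℕ) (u v : V) : Prop :=
  ∃ p : ℕ → V, p 0 = u ∧ p n = v ∧ (∀ i ≤ n, P (p i)) ∧ ∀ i < n, G.Adj (p i) (p (i + 1))

namespace PathIn
variable {G : SimpleGraph V} {P : V → Prop} {n m : ℕ} {u v w : V}

theorem nil (h : P u) : PathIn G P 0 u u := ⟨fun _ => u, rfl, rfl, fun _ _ => h, fun i hi => by omega⟩

theorem cons (hu : P u) (huv : G.Adj u v) (h : PathIn G P n v w) : PathIn G P (n + 1) u w := by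
  obtain ⟨p, h0, hn, hP, ha⟩ := h
  refine ⟨fun i => if i = 0 then u else p (i - 1), by simp, by simp [hn], ?_, ?_⟩
  · intro i hi
    by_cases hi0 : i = 0
    · simpa [hi0] using hu
    · simpa [hi0] using hP (i - 1) (by omega)
  · intro i hi
    by_cases hi0 : i = 0
    · subst hi0; simpa [h0] using huv
    · have := ha (i - 1) (by omega)
      rw [show i - 1 + 1 = i by omega] at this
      simpa [hi0] using this

theorem trans (h : PathIn G P n u v) (h' : PathIn G P m v w) : PathIn G P (n + m) u w := by
  induction n generalizing u with
  | zero =>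
    obtain ⟨p, h0, hn, hP, ha⟩ := h
    rw [← h0, hn]; simpa using h'
  | succ n ih =>
    obtain ⟨p, h0, hn, hP, ha⟩ := h
    rw [show n + 1 + m = (n + m) + 1 by omega]
    refine cons (h0 ▸ hP 0 (by omega)) (h0 ▸ ha 0 (by omega)) (ih ⟨fun i => p (i + 1), rfl, hn, ?_, ?_⟩)
    · intro i hi; exact hP _ (by omega)
    · intro i hi; exact ha _ (by omega)

theorem symm (h : PathIn G P n u v) : PathIn G P n v u := by
  obtain ⟨p, h0, hn, hP, ha⟩ := h
  refine ⟨fun i => p (n - i), by simpa using hn, by simpa using h0, fun i hi => hP _ (by omega), ?_⟩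
  intro i hi
  have := ha (n - (i + 1)) (by omega)
  rw [show n - (i + 1) + 1 = n - i by omega] at this
  exact this.symm

theorem single (hu : P u) (hv : P v) (h : G.Adj u v) : PathIn G P 1 u v := cons hu h (nil hv)

theorem sub {p : ℕ → V} {i j : ℕ} (hij : i ≤ j) (hP : ∀ k, i ≤ k → k ≤ j → P (p k))
    (ha : ∀ k, i ≤ k → k < j → G.Adj (p k) (p (k + 1))) : PathIn G P (j - i) (p i) (p j) := by
  refine ⟨fun k => p (i + k), rfl, by simp; congr 1; omega, ?_, ?_⟩
  · intro k hk; exact hP _ (by omega) (by omega)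
  · intro k hk; exact ha _ (by omega) (by omega)

theorem reach (h : PathIn G P n u v) : Reach G P u v := by
  induction n generalizing u with
  | zero =>
    obtain ⟨p, h0, hn, hP, ha⟩ := h
    rw [← h0, hn]; exact .refl (hn ▸ hP 0 le_rfl)
  | succ n ih =>
    obtain ⟨p, h0, hn, hP, ha⟩ := h
    refine .head (h0 ▸ ha 0 (by omega)) (h0 ▸ hP 0 (by omega)) (ih ⟨fun i => p (i + 1), rfl, hn, ?_, ?_⟩)
    · intro i hi; exact hP _ (by omega)
    · intro i hi; exact ha _ (by omega)

theorem left (h : PathIn G P n u v) : P u := h.reach.left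
theorem right (h : PathIn G P n u v) : P v := h.reach.right

end PathIn

theorem Reach.pathIn {G : SimpleGraph V} {P : V → Prop} {u v : V} (h : Reach G P u v) :
    ∃ n, PathIn G P n u v := by
  induction h with
  | refl h => exact ⟨0, .nil h⟩
  | tail h1 ha hP ih =>
    obtain ⟨n, hn⟩ := ih
    exact ⟨n + 1, hn.trans (.single h1.right hP ha)⟩

/-- Subwalk of a sequence of vertices. -/
theorem reach_seq {G : SimpleGraph V} {P : V → Prop} {p : ℕ → V} {i j : ℕ} (hij : i ≤ j)
    (hP : ∀ k, i ≤ k → k ≤ j → P (p k))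
    (ha : ∀ k, i ≤ k → k < j → G.Adj (p k) (p (k + 1))) : Reach G P (p i) (p j) :=
  (PathIn.sub hij hP ha).reach

/-- An induced path inside `P`. -/
structure IPath (G : SimpleGraph V) (P : V → Prop) (n : ℕ) (u v : V) (p : ℕ → V) : Prop where
  h0 : p 0 = u
  hn : p n = v
  inP : ∀ i ≤ n, P (p i)
  adj : ∀ i < n, G.Adj (p i) (p (i + 1))
  far : ∀ i j, i + 1 < j → j ≤ n → Far G (p i) (p j)

/-- A shortest walk is an induced path. -/
theorem PathIn.induced {G : SimpleGraph V} {P : V → Prop} {n : ℕ} {u v : V} (h : PathIn G P n u v)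
    (hmin : ∀ m, PathIn G P m u v → n ≤ m) : ∃ p, IPath G P n u v p := by
  obtain ⟨p, h0, hn, hP, ha⟩ := h
  have sub : ∀ i j, i ≤ j → j ≤ n → PathIn G P (j - i) (p i) (p j) := fun i j hij hj =>
    PathIn.sub hij (fun k _ hk => hP k (by omega)) (fun k _ hk => ha k (by omega))
  refine ⟨p, h0, hn, hP, ha, ?_⟩
  intro i j hij hj
  constructor
  · intro he
    have h1 := sub 0 i (by omega) (by omega)
    have h2 := sub j n (by omega) (by omega)
    rw [he] at h2
    have := hmin _ (h0 ▸ hn ▸ h1.trans h2)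
    omega
  · intro he
    have h1 := sub 0 i (by omega) (by omega)
    have h2 := sub j n (by omega) (by omega)
    have := hmin _ (h0 ▸ hn ▸ h1.trans (.cons (hP i (by omega)) he h2))
    omega

/-- Asteroidal triple with path lengths. -/
def AT (G : SimpleGraph V) (x y z : V) (A B C : ℕ) : Prop :=
  PathIn G (Far G z) A x y ∧ PathIn G (Far G x) B y z ∧ PathIn G (Far G y) C z x

/-- An asteroidal triple of minimal total length. -/
def MinAT (G : SimpleGraph V) (x y z : V) (A B C : ℕ) : Prop :=
  AT G x y z A B C ∧ ∀ x' y' z' A' B' C', AT G x' y' z' A' B' C' → A + B + C ≤ A' + B' + C'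

theorem MinAT.rot {G : SimpleGraph V} {x y z : V} {A B C : ℕ} (h : MinAT G x y z A B C) :
    MinAT G y z x B C A :=
  ⟨⟨h.1.2.1, h.1.2.2, h.1.1⟩, fun x' y' z' A' B' C' h' => by
    have := h.2 x' y' z' A' B' C' h'; omega⟩

theorem MinAT.refl {G : SimpleGraph V} {x y z : V} {A B C : ℕ} (h : MinAT G x y z A B C) :
    MinAT G y x z A C B :=
  ⟨⟨h.1.1.symm, h.1.2.2.symm, h.1.2.1.symm⟩, fun x' y' z' A' B' C' h' => by
    have := h.2 x' y' z' A' B' C' h'; omega⟩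

theorem MinAT.path {G : SimpleGraph V} {x y z : V} {A B C : ℕ} (h : MinAT G x y z A B C) :
    ∃ p, IPath G (Far G z) A x y p :=
  h.1.1.induced fun m hm => by
    have := h.2 x y z m B C ⟨hm, h.1.2.1, h.1.2.2⟩
    omega

theorem MinAT.two_le {G : SimpleGraph V} {x y z : V} {A B C : ℕ} (h : MinAT G x y z A B C) :
    2 ≤ A := by
  obtain ⟨p, hp⟩ := h.path
  have hf : Far G x y := h.1.2.1.left
  by_contra hA
  rcases (by omega : A = 0 ∨ A = 1) with rfl | rfl
  · exact hf.1 (hp.hn.symm.trans hp.h0)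
  · have := hp.adj 0 (by omega)
    rw [hp.h0] at this
    exact hf.2 (hp.hn ▸ this)

theorem exists_minAT {G : SimpleGraph V} (h : ¬ ATF G) : ∃ x y z A B C, MinAT G x y z A B C := by
  classical
  have hex : ∃ n, ∃ x y z A B C, AT G x y z A B C ∧ A + B + C = n := by
    simp only [ATF] at h
    push Not at h
    obtain ⟨x, y, z, h1, h2, h3⟩ := h
    obtain ⟨A, hA⟩ := h1.pathIn
    obtain ⟨B, hB⟩ := h2.pathIn
    obtain ⟨C, hC⟩ := h3.1.pathIn
    exact ⟨_, x, y, z, A, B, C, ⟨hA, hB, hC⟩, rfl⟩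
  obtain ⟨x, y, z, A, B, C, hat, hs⟩ := Nat.find_spec hex
  refine ⟨x, y, z, A, B, C, hat, fun x' y' z' A' B' C' h' => ?_⟩
  rw [hs]
  exact Nat.find_min' hex ⟨x', y', z', A', B', C', h', rfl⟩

/-- No vertex is joined to three others by walks avoiding the neighbourhoods of the remaining two. -/
def TRI (G : SimpleGraph V) : Prop :=
  ∀ w x y z, Reach G (fun v => Far G y v ∧ Far G z v) w x →
    Reach G (fun v => Far G x v ∧ Far G z v) w y →
    Reach G (fun v => Far G x v ∧ Far G y v) w z → False

theorem minAT_long {G : SimpleGraph V} (hCH : CH G) (hTRI : TRI G) {x y z : V} {A B C : ℕ}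
    (h : MinAT G x y z A B C) (hB : 4 ≤ B) (hC : 3 ≤ C) : False := by
  obtain ⟨p, hp⟩ := h.path
  obtain ⟨q, hq⟩ := h.rot.path
  obtain ⟨m, hm⟩ := h.rot.rot.path
  have hA := h.two_le
  have minB : ∀ k, PathIn G (Far G x) k y z → B ≤ k := fun k hk => by
    have := h.2 x y z A k C ⟨h.1.1, hk, h.1.2.2⟩; omega
  have fxy : Far G x y := h.1.2.1.left
  have fyz : Far G y z := h.1.2.2.left
  have fzx : Far G z x := h.1.1.left
  -- far facts
  have q_y : ∀ i, 2 ≤ i → i ≤ B → Far G y (q i) := fun i hi hi' => hq.h0 ▸ hq.far 0 i (by omega) hi'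
  have q_z : ∀ i, i + 2 ≤ B → Far G z (q i) := fun i hi => (hq.hn ▸ hq.far i B (by omega) le_rfl).symm
  have m_z : ∀ i, 2 ≤ i → i ≤ C → Far G z (m i) := fun i hi hi' => hm.h0 ▸ hm.far 0 i (by omega) hi'
  have m_x : ∀ i, i + 2 ≤ C → Far G x (m i) := fun i hi => (hm.hn ▸ hm.far i C (by omega) le_rfl).symm
  have p_x : ∀ i, 2 ≤ i → i ≤ A → Far G x (p i) := fun i hi hi' => hp.h0 ▸ hp.far 0 i (by omega) hi'
  have p_y : ∀ i, i + 2 ≤ A → Far G y (p i) := fun i hi => (hp.hn ▸ hp.far i A (by omega) le_rfl).symm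
  have yq1 : G.Adj y (q 1) := hq.h0 ▸ hq.adj 0 (by omega)
  have zm1 : G.Adj z (m 1) := hm.h0 ▸ hm.adj 0 (by omega)
  have q12 : G.Adj (q 1) (q 2) := hq.adj 1 (by omega)
  have q23 : G.Adj (q 2) (q 3) := hq.adj 2 (by omega)
  have pky : G.Adj (p (A - 1)) y := by
    have := hp.adj (A - 1) (by omega)
    rwa [show A - 1 + 1 = A by omega, hp.hn] at this
  -- connections of `q 2` to `y` and `z`
  have w_y : Reach G (fun v => Far G x v ∧ Far G z v) (q 2) y := by
    refine .symm (.head yq1 ⟨fxy, fyz.symm⟩ (.single q12 ?_ ?_))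
    · exact ⟨hq.inP 1 (by omega), q_z 1 (by omega)⟩
    · exact ⟨hq.inP 2 (by omega), q_z 2 (by omega)⟩
  have w_z : Reach G (fun v => Far G x v ∧ Far G y v) (q 2) z := by
    rw [← hq.hn]
    exact reach_seq (by omega) (fun k h1 h2 => ⟨hq.inP k h2, q_y k h1 h2⟩)
      (fun k _ hk => hq.adj k hk)
  have w_P : Far G y (q 2) ∧ Far G z (q 2) := ⟨q_y 2 le_rfl (by omega), q_z 2 (by omega)⟩
  have m_q2 : ∀ i, 2 ≤ i → i ≤ C → Far G (q 2) (m i) := by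
    intro i hi hiC
    have r1 : Reach G (fun v => Far G y v ∧ Far G z v) (m i) x := by
      rw [← hm.hn]
      exact reach_seq hiC (fun k h1 h2 => ⟨hm.inP k h2, m_z k (by omega) h2⟩)
        (fun k _ hk => hm.adj k hk)
    refine ⟨fun e => ?_, fun e => ?_⟩
    · exact hTRI (q 2) x y z (e ▸ r1) w_y w_z
    · exact hTRI (q 2) x y z (.head e w_P r1) w_y w_z
  have p_q2 : ∀ i, i + 2 ≤ A → Far G (q 2) (p i) := by
    intro i hi
    have r1 : Reach G (fun v => Far G y v ∧ Far G z v) (p i) x := by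
      rw [← hp.h0]
      exact (reach_seq (Nat.zero_le i) (fun k h1 h2 => ⟨p_y k (by omega), hp.inP k (by omega)⟩)
        (fun k _ hk => hp.adj k (by omega))).symm
    refine ⟨fun e => ?_, fun e => ?_⟩
    · exact hTRI (q 2) x y z (e ▸ r1) w_y w_z
    · exact hTRI (q 2) x y z (.head e w_P r1) w_y w_z
  have m1_ne : m 1 ≠ q 2 := fun e => w_P.2.2 (e ▸ zm1)
  have pk_ne : p (A - 1) ≠ q 2 := fun e => w_P.1.2 (e ▸ pky.symm)
  have m1_y : Far G y (m 1) := hm.inP 1 (by omega)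
  have m1_x : Far G x (m 1) := m_x 1 (by omega)
  have m_seq : ∀ i, 2 ≤ i → i ≤ C → Reach G (Far G (q 2)) (m i) x := by
    intro i hi hi'
    rw [← hm.hn]
    exact reach_seq hi' (fun k h1 h2 => m_q2 k (by omega) h2) (fun k _ hk => hm.adj k hk)
  -- the vertex v
  obtain ⟨v, b, hqv, hvb, hbx, hv⟩ : ∃ v b, G.Adj (q 2) v ∧ G.Adj v b ∧ Reach G (Far G (q 2)) b x ∧
      (v = m 1 ∨ v = q 3) := by
    by_cases hm1 : G.Adj (q 2) (m 1)
    · exact ⟨m 1, m 2, hm1, hm.adj 1 (by omega), m_seq 2 le_rfl (by omega), Or.inl rfl⟩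
    · refine ⟨q 3, q 4, q23, hq.adj 3 (by omega), ?_, Or.inr rfl⟩
      have r1 : Reach G (Far G (q 2)) (q 4) (q B) :=
        reach_seq hB (fun k h1 h2 => hq.far 2 k (by omega) h2) (fun k _ hk => hq.adj k hk)
      have r2 : Reach G (Far G (q 2)) (m 1) x :=
        .head (hm.adj 1 (by omega)) ⟨m1_ne, hm1⟩ (m_seq 2 le_rfl (by omega))
      rw [hq.hn] at r1
      exact r1.trans (.head zm1 r1.right r2)
  have q1m1 : ¬ G.Adj (q 1) (m 1) := by
    intro e
    have := minB _ (.cons fxy yq1 (.cons (hq.inP 1 (by omega)) e (.single m1_x fzx.symm zm1.symm)))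
    omega
  have q1v : q 1 ≠ v ∧ ¬ G.Adj (q 1) v := by
    rcases hv with rfl | rfl
    · exact ⟨fun e => m1_y.2 (e ▸ yq1), q1m1⟩
    · have := hq.far 1 3 (by omega) (by omega)
      exact ⟨this.1.symm, this.2⟩
  by_cases hpk : G.Adj (q 2) (p (A - 1))
  · by_cases hA3 : 3 ≤ A
    · have pkx : Far G x (p (A - 1)) := p_x _ (by omega) (by omega)
      have hpv : p (A - 1) ≠ v ∧ ¬ G.Adj (p (A - 1)) v := by
        rcases hv with rfl | rfl
        · refine ⟨fun e => m1_y.2 (e ▸ pky.symm), fun e => ?_⟩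
          have := minB _ (.cons fxy pky.symm (.cons pkx e (.single m1_x fzx.symm zm1.symm)))
          omega
        · refine ⟨fun e => (q_y 3 (by omega) (by omega)).2 (e ▸ pky.symm), fun e => ?_⟩
          have h3 : PathIn G (Far G x) (B - 3) (q 3) (q B) :=
            PathIn.sub (by omega) (fun k _ hk => hq.inP k hk) (fun k _ hk => hq.adj k hk)
          rw [hq.hn] at h3
          have := minB _ (.cons fxy pky.symm (.cons pkx e h3))
          omega
      have ha : G.Adj (p (A - 1)) (p (A - 2)) := by
        have := hp.adj (A - 2) (by omega)
        rw [show A - 2 + 1 = A - 1 by omega] at this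
        exact this.symm
      have r : Reach G (Far G (q 2)) (p (A - 2)) x := by
        rw [← hp.h0]
        exact (reach_seq (Nat.zero_le _) (fun k _ hk => p_q2 k (by omega))
          (fun k _ hk => hp.adj k (by omega))).symm
      exact hCH (q 2) (p (A - 1)) v (p (A - 2)) b hpk hqv hpv.1 hpv.2 ha hvb (r.trans hbx.symm)
    · have hA2 : A = 2 := by omega
      subst hA2
      simp only [Nat.add_one_sub_one, show 2 - 1 = 1 from rfl] at hpk pky pk_ne
      have xp : G.Adj x (p 1) := hp.h0 ▸ hp.adj 0 (by omega)
      have q1x : Far G x (q 1) := hq.inP 1 (by omega)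
      have pq1 : G.Adj (p 1) (q 1) := by
        by_contra hn
        refine hCH y (p 1) (q 1) (q 2) (q 2) pky.symm yq1 ?_ hn hpk.symm q12 (.refl w_P.1)
        intro e
        exact q1x.2 (e ▸ xp)
      have q1z : Far G z (q 1) := q_z 1 (by omega)
      have hmq1 : ∀ i ≤ C, Far G (q 1) (m i) := by
        intro i hi
        refine ⟨fun e => (hm.inP i hi).2 (e ▸ yq1), fun e => ?_⟩
        rcases (by omega : i = 0 ∨ i = 1 ∨ (2 ≤ i ∧ i + 2 ≤ C) ∨ i = C - 1 ∨ i = C) with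
          rfl | rfl | ⟨h2, h3⟩ | rfl | rfl
        · rw [hm.h0] at e; exact q1z.2 e.symm
        · exact q1m1 e
        · refine hTRI (m i) x y z ?_ ?_ ?_
          · rw [← hm.hn]
            exact reach_seq hi (fun k h1 h2 => ⟨hm.inP k h2, m_z k (by omega) h2⟩)
              (fun k _ hk => hm.adj k hk)
          · exact .head e.symm ⟨m_x i h3, m_z i h2 hi⟩
              (.single yq1.symm ⟨q1x, q1z⟩ ⟨fxy, fyz.symm⟩)
          · rw [← hm.h0]
            exact (reach_seq (Nat.zero_le i) (fun k h1 h2 => ⟨m_x k (by omega), hm.inP k (by omega)⟩)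
              (fun k _ hk => hm.adj k (by omega))).symm
        · exact hCH (q 2) (q 1) v (m (C - 1)) b q12.symm hqv q1v.1 q1v.2 e hvb
            ((m_seq (C - 1) (by omega) (by omega)).trans hbx.symm)
        · rw [hm.hn] at e; exact q1x.2 e.symm
      have h1 : PathIn G (Far G z) 2 x (q 1) :=
        .cons fzx xp (.single (hp.inP 1 (by omega)) q1z pq1)
      have h2 : PathIn G (Far G x) (B - 1) (q 1) (q B) :=
        PathIn.sub (by omega) (fun k _ hk => hq.inP k hk) (fun k _ hk => hq.adj k hk)
      rw [hq.hn] at h2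
      have h3 : PathIn G (Far G (q 1)) C z x := ⟨m, hm.h0, hm.hn, hmq1, hm.adj⟩
      have := h.2 _ _ _ _ _ _ ⟨h1, h2, h3⟩
      omega
  · have r : Reach G (Far G (q 2)) y x := by
      rw [← hp.h0, ← hp.hn]
      refine (reach_seq (Nat.zero_le _) (fun k _ hk => ?_) (fun k _ hk => hp.adj k hk)).symm
      rcases (by omega : k + 2 ≤ A ∨ k = A - 1 ∨ k = A) with h' | rfl | rfl
      · exact p_q2 k h'
      · exact ⟨pk_ne, hpk⟩
      · rw [hp.hn]; exact w_P.1.symm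
    exact hCH (q 2) (q 1) v y b q12.symm hqv q1v.1 q1v.2 yq1.symm hvb (r.trans hbx.symm)

end Paths
end NH

namespace NH
section Embeddings
variable {V : Type} {G : SimpleGraph V}

theorem emb_of {k : ℕ} (H : SimpleGraph (Fin k)) (f : Fin k → V)
    (h : ∀ i j, i < j → (H.Adj i j ∧ G.Adj (f i) (f j)) ∨ (¬ H.Adj i j ∧ Far G (f i) (f j))) :
    Nonempty (H ↪g G) := by
  have hinj : Function.Injective f := by
    intro i j hij
    by_contra hne
    rcases lt_or_gt_of_ne hne with hl | hl
    · rcases h i j hl with h' | h'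
      · exact h'.2.ne hij
      · exact h'.2.1 hij.symm
    · rcases h j i hl with h' | h'
      · exact h'.2.ne hij.symm
      · exact h'.2.1 hij
  refine ⟨⟨⟨f, hinj⟩, ?_⟩⟩
  intro i j
  change G.Adj (f i) (f j) ↔ H.Adj i j
  rcases lt_trichotomy i j with hl | rfl | hl
  · rcases h i j hl with h' | h'
    · exact iff_of_true h'.2 h'.1
    · exact iff_of_false h'.2.2 h'.1
  · exact iff_of_false G.irrefl H.irrefl
  · rw [G.adj_comm, H.adj_comm]
    rcases h j i hl with h' | h'
    · exact iff_of_true h'.2 h'.1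
    · exact iff_of_false h'.2.2 h'.1

theorem mk_sun3 {a b c d e f : V} (ab : G.Adj a b) (ac : G.Adj a c) (bc : G.Adj b c)
    (ad : G.Adj a d) (bd : G.Adj b d) (cd : Far G c d)
    (be : G.Adj b e) (ce : G.Adj c e) (ae : Far G a e)
    (cf : G.Adj c f) (af : G.Adj a f) (bf : Far G b f)
    (de : Far G d e) (df : Far G d f) (ef : Far G e f) : Nonempty (sun3 ↪g G) := by
  refine emb_of sun3 ![a, b, c, d, e, f] ?_
  intro i j hij
  fin_cases i <;> fin_cases j <;>
    first
    | exact absurd hij (by decide)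
    | exact Or.inl ⟨by simp [sun3], by assumption⟩
    | exact Or.inr ⟨by simp [sun3], by assumption⟩

/-- The net: a triangle `d e f` with pendant vertices `c`, `a`, `b`. -/
theorem mk_tent {a b c d e f : V} (ab : Far G a b) (ac : Far G a c) (bc : Far G b c)
    (ad : Far G a d) (bd : Far G b d) (cd : G.Adj c d)
    (be : Far G b e) (ce : Far G c e) (ae : G.Adj a e)
    (cf : Far G c f) (af : Far G a f) (bf : G.Adj b f)
    (de : G.Adj d e) (df : G.Adj d f) (ef : G.Adj e f) : Nonempty (tent ↪g G) := by
  refine emb_of tent ![a, b, c, d, e, f] ?_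
  intro i j hij
  fin_cases i <;> fin_cases j <;>
    first
    | exact absurd hij (by decide)
    | exact Or.inl ⟨by simp [tent, sun3], by assumption⟩
    | exact Or.inr ⟨by simp [tent, sun3], by assumption⟩

theorem mk_umbrella {a b c d e f g : V} (ab : G.Adj a b) (bc : G.Adj b c) (cd : G.Adj c d)
    (de : G.Adj d e) (ac : Far G a c) (ad : Far G a d) (ae : Far G a e) (bd : Far G b d)
    (be : Far G b e) (ce : Far G c e) (af : G.Adj a f) (bf : G.Adj b f) (cf : G.Adj c f)
    (df : G.Adj d f) (ef : G.Adj e f) (cg : G.Adj c g) (ag : Far G a g) (bg : Far G b g)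
    (dg : Far G d g) (eg : Far G e g) (fg : Far G f g) : Nonempty (umbrella ↪g G) := by
  refine emb_of umbrella ![a, b, c, d, e, f, g] ?_
  intro i j hij
  fin_cases i <;> fin_cases j <;>
    first
    | exact absurd hij (by decide)
    | exact Or.inl ⟨by simp [umbrella], by assumption⟩
    | exact Or.inr ⟨by simp [umbrella], by assumption⟩

/-- Rising sun from an induced path `m 0, …, m C` and two vertices `p`, `q`. -/
theorem mk_rising {C : ℕ} (hC : 3 ≤ C) {m : ℕ → V} {p q y : V}
    (hadj : ∀ i < C, G.Adj (m i) (m (i + 1))) (hfar : ∀ i j, i + 1 < j → j ≤ C → Far G (m i) (m j))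
    (hp : ∀ i, 1 ≤ i → i ≤ C → G.Adj p (m i)) (hq : ∀ i, i < C → G.Adj q (m i))
    (hp0 : Far G p (m 0)) (hqC : Far G q (m C)) (hpq : G.Adj p q) (hpy : G.Adj p y)
    (hqy : G.Adj q y) (hy : ∀ i ≤ C, Far G y (m i)) : Nonempty (risingSun (C + 1) ↪g G) := by
  have main : ∀ i j, i < j → j ≤ C → (j = i + 1 ∧ G.Adj (m i) (m j)) ∨ (i + 1 < j ∧ Far G (m i) (m j)) := by
    intro i j hij hj
    by_cases h : j = i + 1
    · subst h; exact Or.inl ⟨rfl, hadj i (by omega)⟩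
    · exact Or.inr ⟨by omega, hfar i j (by omega) hj⟩
  have mm : ∀ i j, i ≤ C → j ≤ C → (G.Adj (m i) (m j) ↔ (j = i + 1 ∨ i = j + 1)) := by
    intro i j hi hj
    rcases lt_trichotomy i j with hl | rfl | hl
    · rcases main i j hl hj with h | h
      · exact iff_of_true h.2 (by omega)
      · exact iff_of_false h.2.2 (by omega)
    · exact iff_of_false G.irrefl (by omega)
    · rw [G.adj_comm]
      rcases main j i hl hi with h | h
      · exact iff_of_true h.2 (by omega)
      · exact iff_of_false h.2.2 (by omega)
  have minj : ∀ i j, i ≤ C → j ≤ C → m i = m j → i = j := by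
    intro i j hi hj he
    rcases lt_trichotomy i j with hl | rfl | hl
    · rcases main i j hl hj with h | h
      · exact absurd he h.2.ne
      · exact absurd he.symm h.2.1
    · rfl
    · rcases main j i hl hi with h | h
      · exact absurd he.symm h.2.ne
      · exact absurd he h.2.1
  have pm : ∀ i, i ≤ C → (G.Adj p (m i) ↔ i ≠ 0) := by
    intro i hi
    by_cases h : i = 0
    · subst h; exact iff_of_false hp0.2 (by simp)
    · exact iff_of_true (hp i (by omega) hi) h
  have qm : ∀ i, i ≤ C → (G.Adj q (m i) ↔ i ≠ C) := by
    intro i hi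
    by_cases h : i = C
    · subst h; exact iff_of_false hqC.2 (by simp)
    · exact iff_of_true (hq i (by omega)) h
  have ym : ∀ i, i ≤ C → ¬ G.Adj y (m i) := fun i hi => (hy i hi).2
  have pne : ∀ i, i ≤ C → p ≠ m i := by
    rintro i hi rfl
    exact (hy i hi).2 hpy.symm
  have qne : ∀ i, i ≤ C → q ≠ m i := by
    rintro i hi rfl
    exact (hy i hi).2 hqy.symm
  have yne : ∀ i, i ≤ C → y ≠ m i := fun i hi => (hy i hi).1.symm
  -- the map
  let F : ℕ → V := fun a => if a = 0 then p else if a = C then q else m (C - a)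
  let W : Fin 3 → V := ![m C, m 0, y]
  let f : Fin (C + 1) ⊕ Fin 3 → V := Sum.elim (fun a => F a) W
  have F0 : F 0 = p := by simp [F]
  have FC : F C = q := by simp [F]; omega
  have Fm : ∀ a, a ≠ 0 → a ≠ C → F a = m (C - a) := fun a h1 h2 => by simp [F, h1, h2]
  have hadjf : ∀ u v, u ≠ v → (G.Adj (f u) (f v) ↔ (risingSun (C + 1)).Adj u v) := by
    have fin3 : ∀ w : Fin 3, w = 0 ∨ w = 1 ∨ w = 2 := by decide
    have hll : ∀ a b : Fin (C + 1), a < b → (G.Adj (f (.inl a)) (f (.inl b)) ↔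
        (risingSun (C + 1)).Adj (.inl a) (.inl b)) := by
      intro a b hab
      have hab' : (a : ℕ) < b := hab
      have hb : (b : ℕ) ≤ C := by omega
      have hne : a ≠ b := hab.ne
      simp only [risingSun, SimpleGraph.fromRel_adj, f, Sum.elim_inl]
      by_cases ha0 : (a : ℕ) = 0
      · refine iff_of_true ?_ ⟨by simpa using hne, by simp [ha0]⟩
        rw [ha0, F0]
        by_cases hbC : (b : ℕ) = C
        · rw [hbC, FC]; exact hpq
        · rw [Fm b (by omega) hbC]; exact hp _ (by omega) (by omega)
      · by_cases hbC : (b : ℕ) = C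
        · refine iff_of_true ?_ ⟨by simpa using hne, by simp [hbC]⟩
          rw [hbC, FC, Fm a ha0 (by omega)]
          exact (hq _ (by omega)).symm
        · rw [Fm a ha0 (by omega), Fm b (by omega) hbC, mm _ _ (by omega) (by omega)]
          simp only [ne_eq, Sum.inl.injEq, hne, not_false_eq_true, true_and]
          omega
    have hlr : ∀ (a : Fin (C + 1)) (w : Fin 3), (G.Adj (f (.inl a)) (f (.inr w)) ↔
        (risingSun (C + 1)).Adj (.inl a) (.inr w)) := by
      intro a w
      have ha : (a : ℕ) ≤ C := by omega
      simp only [risingSun, SimpleGraph.fromRel_adj, f, Sum.elim_inl, Sum.elim_inr]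
      by_cases ha0 : (a : ℕ) = 0
      · rw [ha0, F0]
        rcases fin3 w with rfl | rfl | rfl
        · simp [W, pm C le_rfl]; omega
        · simp [W, pm 0 (by omega)]; omega
        · simp [W, hpy]
      · by_cases haC : (a : ℕ) = C
        · rw [haC, FC]
          rcases fin3 w with rfl | rfl | rfl
          · simp [W, qm C le_rfl]; omega
          · simp [W, qm 0 (by omega)]; omega
          · simp [W, hqy]
        · rw [Fm a ha0 haC]
          rcases fin3 w with rfl | rfl | rfl
          · simp [W, mm _ _ (show C - (a : ℕ) ≤ C by omega) le_rfl]; rw [← Fin.val_eq_zero_iff]; omega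
          · simp [W, mm _ _ (show C - (a : ℕ) ≤ C by omega) (Nat.zero_le _)]; omega
          · simp [W, G.adj_comm _ y, ym _ (show C - (a : ℕ) ≤ C by omega), ha0, haC]
    have hrr : ∀ (a w : Fin 3), a < w → (G.Adj (f (.inr a)) (f (.inr w)) ↔
        (risingSun (C + 1)).Adj (.inr a) (.inr w)) := by
      intro a w haw
      simp only [risingSun, SimpleGraph.fromRel_adj, f, Sum.elim_inr]
      rcases fin3 a with rfl | rfl | rfl <;> rcases fin3 w with rfl | rfl | rfl <;>
        first
        | exact absurd haw (by decide)
        | skip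
      · simp [W, mm _ _ le_rfl (Nat.zero_le C)]; omega
      · simp [W, G.adj_comm _ y, ym C le_rfl]
      · simp [W, G.adj_comm _ y, ym 0 (Nat.zero_le C)]
    rintro (a | a) (b | b) hne
    · rcases lt_trichotomy a b with h | h | h
      · exact hll a b h
      · exact absurd (congrArg Sum.inl h) hne
      · rw [G.adj_comm, (risingSun (C + 1)).adj_comm]; exact hll b a h
    · exact hlr a b
    · rw [G.adj_comm, (risingSun (C + 1)).adj_comm]; exact hlr b a
    · rcases lt_trichotomy a b with h | h | h
      · exact hrr a b h
      · exact absurd (congrArg Sum.inr h) hne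
      · rw [G.adj_comm, (risingSun (C + 1)).adj_comm]; exact hrr b a h
  have hinj : Function.Injective f := by
    have fin3 : ∀ w : Fin 3, w = 0 ∨ w = 1 ∨ w = 2 := by decide
    have hll : ∀ a b : Fin (C + 1), a < b → f (.inl a) ≠ f (.inl b) := by
      intro a b hab
      have hab' : (a : ℕ) < b := hab
      have hb : (b : ℕ) ≤ C := by omega
      simp only [f, Sum.elim_inl]
      by_cases ha0 : (a : ℕ) = 0
      · rw [ha0, F0]
        by_cases hbC : (b : ℕ) = C
        · rw [hbC, FC]; exact hpq.ne
        · rw [Fm b (by omega) hbC]; exact pne _ (by omega)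
      · by_cases hbC : (b : ℕ) = C
        · rw [hbC, FC, Fm a ha0 (by omega)]; exact (qne _ (by omega)).symm
        · rw [Fm a ha0 (by omega), Fm b (by omega) hbC]
          intro h
          have := minj _ _ (by omega) (by omega) h
          omega
    have hlr : ∀ (a : Fin (C + 1)) (w : Fin 3), f (.inl a) ≠ f (.inr w) := by
      intro a w
      have ha : (a : ℕ) ≤ C := by omega
      simp only [f, Sum.elim_inl, Sum.elim_inr]
      by_cases ha0 : (a : ℕ) = 0
      · rw [ha0, F0]
        rcases fin3 w with rfl | rfl | rfl
        · exact pne C le_rfl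
        · exact pne 0 (by omega)
        · exact hpy.ne
      · by_cases haC : (a : ℕ) = C
        · rw [haC, FC]
          rcases fin3 w with rfl | rfl | rfl
          · exact qne C le_rfl
          · exact qne 0 (by omega)
          · exact hqy.ne
        · rw [Fm a ha0 haC]
          rcases fin3 w with rfl | rfl | rfl
          · intro h
            have := minj _ C (by omega) (by omega) h
            omega
          · intro h
            have := minj _ 0 (by omega) (by omega) h
            omega
          · exact (yne _ (by omega)).symm
    have hrr : ∀ (a w : Fin 3), a < w → f (.inr a) ≠ f (.inr w) := by
      intro a w haw
      simp only [f, Sum.elim_inr]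
      rcases fin3 a with rfl | rfl | rfl <;> rcases fin3 w with rfl | rfl | rfl <;>
        first
        | exact absurd haw (by decide)
        | skip
      · intro h
        have := minj C 0 le_rfl (by omega) h
        omega
      · exact (yne C le_rfl).symm
      · exact (yne 0 (by omega)).symm
    rintro (a | a) (b | b) he
    · rcases lt_trichotomy a b with h | h | h
      · exact absurd he (hll a b h)
      · rw [h]
      · exact absurd he.symm (hll b a h)
    · exact absurd he (hlr a b)
    · exact absurd he.symm (hlr b a)
    · rcases lt_trichotomy a b with h | h | h
      · exact absurd he (hrr a b h)
      · rw [h]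
      · exact absurd he.symm (hrr b a h)
  refine ⟨⟨⟨f, hinj⟩, ?_⟩⟩
  intro u v
  change G.Adj (f u) (f v) ↔ _
  by_cases h : u = v
  · subst h; exact iff_of_false G.irrefl (SimpleGraph.irrefl _)
  · exact hadjf u v h

end Embeddings
end NH

namespace NH
section Cases
variable {V : Type} {G : SimpleGraph V}

theorem CH.c4 (h : CH G) {a b c d : V} (ab : G.Adj a b) (bc : G.Adj b c) (cd : G.Adj c d)
    (da : G.Adj d a) (ac : a ≠ c) (bd : b ≠ d) : G.Adj a c ∨ G.Adj b d := by
  by_contra! hn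
  exact h a b d c c ab da.symm bd hn.2 bc cd.symm (.refl ⟨ac.symm, hn.1⟩)

theorem CH.c5 (h : CH G) {a b c d e : V} (ab : G.Adj a b) (bc : G.Adj b c) (cd : G.Adj c d)
    (de : G.Adj d e) (ea : G.Adj e a) (hac : a ≠ c) (had : a ≠ d) (hbe : b ≠ e) :
    G.Adj a c ∨ G.Adj a d ∨ G.Adj b e := by
  by_contra! hn
  exact h a b e c d ab ea.symm hbe hn.2.2 bc de.symm (.single cd ⟨hac.symm, hn.1⟩ ⟨had.symm, hn.2.1⟩)

theorem CH.c6 (h : CH G) {a b c d e f : V} (ab : G.Adj a b) (bc : G.Adj b c) (cd : G.Adj c d)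
    (de : G.Adj d e) (ef : G.Adj e f) (fa : G.Adj f a) (hac : a ≠ c) (had : a ≠ d) (hae : a ≠ e)
    (hbf : b ≠ f) :
    G.Adj a c ∨ G.Adj a d ∨ G.Adj a e ∨ G.Adj b f := by
  by_contra! hn
  exact h a b f c e ab fa.symm hbf hn.2.2.2 bc ef.symm
    (.head cd ⟨hac.symm, hn.1⟩ (.single de ⟨had.symm, hn.2.1⟩ ⟨hae.symm, hn.2.2.1⟩))

/-- The four obstructions other than wheels. -/
structure NoObs (G : SimpleGraph V) : Prop where
  sun : IsEmpty (sun3 ↪g G)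
  rising : ∀ n : ℕ, 4 ≤ n → IsEmpty (risingSun n ↪g G)
  umb : IsEmpty (umbrella ↪g G)
  tent : IsEmpty (tent ↪g G)

theorem NoObs.nosun (h : NoObs G) (h' : Nonempty (sun3 ↪g G)) : False := h'.elim h.sun.false
theorem NoObs.noumb (h : NoObs G) (h' : Nonempty (umbrella ↪g G)) : False := h'.elim h.umb.false
theorem NoObs.notent (h : NoObs G) (h' : Nonempty (_root_.tent ↪g G)) : False := h'.elim h.tent.false


theorem far_of_adj_far {x a b : V} (h : G.Adj x a) (h' : Far G x b) : a ≠ b := by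
  rintro rfl; exact h'.2 h

theorem case22 (hCH : CH G) (hno : NoObs G) {x y z : V} {C : ℕ} (h : MinAT G x y z 2 2 C) : False := by
  obtain ⟨p', hp⟩ := h.path
  obtain ⟨q', hq⟩ := h.rot.path
  obtain ⟨m, hm⟩ := h.rot.rot.path
  have hC := h.rot.rot.two_le
  have fxy : Far G x y := h.1.2.1.left
  have fyz : Far G y z := h.1.2.2.left
  have fzx : Far G z x := h.1.1.left
  obtain ⟨p, rfl⟩ : ∃ p, p = p' 1 := ⟨_, rfl⟩
  obtain ⟨q, rfl⟩ : ∃ q, q = q' 1 := ⟨_, rfl⟩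
  have xp : G.Adj x (p' 1) := hp.h0 ▸ hp.adj 0 (by omega)
  have py : G.Adj (p' 1) y := hp.hn ▸ hp.adj 1 (by omega)
  have yq : G.Adj y (q' 1) := hq.h0 ▸ hq.adj 0 (by omega)
  have qz : G.Adj (q' 1) z := hq.hn ▸ hq.adj 1 (by omega)
  have zp : Far G z (p' 1) := hp.inP 1 (by omega)
  have xq : Far G x (q' 1) := hq.inP 1 (by omega)
  generalize p' 1 = p at *
  generalize q' 1 = q at *
  have ym : ∀ i ≤ C, Far G y (m i) := hm.inP
  have m_z : ∀ i, 2 ≤ i → i ≤ C → Far G z (m i) := fun i hi hi' => hm.h0 ▸ hm.far 0 i (by omega) hi'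
  have m_x : ∀ i, i + 2 ≤ C → Far G x (m i) := fun i hi => (hm.hn ▸ hm.far i C (by omega) le_rfl).symm
  have pm : ∀ i ≤ C, p ≠ m i := fun i hi => far_of_adj_far py.symm (ym i hi)
  have qm : ∀ i ≤ C, q ≠ m i := fun i hi => far_of_adj_far yq (ym i hi)
  have zm1 : G.Adj z (m 1) := hm.h0 ▸ hm.adj 0 (by omega)
  have mCx : G.Adj (m (C - 1)) x := by
    have := hm.adj (C - 1) (by omega)
    rwa [show C - 1 + 1 = C by omega, hm.hn] at this
  have pq : G.Adj p q := by
    by_contra hn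
    refine hCH y p q x z py.symm yq (far_of_adj_far xp xq) hn xp.symm qz ?_
    rw [← hm.h0, ← hm.hn]
    exact (reach_seq (Nat.zero_le _) (fun k _ hk => ym k hk) (fun k _ hk => hm.adj k hk)).symm
  have pmC : G.Adj p (m (C - 1)) := by
    by_contra hn
    have e : G.Adj (m (C - 1)) (m (C - 2)) := by
      have := hm.adj (C - 2) (by omega)
      rw [show C - 2 + 1 = C - 1 by omega] at this
      exact this.symm
    refine hCH x p (m (C - 1)) y (m (C - 2)) xp mCx.symm (pm _ (by omega)) hn py e ?_
    have r : Reach G (Far G x) (m 0) (m (C - 2)) :=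
      reach_seq (Nat.zero_le _) (fun k _ hk => m_x k (by omega)) (fun k _ hk => hm.adj k (by omega))
    rw [hm.h0] at r
    exact .head yq fxy (.head qz xq r)
  have qm1 : G.Adj q (m 1) := by
    by_contra hn
    refine hCH z q (m 1) y (m 2) qz.symm zm1 (qm _ (by omega)) hn yq.symm (hm.adj 1 (by omega)) ?_
    have r : Reach G (Far G z) (m 2) (m C) :=
      reach_seq hC (fun k hk hk' => m_z k hk hk') (fun k _ hk => hm.adj k hk)
    rw [hm.hn] at r
    exact .head py.symm fyz.symm (.head xp.symm zp r.symm)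
  by_cases hC2 : C = 2
  · subst hC2
    simp only [show 2 - 1 = 1 from rfl] at mCx pmC
    exact hno.nosun (mk_sun3 pq pmC qm1 py yq.symm (ym 1 (by omega)).symm qz zm1.symm zp.symm
      mCx xp.symm xq.symm fyz fxy.symm fzx)
  have pm1 : G.Adj p (m 1) := by
    by_contra hn
    have h1 : PathIn G (Far G (m 1)) 2 x y :=
      .cons (m_x 1 (by omega)).symm xp (.single ⟨pm 1 (by omega), fun e => hn e.symm⟩
        (ym 1 (by omega)).symm py)
    have h2 : PathIn G (Far G x) 2 y (m 1) :=
      .cons fxy yq (.single xq (m_x 1 (by omega)) qm1)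
    have h3 : PathIn G (Far G y) (C - 1) (m 1) (m C) :=
      PathIn.sub (by omega) (fun k _ hk => ym k hk) (fun k _ hk => hm.adj k hk)
    rw [hm.hn] at h3
    have := h.2 _ _ _ _ _ _ ⟨h1, h2, h3⟩
    omega
  have qmC : G.Adj q (m (C - 1)) := by
    by_contra hn
    have h1 : PathIn G (Far G z) 2 (m (C - 1)) y :=
      .cons (m_z _ (by omega) (by omega)) pmC.symm (.single zp fyz.symm py)
    have h2 : PathIn G (Far G (m (C - 1))) 2 y z :=
      .cons (ym _ (by omega)).symm yq (.single (Far.symm ⟨(qm _ (by omega)).symm, hn⟩ |>.symm.symm)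
        (m_z _ (by omega) (by omega)).symm qz)
    have h3 : PathIn G (Far G y) (C - 1 - 0) (m 0) (m (C - 1)) :=
      PathIn.sub (by omega) (fun k _ hk => ym k (by omega)) (fun k _ hk => hm.adj k (by omega))
    rw [hm.h0] at h3
    have := h.2 _ _ _ _ _ _ ⟨h1, h2, h3⟩
    omega
  have mid : ∀ s, s ≠ m 0 → (∀ i ≤ C, s ≠ m i) → G.Adj s (m 1) → G.Adj s (m (C - 1)) →
      ∀ i, 1 ≤ i → i ≤ C - 1 → G.Adj s (m i) := by
    intro s _ hs s1 sC i h1 h2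
    by_contra hn
    have hi1 : i ≠ 1 := by rintro rfl; exact hn s1
    have hiC : i ≠ C - 1 := by rintro rfl; exact hn sC
    have fs : Far G (m i) s := ⟨hs i (by omega), fun e => hn e.symm⟩
    obtain ⟨a, ha, hra⟩ : ∃ a, G.Adj (m (i - 1)) a ∧ Reach G (Far G (m i)) a s := by
      by_cases h3 : i = 2
      · subst h3; exact ⟨s, s1.symm, .refl fs⟩
      · refine ⟨m (i - 2), ?_, ?_⟩
        · have := hm.adj (i - 2) (by omega)
          rw [show i - 2 + 1 = i - 1 by omega] at this
          exact this.symm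
        · have : Reach G (Far G (m i)) (m 1) (m (i - 2)) :=
            reach_seq (by omega) (fun k _ hk => (hm.far k i (by omega) (by omega)).symm)
              (fun k _ hk => hm.adj k (by omega))
          exact .tail this.symm s1.symm fs
    obtain ⟨b, hb, hrb⟩ : ∃ b, G.Adj (m (i + 1)) b ∧ Reach G (Far G (m i)) b s := by
      by_cases h3 : i + 1 = C - 1
      · exact ⟨s, h3 ▸ sC.symm, .refl fs⟩
      · refine ⟨m (i + 2), hm.adj _ (by omega), ?_⟩
        have : Reach G (Far G (m i)) (m (i + 2)) (m (C - 1)) :=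
            reach_seq (by omega) (fun k hk _ => hm.far i k (by omega) (by omega))
              (fun k _ hk => hm.adj k (by omega))
        exact .tail this sC.symm fs
    have e1 : G.Adj (m (i - 1)) (m i) := by
      have := hm.adj (i - 1) (by omega)
      rwa [show i - 1 + 1 = i by omega] at this
    have f1 := hm.far (i - 1) (i + 1) (by omega) (by omega)
    exact hCH (m i) (m (i - 1)) (m (i + 1)) a b e1.symm (hm.adj i (by omega)) f1.1.symm f1.2 ha hb
      (hra.trans hrb.symm)
  refine (mk_rising (C := C) (by omega) hm.adj hm.far (p := p) (q := q) (y := y) ?_ ?_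
    (hm.h0 ▸ zp.symm) (hm.hn ▸ xq.symm) pq py yq.symm ym).elim (hno.rising (C + 1) (by omega)).false
  · intro i h1 h2
    by_cases h3 : i = C
    · rw [h3, hm.hn]; exact xp.symm
    · exact mid p (pm 0 (by omega)) pm pm1 pmC i h1 (by omega)
  · intro i h2
    by_cases h3 : i = 0
    · rw [h3, hm.h0]; exact qz
    · exact mid q (qm 0 (by omega)) qm qm1 qmC i (by omega) (by omega)

/-- Common vertex configuration. -/
theorem common_v (hCH : CH G) (hno : NoObs G) {x y z p v a b : V} (fxy : Far G x y) (fyz : Far G y z)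
    (fzx : Far G z x) (xp : G.Adj x p) (py : G.Adj p y) (zp : Far G z p)
    (ya : G.Adj y a) (av : G.Adj a v) (vz : G.Adj v z) (vb : G.Adj v b) (bx : G.Adj b x)
    (xv : Far G x v) (yv : Far G y v) (xa : Far G x a) (za : Far G z a) (yb : Far G y b) (zb : Far G z b)
    (pa : G.Adj p a) (pb : G.Adj p b) : False := by
  have ab : a ≠ b := far_of_adj_far ya yb
  have pv : p ≠ v := far_of_adj_far xp xv
  by_cases hab : G.Adj a b
  · by_cases hpv : G.Adj p v
    · exact hno.notent (mk_tent (a := y) (b := z) (c := x) (d := b) (e := a) (f := v)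
        fyz fxy.symm fzx yb zb bx.symm za xa ya xv yv vz.symm hab.symm vb.symm av)
    · exact hno.nosun (mk_sun3 (a := p) (b := b) (c := a) (d := x) (e := v) (f := y)
        pb pa hab.symm xp.symm bx xa.symm vb.symm av ⟨pv.symm, hpv⟩ ya.symm py yb.symm xv
        fxy yv.symm)
  · have hpv : G.Adj p v := (hCH.c4 pa av vb pb.symm pv ab).resolve_right hab
    have fba : Far G b a := ⟨ab, fun e => hab e.symm⟩
    exact hno.noumb (mk_umbrella (a := x) (b := b) (c := v) (d := a) (e := y) (f := p) (g := z)
      bx.symm vb.symm av.symm ya.symm xv xa fxy fba yb.symm yv.symm xp pb.symm hpv.symm pa.symm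
      py.symm vz fzx.symm zb.symm za.symm fyz zp.symm)

theorem case233 (hCH : CH G) (hno : NoObs G) {x y z : V} (h : MinAT G x y z 2 3 3) : False := by
  obtain ⟨p', hp⟩ := h.path
  obtain ⟨q, hq⟩ := h.rot.path
  obtain ⟨m, hm⟩ := h.rot.rot.path
  have fxy : Far G x y := h.1.2.1.left
  have fyz : Far G y z := h.1.2.2.left
  have fzx : Far G z x := h.1.1.left
  have xp : G.Adj x (p' 1) := hp.h0 ▸ hp.adj 0 (by omega)
  have py : G.Adj (p' 1) y := hp.hn ▸ hp.adj 1 (by omega)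
  have zp : Far G z (p' 1) := hp.inP 1 (by omega)
  have yq1 : G.Adj y (q 1) := hq.h0 ▸ hq.adj 0 (by omega)
  have q12 : G.Adj (q 1) (q 2) := hq.adj 1 (by omega)
  have q2z : G.Adj (q 2) z := hq.hn ▸ hq.adj 2 (by omega)
  have xq1 : Far G x (q 1) := hq.inP 1 (by omega)
  have xq2 : Far G x (q 2) := hq.inP 2 (by omega)
  have yq2 : Far G y (q 2) := hq.h0 ▸ hq.far 0 2 (by omega) (by omega)
  have zq1 : Far G z (q 1) := (hq.hn ▸ hq.far 1 3 (by omega) (by omega)).symm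
  have zm1 : G.Adj z (m 1) := hm.h0 ▸ hm.adj 0 (by omega)
  have m12 : G.Adj (m 1) (m 2) := hm.adj 1 (by omega)
  have m2x : G.Adj (m 2) x := hm.hn ▸ hm.adj 2 (by omega)
  have ym1 : Far G y (m 1) := hm.inP 1 (by omega)
  have ym2 : Far G y (m 2) := hm.inP 2 (by omega)
  have zm2 : Far G z (m 2) := hm.h0 ▸ hm.far 0 2 (by omega) (by omega)
  have xm1 : Far G x (m 1) := (hm.hn ▸ hm.far 1 3 (by omega) (by omega)).symm
  clear hp hq hm h
  generalize p' 1 = p at *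
  generalize q 1 = q1 at *
  generalize q 2 = q2 at *
  generalize m 1 = m1 at *
  generalize m 2 = m2 at *
  have pq1 : G.Adj p q1 := by
    by_contra hn
    exact hCH y p q1 x q2 py.symm yq1 (far_of_adj_far xp xq1) hn xp.symm q12
      (.head m2x.symm fxy.symm (.head m12.symm ym2 (.head zm1.symm ym1 (.single q2z.symm fyz yq2))))
  have pm2 : G.Adj p m2 := by
    by_contra hn
    exact hCH x p m2 y m1 xp m2x.symm (far_of_adj_far py.symm ym2) hn py m12.symm
      (.head yq1 fxy (.head q12 xq1 (.head q2z xq2 (.single zm1 fzx.symm xm1))))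
  by_cases he : q2 = m1
  · subst he
    exact common_v hCH hno fxy fyz fzx xp py zp yq1 q12 q2z m12 m2x xq2 yq2 xq1 zq1 ym2 zm2 pq1 pm2
  have q2m1 : G.Adj q2 m1 := by
    by_contra hn
    exact hCH z q2 m1 q1 m2 q2z.symm zm1 he hn q12.symm m12
      (.head yq1.symm zq1 (.head py.symm fyz.symm (.head xp.symm zp (.single m2x.symm fzx zm2))))
  by_cases h1 : G.Adj q2 m2
  · exact common_v hCH hno fxy fyz fzx xp py zp yq1 q12 q2z h1 m2x xq2 yq2 xq1 zq1 ym2 zm2 pq1 pm2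
  by_cases h2 : G.Adj q1 m1
  · exact common_v hCH hno fxy fyz fzx xp py zp yq1 h2 zm1.symm m12 m2x xm1 ym1 xq1 zq1 ym2 zm2
      pq1 pm2
  have nq1m1 := far_of_adj_far yq1 ym1
  have nq1m2 := far_of_adj_far yq1 ym2
  have nq2m2 : q2 ≠ m2 := far_of_adj_far q2z.symm zm2
  have npm1 : p ≠ m1 := far_of_adj_far py.symm ym1
  have npq2 : p ≠ q2 := far_of_adj_far py.symm yq2
  have h3 : ¬ G.Adj q1 m2 := fun e =>
    (hCH.c4 q12 q2m1 m12 e.symm nq1m1 nq2m2).elim h2 h1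
  have h45 : G.Adj p q2 ∧ G.Adj p m1 := by
    have c := hCH.c5 pq1 q12 q2m1 m12 pm2.symm npq2 npm1 nq1m2
    have c1 : G.Adj p m1 → G.Adj p q2 := fun e =>
      (hCH.c4 pq1 q12 q2m1 e.symm npq2 nq1m1).resolve_right h2
    have c2 : G.Adj p q2 → G.Adj p m1 := fun e =>
      (hCH.c4 e q2m1 m12 pm2.symm npm1 nq2m2).resolve_right h1
    tauto
  exact hno.nosun (mk_sun3 (a := p) (b := m1) (c := q2) (d := m2) (e := z) (f := q1)
    h45.2 h45.1 q2m1.symm pm2 m12 ⟨nq2m2.symm, h1⟩ zm1.symm q2z zp.symm q12.symm pq1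
    ⟨nq1m1, fun e => h2 e.symm⟩ zm2.symm ⟨nq1m2, fun e => h3 e.symm⟩ zq1)

theorem case333 (hCH : CH G) (hno : NoObs G) {x y z : V} (h : MinAT G x y z 3 3 3) : False := by
  obtain ⟨p, hp⟩ := h.path
  obtain ⟨q, hq⟩ := h.rot.path
  obtain ⟨m, hm⟩ := h.rot.rot.path
  have fxy : Far G x y := h.1.2.1.left
  have fyz : Far G y z := h.1.2.2.left
  have fzx : Far G z x := h.1.1.left
  have xp1 : G.Adj x (p 1) := hp.h0 ▸ hp.adj 0 (by omega)
  have p12 : G.Adj (p 1) (p 2) := hp.adj 1 (by omega)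
  have p2y : G.Adj (p 2) y := hp.hn ▸ hp.adj 2 (by omega)
  have zp1 : Far G z (p 1) := hp.inP 1 (by omega)
  have zp2 : Far G z (p 2) := hp.inP 2 (by omega)
  have xp2 : Far G x (p 2) := hp.h0 ▸ hp.far 0 2 (by omega) (by omega)
  have yp1 : Far G y (p 1) := (hp.hn ▸ hp.far 1 3 (by omega) (by omega)).symm
  have yq1 : G.Adj y (q 1) := hq.h0 ▸ hq.adj 0 (by omega)
  have q12 : G.Adj (q 1) (q 2) := hq.adj 1 (by omega)
  have q2z : G.Adj (q 2) z := hq.hn ▸ hq.adj 2 (by omega)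
  have xq1 : Far G x (q 1) := hq.inP 1 (by omega)
  have xq2 : Far G x (q 2) := hq.inP 2 (by omega)
  have yq2 : Far G y (q 2) := hq.h0 ▸ hq.far 0 2 (by omega) (by omega)
  have zq1 : Far G z (q 1) := (hq.hn ▸ hq.far 1 3 (by omega) (by omega)).symm
  have zm1 : G.Adj z (m 1) := hm.h0 ▸ hm.adj 0 (by omega)
  have m12 : G.Adj (m 1) (m 2) := hm.adj 1 (by omega)
  have m2x : G.Adj (m 2) x := hm.hn ▸ hm.adj 2 (by omega)
  have ym1 : Far G y (m 1) := hm.inP 1 (by omega)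
  have ym2 : Far G y (m 2) := hm.inP 2 (by omega)
  have zm2 : Far G z (m 2) := hm.h0 ▸ hm.far 0 2 (by omega) (by omega)
  have xm1 : Far G x (m 1) := (hm.hn ▸ hm.far 1 3 (by omega) (by omega)).symm
  clear hp hq hm h
  generalize p 1 = p1 at *
  generalize p 2 = p2 at *
  generalize q 1 = q1 at *
  generalize q 2 = q2 at *
  generalize m 1 = m1 at *
  generalize m 2 = m2 at *
  have cx : p1 = m2 ∨ G.Adj p1 m2 := by
    by_contra! hn
    exact hCH x p1 m2 p2 m1 xp1 m2x.symm hn.1 hn.2 p12 m12.symm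
      (.head p2y xp2 (.head yq1 fxy (.head q12 xq1 (.head q2z xq2 (.single zm1 fzx.symm xm1)))))
  have cy : p2 = q1 ∨ G.Adj p2 q1 := by
    by_contra! hn
    exact hCH y p2 q1 p1 q2 p2y.symm yq1 hn.1 hn.2 p12.symm q12
      (.head xp1.symm yp1 (.head m2x.symm fxy.symm (.head m12.symm ym2 (.head zm1.symm ym1
        (.single q2z.symm fyz yq2)))))
  have cz : q2 = m1 ∨ G.Adj q2 m1 := by
    by_contra! hn
    exact hCH z q2 m1 q1 m2 q2z.symm zm1 hn.1 hn.2 q12.symm m12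
      (.head yq1.symm zq1 (.head p2y.symm fyz.symm (.head p12.symm zp2 (.head xp1.symm zp1
        (.single m2x.symm fzx zm2)))))
  have net : ∀ a b c, G.Adj x a → Far G y a → Far G z a → G.Adj y b → Far G x b → Far G z b →
      G.Adj z c → Far G x c → Far G y c → ¬ (G.Adj a b ∧ G.Adj b c ∧ G.Adj a c) := by
    rintro a b c xa ya za yb xb zb zc xc yc ⟨ab, bc, ac⟩
    exact hno.notent (mk_tent (a := y) (b := z) (c := x) (d := a) (e := b) (f := c)
        fyz fxy.symm fzx ya za xa zb xb yb xc yc zc ab ac bc)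
  have n1 := net p1 p2 q2 xp1 yp1 zp1 p2y.symm xp2 zp2 q2z.symm xq2 yq2
  have n2 := net p1 p2 m1 xp1 yp1 zp1 p2y.symm xp2 zp2 zm1 xm1 ym1
  have n3 := net p1 q1 q2 xp1 yp1 zp1 yq1 xq1 zq1 q2z.symm xq2 yq2
  have n4 := net p1 q1 m1 xp1 yp1 zp1 yq1 xq1 zq1 zm1 xm1 ym1
  have n5 := net m2 p2 q2 m2x.symm ym2 zm2 p2y.symm xp2 zp2 q2z.symm xq2 yq2
  have n6 := net m2 p2 m1 m2x.symm ym2 zm2 p2y.symm xp2 zp2 zm1 xm1 ym1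
  have n7 := net m2 q1 q2 m2x.symm ym2 zm2 yq1 xq1 zq1 q2z.symm xq2 yq2
  have n8 := net m2 q1 m1 m2x.symm ym2 zm2 yq1 xq1 zq1 zm1 xm1 ym1
  -- cross class inequalities
  have d1 : p1 ≠ p2 := p12.ne
  have d2 : p1 ≠ q1 := far_of_adj_far xp1 xq1
  have d3 : m2 ≠ p2 := far_of_adj_far m2x.symm xp2
  have d4 : m2 ≠ q1 := far_of_adj_far m2x.symm xq1
  have d5 : p1 ≠ q2 := far_of_adj_far xp1 xq2
  have d6 : p1 ≠ m1 := far_of_adj_far xp1 xm1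
  have d7 : m2 ≠ q2 := far_of_adj_far m2x.symm xq2
  have d9 : p2 ≠ q2 := far_of_adj_far p2y.symm yq2
  have d10 : p2 ≠ m1 := far_of_adj_far p2y.symm ym1
  have d11 : q1 ≠ m1 := far_of_adj_far yq1 ym1
  clear net
  -- long diagonals
  have l1 : ¬ G.Adj p1 q2 := by
    intro e
    rcases cy with rfl | cy
    · exact n1 ⟨p12, q12, e⟩
    · rcases hCH.c4 p12 cy q12 e.symm d2 d9 with c | c
      · exact n3 ⟨c, q12, e⟩
      · exact n1 ⟨p12, c, e⟩
  have l2 : ¬ G.Adj m2 q1 := by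
    intro e
    rcases cz with rfl | cz
    · exact n7 ⟨e, q12, m12.symm⟩
    · rcases hCH.c4 e q12 cz m12 d7 d11 with c | c
      · exact n7 ⟨e, q12, c⟩
      · exact n8 ⟨e, c, m12.symm⟩
  have l3 : ¬ G.Adj p2 m1 := by
    intro e
    rcases cx with rfl | cx
    · exact n2 ⟨p12, e, m12.symm⟩
    · rcases hCH.c4 p12 e m12 cx.symm d6 d3.symm with c | c
      · exact n2 ⟨p12, e, c⟩
      · exact n6 ⟨c.symm, e, m12.symm⟩
  -- no short chords at coincident corners, and general contradiction
  have kx : ¬ (G.Adj p1 q1 ∧ G.Adj m2 q2) := by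
    rintro ⟨e1, e2⟩
    rcases cx with rfl | cx
    · exact l1 e2
    · rcases hCH.c4 e1 q12 e2.symm cx.symm d5 d4.symm with c | c
      · exact l1 c
      · exact l2 c.symm
  have ky : ¬ (G.Adj q1 m1 ∧ G.Adj p2 m2) := by
    rintro ⟨e1, e2⟩
    rcases cy with rfl | cy
    · exact l3 e1
    · rcases hCH.c4 e1 m12 e2.symm cy d4.symm d10.symm with c | c
      · exact l2 c.symm
      · exact l3 c.symm
  have kz : ¬ (G.Adj m1 p1 ∧ G.Adj q2 p2) := by
    rintro ⟨e1, e2⟩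
    rcases cz with rfl | cz
    · exact l1 e1.symm
    · rcases hCH.c4 e1 p12 e2.symm cz d10.symm d5 with c | c
      · exact l3 c.symm
      · exact l1 c
  have symm := fun a b => G.adj_comm a b
  rcases cx with rfl | cx <;> rcases cy with rfl | cy <;> rcases cz with rfl | cz
  · exact l1 m12.symm
  · exact (hCH.c4 p12 q12 cz m12 d5 d10).elim l1 l3
  · exact l1 m12.symm
  · -- pentagon p1 p2 q1 q2 m1
    rcases hCH.c5 p12 cy q12 cz m12 d2 d5 d10 with c | c | c
    · rcases hCH.c4 c q12 cz m12 d5 d11 with c' | c'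
      · exact l1 c'
      · exact n4 ⟨c, c', m12.symm⟩
    · exact l1 c
    · exact l3 c
  · exact (hCH.c4 p12 q12 m12 cx.symm d5 d3.symm).elim l1 (fun c => l2 c.symm)
  · -- pentagon p1 p2 q2 m1 m2
    rcases hCH.c5 p12 q12 cz m12 cx.symm d5 d6 d3.symm with c | c | c
    · exact l1 c
    · exact (hCH.c4 p12 q12 cz c.symm d5 d10).elim l1 l3
    · exact l2 c.symm
  · -- pentagon p1 p2 q1 q2 m2
    rcases hCH.c5 q12.symm cy.symm p12.symm cx m12.symm d9.symm d5.symm d4.symm with c | c | c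
    · rcases hCH.c4 c p12.symm cx m12.symm d5.symm d3.symm with c' | c'
      · exact l1 c'.symm
      · exact n5 ⟨c'.symm, c.symm, m12.symm⟩
    · exact l1 c.symm
    · exact l2 c.symm
  · -- hexagon
    have quad : G.Adj p1 q1 → G.Adj p1 m1 → False := fun e1 e2 => by
      rcases hCH.c4 e1 q12 cz e2.symm d5 d11 with c | c
      · exact l1 c
      · exact n4 ⟨e1, c, e2⟩
    rcases hCH.c6 p12 cy q12 cz m12 cx.symm d2 d5 d6 d3.symm with c | c | c | c
    · rcases hCH.c5 c q12 cz m12 cx.symm d5 d6 d4.symm with c' | c' | c'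
      · exact l1 c'
      · exact quad c c'
      · exact l2 c'.symm
    · exact l1 c
    · rcases hCH.c5 p12 cy q12 cz c.symm d2 d5 d10 with c' | c' | c'
      · exact quad c' c
      · exact l1 c'
      · exact l3 c'
    · rcases hCH.c5 cz m12 c.symm cy q12 d7.symm d9.symm d11.symm with c' | c' | c'
      · rcases hCH.c4 c' c.symm cy q12 d9.symm d4 with e | e
        · exact n5 ⟨c.symm, e.symm, c'.symm⟩
        · exact l2 e
      · rcases hCH.c4 c' c m12.symm cz.symm d7.symm d10 with e | e
        · exact n5 ⟨c.symm, c'.symm, e.symm⟩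
        · exact l3 e
      · exact ky ⟨c'.symm, c⟩

theorem atf_of (hCH : CH G) (hTRI : TRI G) (hno : NoObs G) : ATF G := by
  by_contra hn
  obtain ⟨x, y, z, A, B, C, h⟩ := exists_minAT hn
  have hA := h.two_le
  have hB := h.rot.two_le
  have hC := h.rot.rot.two_le
  have b1 : ¬ (4 ≤ B ∧ 3 ≤ C) := fun e => minAT_long hCH hTRI h e.1 e.2
  have b2 : ¬ (4 ≤ C ∧ 3 ≤ A) := fun e => minAT_long hCH hTRI h.rot e.1 e.2
  have b3 : ¬ (4 ≤ A ∧ 3 ≤ B) := fun e => minAT_long hCH hTRI h.rot.rot e.1 e.2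
  have c1 : ¬ (4 ≤ C ∧ 3 ≤ B) := fun e => minAT_long hCH hTRI h.refl e.1 e.2
  have c2 : ¬ (4 ≤ A ∧ 3 ≤ C) := fun e => minAT_long hCH hTRI h.rot.refl e.1 e.2
  have c3 : ¬ (4 ≤ B ∧ 3 ≤ A) := fun e => minAT_long hCH hTRI h.rot.rot.refl e.1 e.2
  by_cases h1 : A = 2 ∧ B = 2
  · obtain ⟨rfl, rfl⟩ := h1; exact case22 hCH hno h
  by_cases h2 : B = 2 ∧ C = 2
  · obtain ⟨rfl, rfl⟩ := h2; exact case22 hCH hno h.rot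
  by_cases h3 : C = 2 ∧ A = 2
  · obtain ⟨rfl, rfl⟩ := h3; exact case22 hCH hno h.rot.rot
  have h4 : A = 2 ∧ B = 3 ∧ C = 3 ∨ B = 2 ∧ A = 3 ∧ C = 3 ∨ C = 2 ∧ A = 3 ∧ B = 3 ∨
      A = 3 ∧ B = 3 ∧ C = 3 := by omega
  rcases h4 with ⟨rfl, rfl, rfl⟩ | ⟨rfl, rfl, rfl⟩ | ⟨rfl, rfl, rfl⟩ | ⟨rfl, rfl, rfl⟩
  · exact case233 hCH hno h
  · exact case233 hCH hno h.rot
  · exact case233 hCH hno h.rot.rot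
  · exact case333 hCH hno h

end Cases
end NH

namespace NH
section Coordinates

/-- A coordinate function of the circle with values in `(0, 1]`. -/
structure Coord (c : Circ → ℝ) : Prop where
  pos : ∀ x, 0 < c x
  le : ∀ x, c x ≤ 1
  inj : ∀ x y, c x = c y → x = y
  surj : ∀ r, 0 < r → r ≤ 1 → ∃ x, c x = r
  sb : ∀ a b d, sbtw a b d ↔ (c a < c b ∧ c b < c d) ∨ (c b < c d ∧ c d < c a) ∨
    (c d < c a ∧ c a < c b)

theorem toIcoMod_window {β x y : ℝ} (hx : x ∈ Ioc β (β + 1)) (hy : y ∈ Ioc β (β + 1)) :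
    toIcoMod (one_pos : (0:ℝ) < 1) x y = if x ≤ y then y else y + 1 := by
  rw [toIcoMod_eq_iff]
  obtain ⟨h1, h2⟩ := hx
  obtain ⟨h3, h4⟩ := hy
  split_ifs with h
  · exact ⟨⟨h, by linarith⟩, 0, by simp⟩
  · exact ⟨⟨by linarith, by linarith⟩, -1, by simp⟩

theorem toIocMod_window {β x y : ℝ} (hx : x ∈ Ioc β (β + 1)) (hy : y ∈ Ioc β (β + 1)) :
    toIocMod (one_pos : (0:ℝ) < 1) x y = if x < y then y else y + 1 := by
  rw [toIocMod_eq_iff]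
  obtain ⟨h1, h2⟩ := hx
  obtain ⟨h3, h4⟩ := hy
  split_ifs with h
  · exact ⟨⟨h, by linarith⟩, 0, by simp⟩
  · exact ⟨⟨by linarith, by linarith⟩, -1, by simp⟩

theorem sbtw_window {β x y z : ℝ} (hx : x ∈ Ioc β (β + 1)) (hy : y ∈ Ioc β (β + 1))
    (hz : z ∈ Ioc β (β + 1)) :
    sbtw (x : Circ) (y : Circ) (z : Circ) ↔ (x < y ∧ y < z) ∨ (y < z ∧ z < x) ∨ (z < x ∧ x < y) := by
  rw [sbtw_iff_not_btw]
  have := QuotientAddGroup.btw_coe_iff (p := (1:ℝ)) (x₁ := z) (x₂ := y) (x₃ := x)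
  refine (not_congr this).trans ?_
  rw [toIcoMod_window hz hy, toIocMod_window hz hx]
  obtain ⟨h1, h2⟩ := hx
  obtain ⟨h3, h4⟩ := hy
  obtain ⟨h5, h6⟩ := hz
  split_ifs with a b b <;> constructor <;> intro h
  all_goals first
    | (push Not at h; grind)
    | (push Not; grind)

theorem exists_coord (p : Circ) : ∃ c, Coord c ∧ c p = 1 := by
  obtain ⟨β, rfl⟩ := QuotientAddGroup.mk_surjective p
  have mem : ∀ x : Circ, ((AddCircle.equivIoc 1 β x : Ioc β (β+1)) : ℝ) ∈ Ioc β (β + 1) :=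
    fun x => (AddCircle.equivIoc 1 β x).2
  have co : ∀ x : Circ, (((AddCircle.equivIoc 1 β x : Ioc β (β+1)) : ℝ) : Circ) = x :=
    fun x => AddCircle.coe_equivIoc
  refine ⟨fun x => (AddCircle.equivIoc 1 β x : ℝ) - β, ⟨?_, ?_, ?_, ?_, ?_⟩, ?_⟩
  · intro x; have := (mem x).1; linarith
  · intro x; have := (mem x).2; linarith
  · intro x y h
    have h' : ((AddCircle.equivIoc 1 β x : Ioc β (β+1)) : ℝ) = AddCircle.equivIoc 1 β y := by
      simpa using h
    rw [← co x, ← co y, h']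
  · intro r h0 h1
    refine ⟨((β + r : ℝ) : Circ), ?_⟩
    rw [AddCircle.equivIoc_coe_of_mem (by constructor <;> linarith)]
    ring
  · intro a b d
    conv_lhs => rw [← co a, ← co b, ← co d]
    rw [sbtw_window (mem a) (mem b) (mem d)]
    simp only [sub_lt_sub_iff_right]
  · have : (QuotientAddGroup.mk β : Circ) = ((β + 1 : ℝ) : Circ) := by
      have := AddCircle.coe_add_period (1:ℝ) β
      exact this.symm
    show ((AddCircle.equivIoc 1 β (QuotientAddGroup.mk β : Circ) : Ioc β (β+1)) : ℝ) - β = 1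
    rw [this, AddCircle.equivIoc_coe_of_mem (by constructor <;> linarith)]
    ring

variable {V : Type} [Fintype V] {M : CAModel V}

theorem s_ne_t (M : CAModel V) (u v : V) : (M.arc u).s ≠ (M.arc v).t := by
  intro h
  have := @M.endpoints_distinct (u, true) (v, false) (by simpa using h)
  simp at this

theorem s_inj (M : CAModel V) {u v : V} (h : (M.arc u).s = (M.arc v).s) : u = v := by
  have := @M.endpoints_distinct (u, true) (v, true) (by simpa using h)
  simpa using this

theorem mem_pts {c : Circ → ℝ} (hc : Coord c) (A : Arc) (x : Circ) : x ∈ A.pts ↔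
    (c A.s < c x ∧ c x < c A.t) ∨ (c x < c A.t ∧ c A.t < c A.s) ∨ (c A.t < c A.s ∧ c A.s < c x) :=
  hc.sb _ _ _

theorem pts_nonempty (M : CAModel V) (v : V) : (M.arc v).pts.Nonempty := by
  obtain ⟨c, hc, h1⟩ := exists_coord (M.arc v).s
  have h2 := hc.pos (M.arc v).t
  have h3 := hc.le (M.arc v).t
  obtain ⟨x, hx⟩ := hc.surj (c (M.arc v).t / 2) (by linarith) (by linarith)
  refine ⟨x, (mem_pts hc _ _).2 ?_⟩
  have : c (M.arc v).s ≠ c (M.arc v).t := fun h => s_ne_t M _ _ (hc.inj _ _ h)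
  grind

/-- An arc avoiding two points lies on one side of them. -/
theorem one_side {c : Circ → ℝ} (hc : Coord c) {A : Arc} {p1 p2 q1 q2 : Circ} (h1 : p1 ∉ A.pts)
    (h2 : p2 ∉ A.pts) (h3 : q1 ∈ A.pts) (h4 : q2 ∈ A.pts) (h5 : c p1 < c q1) (h6 : c q1 < c p2) :
    c p1 < c q2 ∧ c q2 < c p2 := by
  rw [mem_pts hc] at *
  grind

theorem two_cover_inter (M : CAModel V) {u v : V} (h : (M.arc u).pts ∪ (M.arc v).pts = univ) :
    M.Inter u v := by
  obtain ⟨c, hc, h1⟩ := exists_coord (M.arc v).s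
  by_cases huv : u = v
  · subst huv; have := pts_nonempty M u; simpa [CAModel.Inter] using this
  have a1 := hc.pos (M.arc v).t
  have a2 := hc.le (M.arc v).t
  have a3 := hc.pos (M.arc u).s
  have a4 := hc.le (M.arc u).s
  have a5 := hc.pos (M.arc u).t
  have a6 := hc.le (M.arc u).t
  have a7 : c (M.arc u).s ≠ c (M.arc u).t := fun h => s_ne_t M _ _ (hc.inj _ _ h)
  have a9 : c (M.arc v).s ≠ c (M.arc v).t := fun h => s_ne_t M _ _ (hc.inj _ _ h)
  have a8 : c (M.arc u).s < c (M.arc v).t := by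
    have : (M.arc u).s ∈ (M.arc u).pts ∪ (M.arc v).pts := h ▸ mem_univ _
    rcases this with h' | h'
    · rw [mem_pts hc] at h'; grind
    · rw [mem_pts hc] at h'; grind
  by_cases h9 : c (M.arc u).s < c (M.arc u).t
  · obtain ⟨x, hx⟩ := hc.surj ((c (M.arc u).s + min (c (M.arc u).t) (c (M.arc v).t)) / 2)
      (by grind) (by grind)
    refine ⟨x, (mem_pts hc _ _).2 ?_, (mem_pts hc _ _).2 ?_⟩ <;> grind
  · obtain ⟨x, hx⟩ := hc.surj ((c (M.arc u).s + c (M.arc v).t) / 2) (by grind) (by grind)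
    refine ⟨x, (mem_pts hc _ _).2 ?_, (mem_pts hc _ _).2 ?_⟩ <;> grind

/-- Local description of a model around the arc of `h`. -/
structure Local (M : CAModel V) (h : V) (c : Circ → ℝ) (L : ℝ) (a b : V → ℝ) : Prop where
  coord : Coord c
  L0 : 0 < L
  L1 : L < 1
  ah : a h = 0
  bh : b h = L
  ab : ∀ v, M.Inter h v → a v < b v
  aL : ∀ v, M.Inter h v → a v < L
  b0 : ∀ v, M.Inter h v → 0 < b v
  b1 : ∀ v, M.Inter h v → b v < 1
  La : ∀ v, M.Inter h v → L ≤ a v + 1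
  mem : ∀ v, M.Inter h v → ∀ x, x ∈ (M.arc v).pts ↔ (a v < c x ∧ c x < b v) ∨ a v + 1 < c x

theorem exists_local (hN : M.Normal) (h : V) : ∃ c L a b, Local M h c L a b := by
  classical
  obtain ⟨c, hc, h1⟩ := exists_coord (M.arc h).s
  have ne : ∀ u v, c (M.arc u).s ≠ c (M.arc v).t := fun u v h => s_ne_t M _ _ (hc.inj _ _ h)
  have sne : ∀ u, u ≠ h → c (M.arc u).s ≠ c (M.arc h).s := fun u hu e =>
    hu (s_inj M (hc.inj _ _ e))
  have L0 := hc.pos (M.arc h).t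
  have L1 := hc.le (M.arc h).t
  have L1' := ne h h
  rw [h1] at L1' sne
  have key : ∀ v, v ≠ h → M.Inter h v →
      (c (M.arc v).s < c (M.arc v).t → c (M.arc v).s < c (M.arc h).t) ∧
      (c (M.arc v).t < c (M.arc v).s → c (M.arc h).t ≤ c (M.arc v).s) := by
    intro v hv ⟨x, hx, hx'⟩
    rw [mem_pts hc] at hx hx'
    have lx := hc.le x
    constructor
    · intro h2; grind
    · intro h2
      by_contra hlt
      push Not at hlt
      refine hN h v hv.symm (eq_univ_of_forall fun y => ?_)
      by_cases hy : c y < c (M.arc h).t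
      · left; rw [mem_pts hc]; grind
      · right; rw [mem_pts hc]; grind
  refine ⟨c, c (M.arc h).t, fun v => if v = h then 0 else if c (M.arc v).s < c (M.arc v).t then
    c (M.arc v).s else c (M.arc v).s - 1, fun v => c (M.arc v).t, ⟨hc, L0, by grind, by simp, rfl,
      ?_, ?_, ?_, ?_, ?_, ?_⟩⟩
  all_goals intro v hv
  all_goals have k1 := key v
  all_goals have k2 := hc.pos (M.arc v).s
  all_goals have k3 := hc.le (M.arc v).s
  all_goals have k4 := hc.pos (M.arc v).t
  all_goals have k5 := hc.le (M.arc v).t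
  all_goals have k6 := ne v v
  all_goals have k7 := sne v
  all_goals have k8 := ne h v
  · by_cases e : v = h
    · subst e; simp; grind
    · have := k1 e hv; simp only [e, if_false]; grind
  · by_cases e : v = h
    · subst e; simp; grind
    · have := k1 e hv; simp only [e, if_false]; grind
  · exact k4
  · show c (M.arc v).t < 1
    grind
  · by_cases e : v = h
    · subst e; simp; grind
    · have := k1 e hv; simp only [e, if_false]; grind
  · intro x
    have l1 := hc.pos x
    have l2 := hc.le x
    rw [mem_pts hc]
    by_cases e : v = h
    · subst e; simp; grind
    · have := k1 e hv; simp only [e, if_false]; grind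

end Coordinates
end NH

namespace NH
section ModelFacts
variable {V : Type} [Fintype V] {M : CAModel V} {G : SimpleGraph V}

theorem inter_symm {u v : V} (h : M.Inter u v) : M.Inter v u := by
  obtain ⟨x, h1, h2⟩ := h; exact ⟨x, h2, h1⟩

theorem inter_self (M : CAModel V) (u : V) : M.Inter u u := by
  obtain ⟨x, h⟩ := pts_nonempty M u; exact ⟨x, h, h⟩

/-- One-dimensional Helly property for finitely many open intervals. -/
theorem helly_real (S : Set V) (hS : S.Nonempty) (a b : V → ℝ)
    (h : ∀ v ∈ S, ∀ w ∈ S, a v < b w) : ∃ p, ∀ v ∈ S, a v < p ∧ p < b v := by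
  classical
  have hf : S.Finite := S.toFinite
  obtain ⟨v, hv, hv'⟩ := Set.exists_max_image S a hf hS
  obtain ⟨w, hw, hw'⟩ := Set.exists_min_image S b hf hS
  have := h v hv w hw
  refine ⟨(a v + b w) / 2, fun u hu => ?_⟩
  have := hv' u hu
  have := hw' u hu
  constructor <;> linarith

/-- A normal model that is not Helly has three pairwise intersecting arcs covering the circle. -/
theorem three_cover (hN : M.Normal) (hH : ¬ M.Helly) : ∃ u v w, u ≠ v ∧ u ≠ w ∧ v ≠ w ∧
    M.Inter u v ∧ M.Inter u w ∧ M.Inter v w ∧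
    (∀ x, x ∈ (M.arc u).pts ∨ x ∈ (M.arc v).pts ∨ x ∈ (M.arc w).pts) := by
  unfold CAModel.Helly at hH
  push Not at hH
  obtain ⟨S, hS, hp⟩ := hH
  obtain ⟨h, hh, -⟩ := hp ((0 : ℝ) : Circ)
  obtain ⟨c, L, a, b, hl⟩ := exists_local hN h
  have hc := hl.coord
  have L0 := hl.L0
  have L1 := hl.L1
  by_cases hall : ∀ v ∈ S, ∀ w ∈ S, a v < b w
  · exfalso
    obtain ⟨p, hp'⟩ := helly_real S ⟨h, hh⟩ a b hall
    have h1 := hp' h hh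
    rw [hl.ah, hl.bh] at h1
    obtain ⟨x, hx⟩ := hc.surj p h1.1 (by linarith)
    obtain ⟨v, hv, hv'⟩ := hp x
    apply hv'
    rw [hl.mem v (hS h hh v hv), hx]
    exact Or.inl (hp' v hv)
  · push Not at hall
    obtain ⟨w, hw, v, hv, hvw⟩ := hall
    have iv := hS h hh v hv
    have iw := hS h hh w hw
    have e1 := hl.ab v iv
    have e2 := hl.ab w iw
    have e3 := hl.aL v iv
    have e4 := hl.aL w iw
    have e5 := hl.b0 v iv
    have e6 := hl.b0 w iw
    refine ⟨h, v, w, ?_, ?_, ?_, iv, iw, hS v hv w hw, ?_⟩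
    · rintro rfl; rw [hl.bh] at hvw; linarith
    · rintro rfl; rw [hl.ah] at hvw; linarith
    · rintro rfl; linarith
    · obtain ⟨y, hy1, hy2⟩ := hS v hv w hw
      rw [hl.mem v iv] at hy1
      rw [hl.mem w iw] at hy2
      have y1 := hc.le y
      intro x
      rw [hl.mem h (inter_self M h), hl.mem v iv, hl.mem w iw, hl.ah, hl.bh]
      have x0 := hc.pos x
      grind

theorem tri_mid (hM : M.IsModelOf G) {w x y z : V} {pw px py pz : Circ} {c : Circ → ℝ}
    (hc : Coord c) (hw : pw ∈ (M.arc w).pts) (hx : px ∈ (M.arc x).pts) (hy : py ∈ (M.arc y).pts)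
    (hz : pz ∈ (M.arc z).pts) (h1 : c pw = 1)
    (hr : Reach G (fun v => Far G x v ∧ Far G z v) w y) (h2 : c px < c py) (h3 : c py < c pz) :
    False := by
  have out : ∀ v, Far G x v → px ∉ (M.arc v).pts := fun v hv hp =>
    hv.2 ((hM x v).2 ⟨hv.1.symm, px, hx, hp⟩)
  have out' : ∀ v, Far G z v → pz ∉ (M.arc v).pts := fun v hv hp =>
    hv.2 ((hM z v).2 ⟨hv.1.symm, pz, hz, hp⟩)
  have key : ∀ v, Reach G (fun v => Far G x v ∧ Far G z v) w v →
      ∃ q ∈ (M.arc v).pts, ¬ (c px < c q ∧ c q < c pz) := by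
    intro v hv
    induction hv with
    | refl h => exact ⟨pw, hw, fun h => by have := hc.le pz; linarith⟩
    | tail hr' hadj hP ih =>
      rename_i b d
      obtain ⟨q, hq, hq'⟩ := ih
      obtain ⟨-, r, hr1, hr2⟩ := (hM _ _).1 hadj
      refine ⟨r, hr2, fun h => hq' ?_⟩
      have := hr'.right
      exact one_side hc (out _ this.1) (out' _ this.2) hr1 hq h.1 h.2
  obtain ⟨q, hq, hq'⟩ := key y hr
  have := hr.right
  exact hq' (one_side hc (out _ this.1) (out' _ this.2) hy hq h2 h3)

theorem tri_of_model (hM : M.IsModelOf G) : TRI G := by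
  intro w x y z hx hy hz
  obtain ⟨pw, hpw⟩ := pts_nonempty M w
  obtain ⟨px, hpx⟩ := pts_nonempty M x
  obtain ⟨py, hpy⟩ := pts_nonempty M y
  obtain ⟨pz, hpz⟩ := pts_nonempty M z
  obtain ⟨c, hc, h1⟩ := exists_coord pw
  have ne : ∀ {u v p q}, p ∈ (M.arc u).pts → q ∈ (M.arc v).pts → Far G u v → c p ≠ c q := by
    intro u v p q hp hq hf e
    have := hc.inj _ _ e
    subst this
    exact hf.2 ((hM u v).2 ⟨hf.1.symm, p, hp, hq⟩)
  have nxy := ne hpx hpy hy.right.1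
  have nxz := ne hpx hpz hz.right.1
  have nyz := ne hpy hpz hz.right.2
  have sw : ∀ {u v t s : V}, Reach G (fun v => Far G u v ∧ Far G t v) w s →
      Reach G (fun v => Far G t v ∧ Far G u v) w s := fun h => h.mono (fun _ hv => ⟨hv.2, hv.1⟩)
  rcases lt_or_gt_of_ne nxy with a | a <;> rcases lt_or_gt_of_ne nxz with b | b <;>
    rcases lt_or_gt_of_ne nyz with d | d
  · exact tri_mid hM hc hpw hpx hpy hpz h1 hy a d
  · exact tri_mid hM hc hpw hpx hpz hpy h1 hz b d
  · linarith
  · exact tri_mid hM hc hpw hpz hpx hpy h1 (hx.mono (fun _ hv => ⟨hv.2, hv.1⟩)) b a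
  · exact tri_mid hM hc hpw hpy hpx hpz h1 hx a b
  · linarith
  · exact tri_mid hM hc hpw hpy hpz hpx h1 (hz.mono (fun _ hv => ⟨hv.2, hv.1⟩)) d b
  · exact tri_mid hM hc hpw hpz hpy hpx h1 (hy.mono (fun _ hv => ⟨hv.2, hv.1⟩)) d a

/-- Graph level description of the neighbourhood of `h` in a normal Helly model. -/
structure Nbhd (G : SimpleGraph V) (h : V) (L : ℝ) (a b : V → ℝ) : Prop where
  ab : ∀ v, G.Adj h v → a v < b v
  aL : ∀ v, G.Adj h v → a v < L
  b0 : ∀ v, G.Adj h v → 0 < b v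
  adj : ∀ v w, G.Adj h v → G.Adj h w → v ≠ w → (G.Adj v w ↔ a w < b v ∧ a v < b w)
  exit : ∀ u v, Far G h u → G.Adj h v → G.Adj u v → L < b v ∨ a v < 0
  sun : ∀ u v w, Far G h u → G.Adj h v → G.Adj h w → G.Adj u v → G.Adj u w → G.Adj v w →
    ¬ (a v < 0 ∧ b v ≤ L ∧ 0 ≤ a w ∧ L < b w)
  right : ∀ u v w, Far G h u → G.Adj h v → G.Adj h w → G.Adj u v → Far G u w → 0 ≤ a v →
    b w < b v
  left : ∀ u v w, Far G h u → G.Adj h v → G.Adj h w → G.Adj u v → Far G u w → b v ≤ L →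
    a v < a w

theorem exists_nbhd (hM : M.IsModelOf G) (hN : M.Normal) (hH : M.Helly) (h : V) :
    ∃ L a b, Nbhd G h L a b := by
  obtain ⟨c, L, a, b, hl⟩ := exists_local hN h
  have hc := hl.coord
  have L0 := hl.L0
  have L1 := hl.L1
  have int : ∀ {u v}, G.Adj u v → M.Inter u v := fun e => ((hM _ _).1 e).2
  have memh : ∀ x, x ∈ (M.arc h).pts ↔ c x < L := by
    intro x
    rw [hl.mem h (inter_self M h), hl.ah, hl.bh]
    have := hc.pos x
    have := hc.le x
    constructor
    · rintro (h | h)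
      · exact h.2
      · linarith
    · intro h; left; exact ⟨by linarith, h⟩
  have tri : ∀ {u v w}, M.Inter u v → M.Inter u w → M.Inter v w →
      ∃ x, x ∈ (M.arc u).pts ∧ x ∈ (M.arc v).pts ∧ x ∈ (M.arc w).pts := by
    intro u v w h1 h2 h3
    obtain ⟨x, hx⟩ := hH {u, v, w} (by
      intro s hs t ht
      simp only [mem_insert_iff, mem_singleton_iff] at hs ht
      rcases hs with rfl | rfl | rfl <;> rcases ht with rfl | rfl | rfl <;>
        first | exact inter_self M _ | assumption | (apply inter_symm; assumption))
    exact ⟨x, hx u (by simp), hx v (by simp), hx w (by simp)⟩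
  have far : ∀ {u x}, Far G h u → x ∈ (M.arc u).pts → L ≤ c x := by
    intro u x hu hx
    by_contra hlt
    exact hu.2 ((hM h u).2 ⟨hu.1.symm, x, (memh x).2 (by linarith), hx⟩)
  refine ⟨L, a, b, ⟨fun v e => hl.ab v (int e), fun v e => hl.aL v (int e),
    fun v e => hl.b0 v (int e), ?_, ?_, ?_, ?_, ?_⟩⟩
  · intro v w hv hw hne
    constructor
    · intro e
      obtain ⟨x, hx1, hx2, hx3⟩ := tri (int hv) (int hw) (int e)
      rw [memh] at hx1
      rw [hl.mem v (int hv)] at hx2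
      rw [hl.mem w (int hw)] at hx3
      have := hl.La v (int hv)
      have := hl.La w (int hw)
      grind
    · rintro ⟨h1, h2⟩
      have e1 := hl.ab v (int hv)
      have e2 := hl.ab w (int hw)
      have e3 := hl.aL v (int hv)
      have e4 := hl.aL w (int hw)
      have e5 := hl.b0 v (int hv)
      have e6 := hl.b0 w (int hw)
      have lt : max (max (a v) (a w)) 0 < min (min (b v) (b w)) L := by
        simp only [max_lt_iff, lt_min_iff]; grind
      obtain ⟨p, hp1, hp2⟩ := exists_between lt
      simp only [max_lt_iff, lt_min_iff] at hp1 hp2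
      obtain ⟨x, hx⟩ := hc.surj p hp1.2 (by linarith)
      refine (hM v w).2 ⟨hne, x, ?_, ?_⟩
      · rw [hl.mem v (int hv)]; left; rw [hx]; exact ⟨hp1.1.1, hp2.1.1⟩
      · rw [hl.mem w (int hw)]; left; rw [hx]; exact ⟨hp1.1.2, hp2.1.2⟩
  · intro u v hu hv e
    obtain ⟨x, hx1, hx2⟩ := int e
    have := far hu hx1
    have := hc.le x
    rw [hl.mem v (int hv)] at hx2
    grind
  · rintro u v w hu hv hw uv uw vw ⟨h1, h2, h3, h4⟩
    obtain ⟨x, hx1, hx2, hx3⟩ := tri (int uv) (int uw) (int vw)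
    have f1 := far hu hx1
    have f2 := hc.le x
    rw [hl.mem v (int hv)] at hx2
    rw [hl.mem w (int hw)] at hx3
    obtain ⟨y, hy1, hy2, hy3⟩ := tri (int hv) (int hw) (int vw)
    rw [memh] at hy1
    rw [hl.mem v (int hv)] at hy2
    rw [hl.mem w (int hw)] at hy3
    have := hl.La v (int hv)
    have := hl.La w (int hw)
    refine hN v w vw.ne (eq_univ_of_forall fun z => ?_)
    rw [mem_union, hl.mem v (int hv), hl.mem w (int hw)]
    have := hc.pos z
    grind
  · intro u v w hu hv hw uv uw h0
    by_contra! hlt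
    obtain ⟨x, hx1, hx2⟩ := int uv
    have f1 := far hu hx1
    have f2 := hc.le x
    rw [hl.mem v (int hv)] at hx2
    refine uw.2 ((hM u w).2 ⟨uw.1.symm, x, hx1, ?_⟩)
    rw [hl.mem w (int hw)]
    have e4 := hl.aL w (int hw)
    grind
  · intro u v w hu hv hw uv uw h0
    by_contra! hlt
    obtain ⟨x, hx1, hx2⟩ := int uv
    have f1 := far hu hx1
    have f2 := hc.le x
    rw [hl.mem v (int hv)] at hx2
    refine uw.2 ((hM u w).2 ⟨uw.1.symm, x, hx1, ?_⟩)
    rw [hl.mem w (int hw)]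
    grind

end ModelFacts
end NH

namespace NH
section Forward
variable {V : Type} [Fintype V] {G : SimpleGraph V}

theorem Nbhd.reflect {h : V} {L : ℝ} {a b : V → ℝ} (H : Nbhd G h L a b) :
    Nbhd G h L (fun v => L - b v) (fun v => L - a v) where
  ab v e := by have := H.ab v e; linarith
  aL v e := by have := H.b0 v e; linarith
  b0 v e := by have := H.aL v e; linarith
  adj v w hv hw hne := by
    rw [H.adj v w hv hw hne]
    constructor <;> rintro ⟨h1, h2⟩ <;> constructor <;> linarith
  exit u v hu hv e := by
    rcases H.exit u v hu hv e with h | h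
    · right; linarith
    · left; linarith
  sun u v w hu hv hw uv uw vw := by
    rintro ⟨h1, h2, h3, h4⟩
    exact H.sun u w v hu hw hv uw uv vw.symm ⟨by linarith, by linarith, by linarith, by linarith⟩
  right u v w hu hv hw uv uw h0 := by
    have := H.left u v w hu hv hw uv uw (by linarith); linarith
  left u v w hu hv hw uv uw h0 := by
    have := H.right u v w hu hv hw uv uw (by linarith); linarith

theorem Nbhd.far {h : V} {L : ℝ} {a b : V → ℝ} (H : Nbhd G h L a b) {v w : V} (hv : G.Adj h v)
    (hw : G.Adj h w) (hf : Far G v w) : b v ≤ a w ∨ b w ≤ a v := by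
  have := (H.adj v w hv hw hf.1.symm).not.1 hf.2
  by_contra! hn
  exact this ⟨hn.1, hn.2⟩

theorem Nbhd.adj' {h : V} {L : ℝ} {a b : V → ℝ} (H : Nbhd G h L a b) {v w : V} (hv : G.Adj h v)
    (hw : G.Adj h w) (e : G.Adj v w) : a w < b v ∧ a v < b w :=
  (H.adj v w hv hw e.ne).1 e

theorem emb_adj {W : Type} {H : SimpleGraph W} (φ : H ↪g G) {i j : W} (h : H.Adj i j) :
    G.Adj (φ i) (φ j) := φ.map_adj_iff.2 h

theorem emb_far {W : Type} {H : SimpleGraph W} (φ : H ↪g G) {i j : W} (hne : j ≠ i)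
    (h : ¬ H.Adj i j) : Far G (φ i) (φ j) :=
  ⟨fun e => hne (φ.injective e), fun e => h (φ.map_adj_iff.1 e)⟩

/-- Every vertex has a local description. -/
def AllNbhd (G : SimpleGraph V) : Prop := ∀ h, ∃ L a b, Nbhd G h L a b

theorem no_umbrella (hG : AllNbhd G) : IsEmpty (umbrella ↪g G) := by
  refine ⟨fun φ => ?_⟩
  obtain ⟨L, a, b, H⟩ := hG (φ 5)
  have dec : ∀ i j : Fin 7, umbrella.Adj i j ↔ i ≠ j ∧
    ((((i : ℕ) < 5 ∧ (j : ℕ) = (i : ℕ) + 1 ∧ (j : ℕ) < 5) ∨ ((i : ℕ) = 5 ∧ (j : ℕ) < 5) ∨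
    ((i : ℕ) = 6 ∧ (j : ℕ) = 2)) ∨ (((j : ℕ) < 5 ∧ (i : ℕ) = (j : ℕ) + 1 ∧ (i : ℕ) < 5) ∨ ((j : ℕ) = 5 ∧ (i : ℕ) < 5) ∨
    ((j : ℕ) = 6 ∧ (i : ℕ) = 2))) := by
    intro i j; rw [umbrella, SimpleGraph.fromRel_adj]
  have A : ∀ {i j : Fin 7}, umbrella.Adj i j → G.Adj (φ i) (φ j) := fun h => emb_adj φ h
  have F : ∀ {i j : Fin 7}, j ≠ i → ¬ umbrella.Adj i j → Far G (φ i) (φ j) :=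
    fun h h' => emb_far φ h h'
  simp only [dec] at A F
  have h0 : G.Adj (φ 5) (φ 0) := A (by decide)
  have h1 : G.Adj (φ 5) (φ 1) := A (by decide)
  have h2 : G.Adj (φ 5) (φ 2) := A (by decide)
  have h3 : G.Adj (φ 5) (φ 3) := A (by decide)
  have h4 : G.Adj (φ 5) (φ 4) := A (by decide)
  have e := H.exit (φ 6) (φ 2) (F (by decide) (by decide)) h2 (A (by decide))
  have e01 := H.adj' h0 h1 (A (by decide))
  have e12 := H.adj' h1 h2 (A (by decide))
  have e23 := H.adj' h2 h3 (A (by decide))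
  have e34 := H.adj' h3 h4 (A (by decide))
  have f02 := H.far h0 h2 (F (by decide) (by decide))
  have f03 := H.far h0 h3 (F (by decide) (by decide))
  have f04 := H.far h0 h4 (F (by decide) (by decide))
  have f13 := H.far h1 h3 (F (by decide) (by decide))
  have f14 := H.far h1 h4 (F (by decide) (by decide))
  have f24 := H.far h2 h4 (F (by decide) (by decide))
  have l0 := H.aL _ h0
  have l1 := H.aL _ h1
  have l2 := H.aL _ h2
  have l3 := H.aL _ h3
  have l4 := H.aL _ h4
  have p0 := H.b0 _ h0
  have p1 := H.b0 _ h1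
  have p2 := H.b0 _ h2
  have p3 := H.b0 _ h3
  have p4 := H.b0 _ h4
  have q0 := H.ab _ h0
  have q4 := H.ab _ h4
  have q2 := H.ab _ h2
  clear dec A F
  rcases e with e | e <;> rcases f02 with f | f <;> rcases f24 with g | g <;>
    rcases f04 with k | k <;> rcases f14 with l | l <;> rcases f03 with m | m <;> linarith

theorem sun_dec (i j : Fin 6) : sun3.Adj i j ↔ i ≠ j ∧
    ((((i : ℕ) < 3 ∧ (j : ℕ) < 3) ∨
    (3 ≤ (i : ℕ) ∧ ((j : ℕ) = (i : ℕ) - 3 ∨ (j : ℕ) = ((i : ℕ) - 2) % 3))) ∨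
    (((j : ℕ) < 3 ∧ (i : ℕ) < 3) ∨
    (3 ≤ (j : ℕ) ∧ ((i : ℕ) = (j : ℕ) - 3 ∨ (i : ℕ) = ((j : ℕ) - 2) % 3)))) := by
  rw [sun3, SimpleGraph.fromRel_adj]

theorem no_sun (hG : AllNbhd G) : IsEmpty (sun3 ↪g G) := by
  refine ⟨fun φ => ?_⟩
  obtain ⟨L, a, b, H⟩ := hG (φ 0)
  have A : ∀ {i j : Fin 6}, sun3.Adj i j → G.Adj (φ i) (φ j) := fun h => emb_adj φ h
  have F : ∀ {i j : Fin 6}, j ≠ i → ¬ sun3.Adj i j → Far G (φ i) (φ j) :=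
    fun h h' => emb_far φ h h'
  simp only [sun_dec] at A F
  have h1 : G.Adj (φ 0) (φ 1) := A (by decide)
  have h2 : G.Adj (φ 0) (φ 2) := A (by decide)
  have h3 : G.Adj (φ 0) (φ 3) := A (by decide)
  have h5 : G.Adj (φ 0) (φ 5) := A (by decide)
  have u : Far G (φ 0) (φ 4) := F (by decide) (by decide)
  have u1 : G.Adj (φ 4) (φ 1) := A (by decide)
  have u2 : G.Adj (φ 4) (φ 2) := A (by decide)
  have v12 : G.Adj (φ 1) (φ 2) := A (by decide)
  have e1 := H.exit _ _ u h1 u1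
  have e2 := H.exit _ _ u h2 u2
  have s1 := H.sun _ _ _ u h1 h2 u1 u2 v12
  have s2 := H.sun _ _ _ u h2 h1 u2 u1 v12.symm
  have e13 := H.adj' h1 h3 (A (by decide))
  have e25 := H.adj' h2 h5 (A (by decide))
  have f23 := H.far h2 h3 (F (by decide) (by decide))
  have f15 := H.far h1 h5 (F (by decide) (by decide))
  have l3 := H.aL _ h3
  have l5 := H.aL _ h5
  have p3 := H.b0 _ h3
  have p5 := H.b0 _ h5
  clear A F
  grind

theorem no_tent (hG : AllNbhd G) : IsEmpty (tent ↪g G) := by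
  refine ⟨fun φ => ?_⟩
  obtain ⟨L, a, b, H⟩ := hG (φ 3)
  have A : ∀ {i j : Fin 6}, tent.Adj i j → G.Adj (φ i) (φ j) := fun h => emb_adj φ h
  have F : ∀ {i j : Fin 6}, j ≠ i → ¬ tent.Adj i j → Far G (φ i) (φ j) :=
    fun h h' => emb_far φ h h'
  simp only [tent, SimpleGraph.compl_adj, sun_dec] at A F
  have h4 : G.Adj (φ 3) (φ 4) := A (by decide)
  have h5 : G.Adj (φ 3) (φ 5) := A (by decide)
  have h2 : G.Adj (φ 3) (φ 2) := A (by decide)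
  have u0 : Far G (φ 3) (φ 0) := F (by decide) (by decide)
  have u1 : Far G (φ 3) (φ 1) := F (by decide) (by decide)
  have a04 : G.Adj (φ 0) (φ 4) := A (by decide)
  have a15 : G.Adj (φ 1) (φ 5) := A (by decide)
  have f05 : Far G (φ 0) (φ 5) := F (by decide) (by decide)
  have f14 : Far G (φ 1) (φ 4) := F (by decide) (by decide)
  have e4 := H.exit _ _ u0 h4 a04
  have e5 := H.exit _ _ u1 h5 a15
  have r4 := H.right _ _ _ u0 h4 h5 a04 f05
  have r5 := H.right _ _ _ u1 h5 h4 a15 f14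
  have l4 := H.left _ _ _ u0 h4 h5 a04 f05
  have l5 := H.left _ _ _ u1 h5 h4 a15 f14
  have e45 := H.adj' h4 h5 (A (by decide))
  have f24 := H.far h2 h4 (F (by decide) (by decide))
  have f25 := H.far h2 h5 (F (by decide) (by decide))
  have l2 := H.aL _ h2
  have p2 := H.b0 _ h2
  have q2 := H.ab _ h2
  clear A F
  grind

theorem no_wheel (hG : AllNbhd G) (n : ℕ) (hn : 4 ≤ n) : IsEmpty (wheel n ↪g G) := by
  refine ⟨fun φ => ?_⟩
  obtain ⟨L, a, b, H⟩ := hG (φ (Sum.inr ()))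
  have A : ∀ i j : Fin n, (((i : ℕ) + 1) % n = j) → G.Adj (φ (Sum.inl i)) (φ (Sum.inl j)) := by
    intro i j h
    apply emb_adj φ
    rw [wheel, SimpleGraph.fromRel_adj]
    refine ⟨?_, Or.inl (Or.inr ⟨i, j, rfl, rfl, h⟩)⟩
    intro e
    have e' : i = j := by simpa using e
    subst e'
    have := i.2
    rcases Nat.lt_or_ge (i + 1) n with h1 | h1
    · rw [Nat.mod_eq_of_lt h1] at h; omega
    · have : (i : ℕ) + 1 = n := by omega
      rw [this, Nat.mod_self] at h; omega
  have Hh : ∀ i : Fin n, G.Adj (φ (Sum.inr ())) (φ (Sum.inl i)) := by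
    intro i
    apply emb_adj φ
    rw [wheel, SimpleGraph.fromRel_adj]
    exact ⟨by simp, Or.inl (Or.inl ⟨(), rfl⟩)⟩
  have F : ∀ i j : Fin n, i ≠ j → (((i : ℕ) + 1) % n ≠ j) → (((j : ℕ) + 1) % n ≠ i) →
      Far G (φ (Sum.inl i)) (φ (Sum.inl j)) := by
    intro i j h1 h2 h3
    apply emb_far φ
    · simpa using h1.symm
    · rw [wheel, SimpleGraph.fromRel_adj]
      rintro ⟨-, (⟨x, hx⟩ | ⟨k, l, hk, hl, h⟩) | (⟨x, hx⟩ | ⟨k, l, hk, hl, h⟩)⟩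
      · simp at hx
      · simp only [Sum.inl.injEq] at hk hl; subst hk hl; exact h2 h
      · simp at hx
      · simp only [Sum.inl.injEq] at hk hl; subst hk hl; exact h3 h
  haveI : Nonempty (Fin n) := ⟨⟨0, by omega⟩⟩
  obtain ⟨i, hi⟩ := Finite.exists_min (fun i : Fin n => b (φ (Sum.inl i)))
  have key : ∀ j k : Fin n, (((k : ℕ) + 1) % n = i) → (((i : ℕ) + 1) % n = j) → False := by
    intro j k hk hj
    have e1 := H.adj' (Hh _) (Hh _) (A i j hj)
    have e2 := H.adj' (Hh _) (Hh _) (A k i hk)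
    have i2 := i.2
    have j2 := j.2
    have k2 := k.2
    have m : ∀ x, x < n → (x + 1) % n = if x + 1 = n then 0 else x + 1 := by
      intro x hx
      split_ifs with h
      · rw [h, Nat.mod_self]
      · exact Nat.mod_eq_of_lt (by omega)
    rw [m _ i2] at hj
    rw [m _ k2] at hk
    have f : Far G (φ (Sum.inl j)) (φ (Sum.inl k)) := by
      apply F
      · intro e; subst e; split_ifs at hj hk <;> omega
      · rw [m _ j2]; split_ifs at hj hk ⊢ <;> omega
      · rw [m _ k2]; split_ifs at hj hk ⊢ <;> omega
    have := H.far (Hh _) (Hh _) f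
    have := hi j
    have := hi k
    grind
  have i2 := i.2
  rcases Nat.eq_zero_or_pos (i : ℕ) with h | h
  · refine key ⟨1, by omega⟩ ⟨n - 1, by omega⟩ ?_ ?_
    · show (n - 1 + 1) % n = i
      rw [Nat.sub_add_cancel (by omega), Nat.mod_self, h]
    · rw [h]; exact Nat.mod_eq_of_lt (by omega)
  · refine key ⟨(i + 1) % n, Nat.mod_lt _ (by omega)⟩ ⟨i - 1, by omega⟩ ?_ rfl
    show ((i : ℕ) - 1 + 1) % n = i
    rw [Nat.sub_add_cancel h, Nat.mod_eq_of_lt i2]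

theorem rising_adj {n : ℕ} (u v : Fin n ⊕ Fin 3) : (risingSun n).Adj u v ↔ u ≠ v ∧
    ((match u, v with
    | Sum.inl a, Sum.inl b => (a : ℕ) = 0 ∨ (a : ℕ) = n - 1 ∨ (b : ℕ) = (a : ℕ) + 1
    | Sum.inr w, Sum.inl a =>
        ((w : ℕ) = 0 ∧ ((a : ℕ) = 0 ∨ (a : ℕ) = 1)) ∨
        ((w : ℕ) = 1 ∧ ((a : ℕ) = n - 2 ∨ (a : ℕ) = n - 1)) ∨
        ((w : ℕ) = 2 ∧ ((a : ℕ) = n - 1 ∨ (a : ℕ) = 0))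
    | _, _ => False) ∨ (match v, u with
    | Sum.inl a, Sum.inl b => (a : ℕ) = 0 ∨ (a : ℕ) = n - 1 ∨ (b : ℕ) = (a : ℕ) + 1
    | Sum.inr w, Sum.inl a =>
        ((w : ℕ) = 0 ∧ ((a : ℕ) = 0 ∨ (a : ℕ) = 1)) ∨
        ((w : ℕ) = 1 ∧ ((a : ℕ) = n - 2 ∨ (a : ℕ) = n - 1)) ∨
        ((w : ℕ) = 2 ∧ ((a : ℕ) = n - 1 ∨ (a : ℕ) = 0))
    | _, _ => False)) := by
  rw [risingSun, SimpleGraph.fromRel_adj]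
  all_goals (cases u <;> cases v <;> rfl)

theorem no_rising (hG : AllNbhd G) (n : ℕ) (hn : 4 ≤ n) : IsEmpty (risingSun n ↪g G) := by
  refine ⟨fun φ => ?_⟩
  obtain ⟨L, a, b, H⟩ := hG (φ (Sum.inl ⟨0, by omega⟩))
  obtain ⟨v, hv⟩ : ∃ v : ℕ → V, ∀ i (hi : i < n), v i = φ (Sum.inl ⟨i, hi⟩) :=
    ⟨fun i => if hi : i < n then φ (Sum.inl ⟨i, hi⟩) else φ (Sum.inr 0), fun i hi => by simp [hi]⟩
  rw [← hv 0 (by omega)] at H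
  have vv : ∀ i j, i < n → j < n → i ≠ j → (i = 0 ∨ i = n - 1 ∨ j = i + 1) → G.Adj (v i) (v j) := by
    intro i j hi hj hne h
    rw [hv i hi, hv j hj]
    apply emb_adj φ
    rw [rising_adj]
    exact ⟨by simpa using hne, Or.inl h⟩
  have wv : ∀ (k : Fin 3) j, j < n → (((k : ℕ) = 0 ∧ (j = 0 ∨ j = 1)) ∨
        ((k : ℕ) = 1 ∧ (j = n - 2 ∨ j = n - 1)) ∨
        ((k : ℕ) = 2 ∧ (j = n - 1 ∨ j = 0))) → G.Adj (φ (Sum.inr k)) (v j) := by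
    intro k j hj h
    rw [hv j hj]
    apply emb_adj φ
    rw [rising_adj]
    exact ⟨by simp, Or.inl h⟩
  have wf : ∀ (k : Fin 3) j, j < n → ¬ (((k : ℕ) = 0 ∧ (j = 0 ∨ j = 1)) ∨
        ((k : ℕ) = 1 ∧ (j = n - 2 ∨ j = n - 1)) ∨
        ((k : ℕ) = 2 ∧ (j = n - 1 ∨ j = 0))) → Far G (φ (Sum.inr k)) (v j) := by
    intro k j hj h
    rw [hv j hj]
    apply emb_far φ (by simp)
    rw [rising_adj]
    rintro ⟨-, h' | h'⟩
    · exact h h'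
    · exact h'
  have ww : Far G (φ (Sum.inr 0)) (φ (Sum.inr 2)) := by
    apply emb_far φ (by simp)
    rw [rising_adj]
    simp
  have hvj : ∀ j, 1 ≤ j → j < n → G.Adj (v 0) (v j) := fun j h1 h2 =>
    vv 0 j (by omega) h2 (by omega) (by omega)
  have hw0 : G.Adj (v 0) (φ (Sum.inr 0)) := (wv 0 0 (by omega) (by simp)).symm
  have hw2 : G.Adj (v 0) (φ (Sum.inr 2)) := (wv 2 0 (by omega) (by simp)).symm
  have w1 : Far G (v 0) (φ (Sum.inr 1)) := (wf 1 0 (by omega) (by simp; omega)).symm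
  have d1 : G.Adj (v 0) (v (n - 2)) := hvj _ (by omega) (by omega)
  have ed := H.exit _ (v (n - 2)) w1 d1 (wv 1 _ (by omega) (by simp))
  have main : ∀ a b, Nbhd G (v 0) L a b → L < b (v (n - 2)) → False := by
    clear ed H a b
    intro a b H hd
    have e1 : G.Adj (v 0) (v (n - 1)) := hvj _ (by omega) (by omega)
    have ee := H.exit _ (v (n - 1)) w1 e1 (wv 1 _ (by omega) (by simp))
    have x1 := H.far hw0 d1 (wf 0 _ (by omega) (by simp; omega))
    have x2 := H.far hw2 d1 (wf 2 _ (by omega) (by simp; omega))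
    have x3 := H.far hw0 e1 (wf 0 _ (by omega) (by simp; omega))
    have x4 := H.adj' hw2 e1 (wv 2 _ (by omega) (by simp))
    have x5 := H.far hw0 hw2 ww
    have x6 := H.adj' e1 d1 (vv _ _ (by omega) (by omega) (by omega) (by omega))
    have l0 := H.aL _ hw0
    have l2 := H.aL _ hw2
    have p0 := H.b0 _ hw0
    have p2 := H.b0 _ hw2
    have q0 := H.ab _ hw0
    have q2 := H.ab _ hw2
    have x7 : b (φ (Sum.inr 0)) ≤ a (φ (Sum.inr 2)) := by grind
    have ind : ∀ i, 1 ≤ i → i ≤ n - 2 → b (v i) ≤ a (φ (Sum.inr 2)) := by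
      intro i hi
      induction i, hi using Nat.le_induction with
      | base =>
        intro _
        have y1 := H.adj' hw0 (hvj 1 (by omega) (by omega)) (wv 0 1 (by omega) (by simp))
        have y2 := H.far hw2 (hvj 1 (by omega) (by omega)) (wf 2 1 (by omega) (by simp; omega))
        grind
      | succ i hi ih =>
        intro h
        have y0 := ih (by omega)
        have y1 := H.adj' (hvj i (by omega) (by omega)) (hvj (i + 1) (by omega) (by omega))
          (vv i (i + 1) (by omega) (by omega) (by omega) (by omega))
        have y2 := H.far hw2 (hvj (i + 1) (by omega) (by omega))
          (wf 2 (i + 1) (by omega) (by simp; omega))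
        grind
    have := ind (n - 2) (by omega) le_rfl
    linarith
  rcases ed with h | h
  · exact main a b H h
  · exact main _ _ H.reflect (by linarith)

end Forward
end NH

namespace NH
section Intervals
variable {V : Type} [Fintype V] {G : SimpleGraph V}

theorem model_of_intervals (s t : V → ℝ) (h0 : ∀ v, 0 < s v) (hst : ∀ v, s v < t v)
    (h1 : ∀ v, t v < 1) (hs : ∀ u v, s u = s v → u = v) (ht : ∀ u v, t u = t v → u = v)
    (hd : ∀ u v, s u ≠ t v) :
    ∃ M : CAModel V, M.Normal ∧ M.Helly ∧ ∀ u v, M.Inter u v ↔ s u < t v ∧ s v < t u := by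
  have ws : ∀ v, s v ∈ Ioc (0:ℝ) (0 + 1) := fun v => ⟨h0 v, by linarith [hst v, h1 v]⟩
  have wt : ∀ v, t v ∈ Ioc (0:ℝ) (0 + 1) := fun v => ⟨by linarith [hst v, h0 v], by linarith [h1 v]⟩
  have cinj : ∀ {x y : ℝ}, x ∈ Ioc (0:ℝ) (0 + 1) → y ∈ Ioc (0:ℝ) (0 + 1) →
      (x : Circ) = (y : Circ) → x = y := by
    intro x y hx hy h
    have e1 := AddCircle.equivIoc_coe_of_mem (p := (1:ℝ)) hx
    have e2 := AddCircle.equivIoc_coe_of_mem (p := (1:ℝ)) hy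
    rw [← e1, ← e2, h]
  let M : CAModel V :=
    { arc := fun v => ⟨(s v : Circ), (t v : Circ)⟩
      endpoints_distinct := by
        rintro ⟨u, i⟩ ⟨v, j⟩ h
        cases i <;> cases j <;> simp only [if_true, if_false, Bool.false_eq_true] at h
        · rw [ht u v (cinj (wt u) (wt v) h)]
        · exact absurd (cinj (wt u) (ws v) h).symm (hd v u)
        · exact absurd (cinj (ws u) (wt v) h) (hd u v)
        · rw [hs u v (cinj (ws u) (ws v) h)] }
  have mem : ∀ v (p : ℝ), p ∈ Ioc (0:ℝ) (0 + 1) → ((p : Circ) ∈ (M.arc v).pts ↔ s v < p ∧ p < t v) := by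
    intro v p hp
    have := sbtw_window (ws v) hp (wt v)
    refine this.trans ?_
    have := hst v
    constructor
    · rintro (h | h | h)
      · exact h
      · linarith
      · linarith
    · intro h; exact Or.inl h
  have rep : ∀ x : Circ, ∃ p : ℝ, p ∈ Ioc (0:ℝ) (0 + 1) ∧ (p : Circ) = x := fun x =>
    ⟨_, (AddCircle.equivIoc (1:ℝ) 0 x).2, AddCircle.coe_equivIoc⟩
  have int : ∀ u v, M.Inter u v ↔ s u < t v ∧ s v < t u := by
    intro u v
    constructor
    · rintro ⟨x, hx1, hx2⟩
      obtain ⟨p, hp, rfl⟩ := rep x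
      rw [mem _ _ hp] at hx1 hx2
      constructor <;> linarith
    · rintro ⟨e1, e2⟩
      have := hst u
      have := hst v
      have lt : max (s u) (s v) < min (t u) (t v) := by
        simp only [max_lt_iff, lt_min_iff]; grind
      obtain ⟨p, hp1, hp2⟩ := exists_between lt
      simp only [max_lt_iff, lt_min_iff] at hp1 hp2
      have hp : p ∈ Ioc (0:ℝ) (0 + 1) := ⟨by linarith [h0 u], by linarith [h1 u]⟩
      exact ⟨(p : Circ), (mem u p hp).2 ⟨hp1.1, hp2.1⟩, (mem v p hp).2 ⟨hp1.2, hp2.2⟩⟩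
  refine ⟨M, ?_, ?_, int⟩
  · intro u v _ h
    have hp : (1 : ℝ) ∈ Ioc (0:ℝ) (0 + 1) := ⟨by norm_num, by norm_num⟩
    have : ((1 : ℝ) : Circ) ∈ (M.arc u).pts ∪ (M.arc v).pts := h ▸ mem_univ _
    rw [mem_union, mem _ _ hp, mem _ _ hp] at this
    have := h1 u
    have := h1 v
    grind
  · intro S hS
    rcases S.eq_empty_or_nonempty with rfl | hne
    · exact ⟨((0:ℝ) : Circ), by simp⟩
    · obtain ⟨p, hp⟩ := helly_real S hne s t (fun v hv w hw => ((int v w).1 (hS v hv w hw)).1)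
      obtain ⟨v, hv⟩ := hne
      have hp' : p ∈ Ioc (0:ℝ) (0 + 1) := by
        have := hp v hv
        exact ⟨by linarith [h0 v], by linarith [h1 v]⟩
      exact ⟨(p : Circ), fun u hu => (mem u p hp').2 (hp u hu)⟩

theorem two_two_free (hCH : CH G) {lt : V → V → Prop} (ho : OrderOn G Finset.univ lt) {x y u v : V}
    (h1 : lt x y) (h2 : lt u v) : lt x v ∨ lt u y := by
  by_contra! hn
  obtain ⟨n1, n2⟩ := hn
  have tr : ∀ {a b c}, lt a b → lt b c → lt a c := fun {a b c} e1 e2 =>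
    ho.trans a (Finset.mem_univ _) b (Finset.mem_univ _) c (Finset.mem_univ _) e1 e2
  have adj : ∀ {a b}, a ≠ b → ¬ lt a b → ¬ lt b a → G.Adj a b := by
    intro a b hne e1 e2
    by_contra hadj
    rcases (ho.comp a (Finset.mem_univ _) b (Finset.mem_univ _)).1 ⟨hne.symm, hadj⟩ with h | h
    · exact e1 h
    · exact e2 h
  have far : ∀ {a b}, lt a b → Far G a b := fun {a b} e =>
    ho.far (Finset.mem_univ _) (Finset.mem_univ _) e
  have xv : G.Adj v x := by
    apply adj
    · rintro rfl; exact n2 (tr h2 h1)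
    · exact fun e => n2 (tr (tr h2 e) h1)
    · exact n1
  have uy : G.Adj u y := by
    apply adj
    · rintro rfl; exact n1 (tr h1 h2)
    · exact n2
    · exact fun e => n1 (tr (tr h1 e) h2)
  have xu : G.Adj x u := by
    apply adj
    · rintro rfl; exact n1 h2
    · exact fun e => n1 (tr e h2)
    · exact fun e => n2 (tr e h1)
  have yv : G.Adj y v := by
    apply adj
    · rintro rfl; exact n1 h1
    · exact fun e => n1 (tr h1 e)
    · exact fun e => n2 (tr h2 e)
  rcases hCH.c4 xu uy yv xv (far h1).1.symm (far h2).1.symm with h | h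
  · exact (far h1).2 h
  · exact (far h2).2 h

set_option maxHeartbeats 1000000 in
theorem nhca_of_order (hCH : CH G) {lt : V → V → Prop} (ho : OrderOn G Finset.univ lt) :
    IsNHCAGraph G := by
  classical
  have tr : ∀ {a b c}, lt a b → lt b c → lt a c := fun {a b c} e1 e2 =>
    ho.trans a (Finset.mem_univ _) b (Finset.mem_univ _) c (Finset.mem_univ _) e1 e2
  have irr : ∀ a, ¬ lt a a := fun a h => (ho.far (Finset.mem_univ _) (Finset.mem_univ _) h).1 rfl
  set n := Fintype.card V with hn
  let P : V → Finset V := fun x => Finset.univ.filter (fun y => lt y x)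
  have memP : ∀ x y, y ∈ P x ↔ lt y x := fun x y => by simp [P]
  let L : V → ℕ := fun x => (P x).card
  have Ln : ∀ x, L x ≤ n := fun x => Finset.card_le_univ _
  have mono : ∀ {x y z}, L z ≤ L y → lt x z → lt x y := by
    intro x y z hl hx
    by_contra hxy
    have sub : P y ⊆ P z := by
      intro w hw
      rw [memP] at hw ⊢
      exact (two_two_free hCH ho hx hw).resolve_left hxy
    have := Finset.eq_of_subset_of_card_le sub hl
    rw [← memP, ← this, memP] at hx
    exact hxy hx
  have Llt : ∀ {x z}, lt x z → L x < L z := by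
    intro x z h
    apply Finset.card_lt_card
    refine ⟨fun w hw => ?_, fun hs => ?_⟩
    · rw [memP] at hw ⊢; exact tr hw h
    · have := hs ((memP z x).2 h)
      rw [memP] at this
      exact irr x this
  have exR : ∀ x, ∃ r, L x < r ∧ r ≤ n + 1 ∧ ∀ y, r ≤ L y ↔ lt x y := by
    intro x
    by_cases hx : ∃ z, lt x z
    · obtain ⟨z, hz, hz'⟩ := Set.exists_min_image {z | lt x z} L (Set.toFinite _) hx
      refine ⟨L z, Llt hz, (Ln z).trans (by omega), fun y => ⟨fun h => mono h hz, fun h => hz' y h⟩⟩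
    · push Not at hx
      refine ⟨n + 1, by have := Ln x; omega, le_rfl, fun y => ⟨fun h => ?_, fun h => (hx y h).elim⟩⟩
      have := Ln y; omega
  clear_value L
  choose R hR1 hR2 hR3 using exR
  let e := Fintype.equivFin V
  let k : V → ℝ := fun v => ((e v : ℕ) + 1 : ℝ) / (2 * n + 2)
  have npos : (0:ℝ) < 2 * n + 2 := by positivity
  have k0 : ∀ v, 0 < k v := fun v => by positivity
  have k1 : ∀ v, k v < 1 / 2 := by
    intro v
    have h : (e v : ℕ) < n := (e v).2
    have h' : ((e v : ℕ) : ℝ) + 1 ≤ n := by exact_mod_cast h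
    show ((e v : ℕ) + 1 : ℝ) / (2 * n + 2) < 1 / 2
    rw [div_lt_div_iff₀ npos (by norm_num)]
    linarith
  have kinj : ∀ u v, k u = k v → u = v := by
    intro u v h
    have h' : ((e u : ℕ) + 1 : ℝ) / (2 * n + 2) = ((e v : ℕ) + 1 : ℝ) / (2 * n + 2) := h
    rw [div_left_inj' npos.ne'] at h'
    have h2 : ((e u : ℕ) : ℝ) = (e v : ℕ) := by linarith
    have h3 : (e u : ℕ) = e v := by exact_mod_cast h2
    exact e.injective (Fin.ext h3)
  clear_value k
  have N : (0:ℝ) < n + 2 := by positivity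
  have nat1 : ∀ {i j : ℕ}, i < j → (i : ℝ) + 1 ≤ j := fun h => by exact_mod_cast h
  have nat2 : ∀ {i j : ℕ}, i ≤ j → (i : ℝ) ≤ j := fun h => by exact_mod_cast h
  have eqn : ∀ {i j : ℕ} {p q : ℝ}, 0 < p → p < 1/2 → 0 < q → q < 1/2 → (i : ℝ) + p = j + q → p = q := by
    intro i j p q h1 h2 h3 h4 h
    rcases lt_trichotomy i j with h5 | h5 | h5
    · have := nat1 h5; linarith
    · subst h5; linarith
    · have := nat1 h5; linarith
  have sep : ∀ u v, (L u + k u < R v - k v ↔ ¬ lt v u) ∧ (L u + k u : ℝ) ≠ R v - k v := by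
    intro u v
    have a1 := k0 u
    have a2 := k0 v
    have a3 := k1 u
    have a4 := k1 v
    by_cases h : lt v u
    · have := nat2 ((hR3 v u).2 h)
      exact ⟨⟨fun h' => by linarith, fun h' => (h' h).elim⟩, by intro h'; linarith⟩
    · have h' : L u < R v := by
        by_contra hh
        exact h ((hR3 v u).1 (by omega))
      have := nat1 h'
      exact ⟨⟨fun _ => h, fun _ => by linarith⟩, by intro h'; linarith⟩
  obtain ⟨M, hN, hH, hI⟩ := model_of_intervals (fun v => (L v + k v) / (n + 2))
    (fun v => (R v - k v) / (n + 2))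
    (fun v => by have := k0 v; positivity)
    (fun v => by
      have := (sep v v).1.2 (irr v)
      exact div_lt_div_of_pos_right this N)
    (fun v => by
      have := k0 v
      have := nat2 (hR2 v)
      push_cast at this
      rw [div_lt_one N]; linarith)
    (fun u v h => by
      rw [div_left_inj' N.ne'] at h
      exact kinj _ _ (eqn (k0 u) (k1 u) (k0 v) (k1 v) h))
    (fun u v h => by
      rw [div_left_inj' N.ne'] at h
      exact (kinj _ _ (eqn (i := R u) (j := R v) (k0 v) (k1 v) (k0 u) (k1 u) (by linarith))).symm)
    (fun u v h => by
      rw [div_left_inj' N.ne'] at h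
      exact (sep u v).2 h)
  refine ⟨M, hN, hH, fun u v => ?_⟩
  rw [hI, div_lt_div_iff_of_pos_right N, div_lt_div_iff_of_pos_right N, (sep u v).1, (sep v u).1]
  constructor
  · intro h
    refine ⟨h.ne, fun h' => ?_, fun h' => ?_⟩
    · exact (ho.far (Finset.mem_univ _) (Finset.mem_univ _) h').2 h.symm
    · exact (ho.far (Finset.mem_univ _) (Finset.mem_univ _) h').2 h
  · rintro ⟨hne, h1, h2⟩
    by_contra hadj
    rcases (ho.comp u (Finset.mem_univ _) v (Finset.mem_univ _)).1 ⟨hne.symm, hadj⟩ with h | h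
    · exact h2 h
    · exact h1 h

end Intervals
end NH

namespace NH
section Holes
variable {V X : Type} {G : SimpleGraph V} {n : ℕ} {f : ℕ → V}

/-- `f 0, …, f (n-1)` is a chordless cycle with at least four vertices. -/
def IsHole (G : SimpleGraph V) (n : ℕ) (f : ℕ → V) : Prop :=
  4 ≤ n ∧ ∀ i j, i < j → j < n →
    f i ≠ f j ∧ (G.Adj (f i) (f j) ↔ j = i + 1 ∨ (i = 0 ∧ j + 1 = n))

theorem IsHole.inj (h : IsHole G n f) {i j : ℕ} (hi : i < n) (hj : j < n) (e : f i = f j) :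
    i = j := by
  rcases lt_trichotomy i j with hl | hl | hl
  · exact absurd e (h.2 i j hl hj).1
  · exact hl
  · exact absurd e.symm (h.2 j i hl hi).1

theorem IsHole.adj (h : IsHole G n f) {i j : ℕ} (hi : i < n) (hj : j < n) :
    G.Adj (f i) (f j) ↔ j = i + 1 ∨ i = j + 1 ∨ (i = 0 ∧ j + 1 = n) ∨ (j = 0 ∧ i + 1 = n) := by
  have h4 := h.1
  rcases lt_trichotomy i j with hl | hl | hl
  · rw [(h.2 i j hl hj).2]; omega
  · subst hl
    refine iff_of_false G.irrefl (by omega)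
  · rw [G.adj_comm, (h.2 j i hl hi).2]; omega

theorem IsHole.shift (h : IsHole G n f) {m : ℕ} (hm : m < n) :
    IsHole G n (fun k => if k + m < n then f (k + m) else f (k + m - n)) := by
  refine ⟨h.1, fun i j hij hj => ?_⟩
  have h4 := h.1
  have e : ∀ k, k < n → ∃ k', k' < n ∧ (if k + m < n then f (k + m) else f (k + m - n)) = f k' ∧
      ((k + m < n ∧ k' = k + m) ∨ (n ≤ k + m ∧ k' + n = k + m)) := by
    intro k hk
    by_cases hc : k + m < n
    · exact ⟨k + m, hc, by rw [if_pos hc], Or.inl ⟨hc, rfl⟩⟩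
    · exact ⟨k + m - n, by omega, by rw [if_neg hc], Or.inr ⟨by omega, by omega⟩⟩
  obtain ⟨i', hi', ei, hi2⟩ := e i (by omega)
  obtain ⟨j', hj', ej, hj2⟩ := e j hj
  dsimp only
  rw [ei, ej]
  refine ⟨fun e => ?_, ?_⟩
  · have := h.inj hi' hj' e
    omega
  · rw [h.adj hi' hj']
    omega

theorem IsHole.rev (h : IsHole G n f) :
    IsHole G n (fun k => if k = 0 then f 0 else f (n - k)) := by
  refine ⟨h.1, fun i j hij hj => ?_⟩
  have h4 := h.1
  have hj0 : j ≠ 0 := by omega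
  dsimp only
  rw [if_neg hj0]
  by_cases hi : i = 0
  · rw [if_pos hi]
    refine ⟨fun e => ?_, ?_⟩
    · have := h.inj (by omega) (by omega) e
      omega
    · rw [h.adj (by omega) (by omega)]; omega
  · rw [if_neg hi]
    refine ⟨fun e => ?_, ?_⟩
    · have := h.inj (by omega) (by omega) e
      omega
    · rw [h.adj (by omega) (by omega)]; omega

theorem IsHole.gap (h : IsHole G n f) {v : V} {i j : ℕ} (hv : ∀ k < n, v ≠ f k)
    (hi : G.Adj v (f i)) (hj : G.Adj v (f j)) (hij : i + 2 ≤ j) (hjn : j < n)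
    (hne : ¬ (i = 0 ∧ j + 1 = n)) (hbet : ∀ k, i < k → k < j → ¬ G.Adj v (f k)) :
    IsHole G (j - i + 2) (fun k => if k = 0 then v else f (i + k - 1)) := by
  refine ⟨by omega, fun p q hpq hq => ?_⟩
  dsimp only
  rw [if_neg (show q ≠ 0 by omega)]
  by_cases hp : p = 0
  · rw [if_pos hp]
    refine ⟨hv _ (by omega), ?_⟩
    by_cases h1 : q = 1
    · rw [show i + q - 1 = i by omega]
      exact iff_of_true hi (by omega)
    by_cases h2 : i + q - 1 = j
    · rw [h2]; exact iff_of_true hj (by omega)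
    · exact iff_of_false (hbet _ (by omega) (by omega)) (by omega)
  · rw [if_neg hp]
    refine ⟨fun e => ?_, ?_⟩
    · have := h.inj (by omega) (by omega) e
      omega
    · rw [h.adj (by omega) (by omega)]; omega

theorem IsHole.hub (h : IsHole G n f) (hW : ∀ n : ℕ, 4 ≤ n → IsEmpty (wheel n ↪g G)) {v : V}
    (hv : ∀ k < n, G.Adj v (f k)) : False := by
  have h4 := h.1
  refine (hW n h4).false ?_
  refine ⟨⟨fun x => Sum.elim (fun i : Fin n => f i) (fun _ => v) x, ?_⟩, ?_⟩
  · rintro (i | i) (j | j) e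
    · have := h.inj i.2 j.2 e
      rw [Fin.ext this]
    · exact absurd e (hv i i.2).ne'
    · exact absurd e (hv j j.2).ne
    · rfl
  · rintro (i | i) (j | j)
    · change G.Adj (f i) (f j) ↔ _
      rw [h.adj i.2 j.2, wheel, SimpleGraph.fromRel_adj]
      have hm : ∀ a b : Fin n, ((a : ℕ) + 1) % n = (b : ℕ) ↔
          ((b : ℕ) = a + 1 ∨ ((b : ℕ) = 0 ∧ (a : ℕ) + 1 = n)) := by
        intro a b
        by_cases hc : (a : ℕ) + 1 = n
        · rw [hc, Nat.mod_self]; omega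
        · rw [Nat.mod_eq_of_lt (by omega)]; omega
      have hne : (Sum.inl i : Fin n ⊕ Unit) ≠ Sum.inl j ↔ (i : ℕ) ≠ j := by
        rw [Ne, Sum.inl.injEq, Fin.ext_iff]
      rw [hne]
      simp [hm]
      omega
    · change G.Adj (f i) v ↔ _
      rw [wheel, SimpleGraph.fromRel_adj]
      refine iff_of_true (hv i i.2).symm ⟨by simp, Or.inr (Or.inl ⟨_, rfl⟩)⟩
    · change G.Adj v (f j) ↔ _
      rw [wheel, SimpleGraph.fromRel_adj]
      refine iff_of_true (hv j j.2) ⟨by simp, Or.inl (Or.inl ⟨_, rfl⟩)⟩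
    · change G.Adj v v ↔ _
      refine iff_of_false G.irrefl (by cases i; cases j; exact (wheel n).irrefl)

/-- A vertex off the hole with a neighbour on both sides of a non-neighbour. -/
theorem IsHole.around (h : IsHole G n f) {v : V} {i j m : ℕ} (hv : ∀ k < n, v ≠ f k)
    (hi : G.Adj v (f i)) (hj : G.Adj v (f j)) (him : i < m) (hmj : m < j) (hjn : j < n)
    (hm : ¬ G.Adj v (f m)) :
    ∃ i' j', i ≤ i' ∧ i' < m ∧ m < j' ∧ j' ≤ j ∧ G.Adj v (f i') ∧ G.Adj v (f j') ∧
      ∀ k, i' < k → k < j' → ¬ G.Adj v (f k) := by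
  classical
  have e1 : ∃ k, m < k ∧ G.Adj v (f k) := ⟨j, hmj, hj⟩
  have e2 : ∃ k, k < m ∧ G.Adj v (f (m - 1 - k)) :=
    ⟨m - 1 - i, by omega, by rwa [show m - 1 - (m - 1 - i) = i by omega]⟩
  have s1 := Nat.find_spec e1
  have s2 := Nat.find_spec e2
  have m1 := fun k => Nat.find_min e1 (m := k)
  have m2 := fun k => Nat.find_min e2 (m := k)
  have l1 : Nat.find e1 ≤ j := Nat.find_min' e1 ⟨hmj, hj⟩
  have l2 : Nat.find e2 ≤ m - 1 - i :=
    Nat.find_min' e2 ⟨by omega, by rwa [show m - 1 - (m - 1 - i) = i by omega]⟩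
  generalize Nat.find e1 = x at *
  generalize Nat.find e2 = y at *
  refine ⟨m - 1 - y, x, by omega, by omega, s1.1, l1, s2.2, s1.2, fun k hk hk' hadj => ?_⟩
  rcases lt_trichotomy k m with hl | hl | hl
  · exact m2 (m - 1 - k) (by omega)
      ⟨by omega, by rwa [show m - 1 - (m - 1 - k) = k by omega]⟩
  · exact hm (hl ▸ hadj)
  · exact m1 k hk' ⟨hl, hadj⟩

theorem IsHole.thru0 (h : IsHole G n f) {v : V} {i j m : ℕ} (hv : ∀ k < n, v ≠ f k)
    (hi : G.Adj v (f i)) (hj : G.Adj v (f j)) (him : i < m) (hmj : m < j) (hjn : j < n)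
    (hne : ¬ (i = 0 ∧ j + 1 = n)) (hm : ¬ G.Adj v (f m)) :
    ∃ n' g, IsHole G n' g ∧ g 0 = v := by
  obtain ⟨i', j', h1, h2, h3, h4, h5, h6, h7⟩ := h.around hv hi hj him hmj hjn hm
  exact ⟨_, _, h.gap hv h5 h6 (by omega) (by omega) (by omega) h7, by simp⟩

theorem IsHole.thru (h : IsHole G n f) {v : V} {i j m : ℕ} (hv : ∀ k < n, v ≠ f k)
    (hi : G.Adj v (f i)) (hj : G.Adj v (f j)) (hij : i + 2 ≤ j) (hjn : j < n)
    (hne : ¬ (i = 0 ∧ j + 1 = n)) (hmn : m < n) (hm : ¬ G.Adj v (f m)) :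
    ∃ n' g, IsHole G n' g ∧ g 0 = v := by
  have hmi : m ≠ i := fun e => hm (e ▸ hi)
  have hmj : m ≠ j := fun e => hm (e ▸ hj)
  by_cases hc : i < m ∧ m < j
  · exact h.thru0 hv hi hj hc.1 hc.2 hjn hne hm
  · have hs := h.shift hjn
    refine hs.thru0 (v := v) (i := 0) (j := i + n - j)
      (m := if m < j then m + n - j else m - j) ?_ ?_ ?_ ?_ ?_ ?_ ?_ ?_
    · intro k hk
      split_ifs
      · exact hv _ (by omega)
      · exact hv _ (by omega)
    · simpa [hjn] using hj

    · rw [if_neg (by omega), show i + n - j + j - n = i by omega]; exact hi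
    · split_ifs <;> omega
    · split_ifs <;> omega
    · omega
    · omega
    · by_cases hc2 : m < j
      · rw [if_pos hc2, if_neg (by omega), show m + n - j + j - n = m by omega]; exact hm
      · rw [if_neg hc2, if_pos (by omega), show m - j + j = m by omega]; exact hm

/-- A hole in a graph violating the local condition. -/
theorem hole_of_not_CH (h : ¬ CH G) : ∃ n f, IsHole G n f := by
  unfold CH at h
  push Not at h
  obtain ⟨x, u, v, a, b, hxu, hxv, huv, hnuv, hua, hvb, hR⟩ := h
  classical
  have hR' : Reach G (fun w => w = u ∨ w = v ∨ Far G x w) u v := by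
    have r1 : Reach G (fun w => w = u ∨ w = v ∨ Far G x w) a b :=
      hR.mono fun w hw => Or.inr (Or.inr hw)
    exact (Reach.head hua (Or.inl rfl) r1).tail hvb.symm (Or.inr (Or.inl rfl))
  have hp := hR'.pathIn
  have hmin : ∀ m, PathIn G (fun w => w = u ∨ w = v ∨ Far G x w) m u v → Nat.find hp ≤ m :=
    fun m hm => Nat.find_min' hp hm
  obtain ⟨p, ip⟩ := (Nat.find_spec hp).induced hmin
  generalize Nat.find hp = l at *
  have hl : 2 ≤ l := by
    by_contra hlt
    have : l = 0 ∨ l = 1 := by omega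
    rcases this with rfl | rfl
    · exact huv (ip.h0.symm.trans ip.hn)
    · have := ip.adj 0 (by omega)
      rw [ip.h0, ip.hn] at this
      exact hnuv this
  have hxne : ∀ i ≤ l, x ≠ p i := by
    intro i hi e
    rcases ip.inP i hi with h1 | h1 | h1
    · exact hxu.ne (e.trans h1)
    · exact hxv.ne (e.trans h1)
    · exact h1.1 e.symm
  have hpinj : ∀ i j, i < j → j ≤ l → p i ≠ p j := by
    intro i j hij hj
    by_cases e : j = i + 1
    · rw [e]; exact (ip.adj i (by omega)).ne
    · exact (ip.far i j (by omega) hj).1.symm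
  refine ⟨l + 2, fun k => if k = 0 then x else p (k - 1), by omega, fun i j hij hj => ?_⟩
  dsimp only
  rw [if_neg (show j ≠ 0 by omega)]
  by_cases hi : i = 0
  · rw [if_pos hi]
    refine ⟨hxne _ (by omega), ?_⟩
    by_cases h1 : j = 1
    · rw [show j - 1 = 0 by omega, ip.h0]; exact iff_of_true hxu (by omega)
    by_cases h2 : j = l + 1
    · rw [show j - 1 = l by omega, ip.hn]; exact iff_of_true hxv (by omega)
    · refine iff_of_false ?_ (by omega)
      rcases ip.inP (j - 1) (by omega) with h3 | h3 | h3
      · exact absurd (ip.h0.trans h3.symm) (hpinj 0 (j - 1) (by omega) (by omega))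
      · exact absurd (h3.trans ip.hn.symm) (hpinj (j - 1) l (by omega) (by omega))
      · exact h3.2
  · rw [if_neg hi]
    refine ⟨hpinj _ _ (by omega) (by omega), ?_⟩
    by_cases e : j = i + 1
    · have := ip.adj (i - 1) (by omega)
      rw [show i - 1 + 1 = j - 1 by omega] at this
      exact iff_of_true this (Or.inl e)
    · exact iff_of_false (ip.far (i - 1) (j - 1) (by omega) (by omega)).2 (by omega)

end Holes
end NH

namespace NH
section Covers
variable {V X : Type} {G : SimpleGraph V} {n : ℕ} {f : ℕ → V} {S : V → Set X}

/-- Points certifying the consecutive intersections along a hole. -/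
theorem IsHole.wpts (h : IsHole G n f) (hS : ∀ u v, G.Adj u v ↔ u ≠ v ∧ (S u ∩ S v).Nonempty)
    {i k : ℕ} (hi : i < n) (hk : k < n) (hadj : G.Adj (f i) (f k)) :
    ∃ x, x ∈ S (f i) ∧ x ∈ S (f k) ∧ ∀ j < n, x ∈ S (f j) → j = i ∨ j = k := by
  have h4 := h.1
  obtain ⟨x, hx1, hx2⟩ := ((hS _ _).1 hadj).2
  refine ⟨x, hx1, hx2, fun j hj hxj => ?_⟩
  by_contra hc
  push Not at hc
  have a1 : G.Adj (f j) (f i) :=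
    (hS _ _).2 ⟨fun e => hc.1 (h.inj hj hi e), x, hxj, hx1⟩
  have a2 : G.Adj (f j) (f k) :=
    (hS _ _).2 ⟨fun e => hc.2 (h.inj hj hk e), x, hxj, hx2⟩
  rw [h.adj hj hi] at a1
  rw [h.adj hj hk] at a2
  rw [h.adj hi hk] at hadj
  omega

theorem IsHole.wpt (h : IsHole G n f) (hS : ∀ u v, G.Adj u v ↔ u ≠ v ∧ (S u ∩ S v).Nonempty)
    (k : ℕ) (hk : k + 1 < n) :
    ∃ x, x ∈ S (f k) ∧ x ∈ S (f (k + 1)) ∧ ∀ j < n, x ∈ S (f j) → j = k ∨ j = k + 1 :=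
  h.wpts hS (by omega) hk ((h.adj (by omega) hk).2 (Or.inl rfl))

/-- If a vertex off the hole contains all middle points it sees all but the first vertex. -/
theorem IsHole.sees (h : IsHole G n f) (hS : ∀ u v, G.Adj u v ↔ u ≠ v ∧ (S u ∩ S v).Nonempty)
    {c : V} (hc : ∀ k < n, c ≠ f k) (p q : ℕ) (hpq : p < q) (hq : q < n)
    (hall : ∀ k x, p ≤ k → k < q → x ∈ S (f k) → x ∈ S (f (k + 1)) →
      (∀ j < n, x ∈ S (f j) → j = k ∨ j = k + 1) → x ∈ S c) :
    ∀ k, p ≤ k → k ≤ q → G.Adj c (f k) := by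
  intro k hpk hkq
  by_cases hk : k < q
  · obtain ⟨x, h1, h2, h3⟩ := h.wpt hS k (by omega)
    exact (hS _ _).2 ⟨hc k (by omega), x, hall k x hpk hk h1 h2 h3, h1⟩
  · obtain ⟨x, h1, h2, h3⟩ := h.wpt hS (k - 1) (by omega)
    have := hall (k - 1) x (by omega) (by omega) h1 h2 h3
    rw [show k - 1 + 1 = k by omega] at h2
    exact (hS _ _).2 ⟨hc k (by omega), x, this, h2⟩

variable (hS : ∀ u v, G.Adj u v ↔ u ≠ v ∧ (S u ∩ S v).Nonempty)
  (hW : ∀ n : ℕ, 4 ≤ n → IsEmpty (wheel n ↪g G))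

theorem two_on {a b : V} (hS : ∀ u v, G.Adj u v ↔ u ≠ v ∧ (S u ∩ S v).Nonempty)
    (hW : ∀ n : ℕ, 4 ≤ n → IsEmpty (wheel n ↪g G)) (hab : G.Adj a b)
    (hcov : ∀ x, x ∈ S a ∨ x ∈ S b) (h : IsHole G n f) (ha : f 0 = a) : False := by
  have h4 := h.1
  subst ha
  have hb : ∀ k < n, b ≠ f k := by
    rintro k hk rfl
    rw [h.adj (by omega) hk] at hab
    obtain ⟨x1, _, _, h1⟩ := h.wpt hS 1 (by omega)
    obtain ⟨x2, _, _, h2⟩ := h.wpt hS 2 (by omega)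
    rcases hcov x1 with c1 | c1
    · have := h1 0 (by omega) c1; omega
    rcases hcov x2 with c2 | c2
    · have := h2 0 (by omega) c2; omega
    have := h1 k hk c1
    have := h2 k hk c2
    omega
  have hs := h.sees hS hb 1 (n - 1) (by omega) (by omega) (by
    intro k x hk1 hk2 _ _ hx
    rcases hcov x with c | c
    · have := hx 0 (by omega) c; omega
    · exact c)
  refine h.hub hW (v := b) fun k hk => ?_
  by_cases hk0 : k = 0
  · rw [hk0]; exact hab.symm
  · exact hs k (by omega) (by omega)

theorem two_mem {a b : V} (hS : ∀ u v, G.Adj u v ↔ u ≠ v ∧ (S u ∩ S v).Nonempty)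
    (hW : ∀ n : ℕ, 4 ≤ n → IsEmpty (wheel n ↪g G)) (hab : G.Adj a b)
    (hcov : ∀ x, x ∈ S a ∨ x ∈ S b) (h : IsHole G n f) {i : ℕ} (hi : i < n) (ha : f i = a) :
    False :=
  two_on hS hW hab hcov (h.shift hi) (by simpa [hi] using ha)

theorem two_cover_no_hole {a b : V} (hS : ∀ u v, G.Adj u v ↔ u ≠ v ∧ (S u ∩ S v).Nonempty)
    (hW : ∀ n : ℕ, 4 ≤ n → IsEmpty (wheel n ↪g G)) (hab : G.Adj a b)
    (hcov : ∀ x, x ∈ S a ∨ x ∈ S b) (h : IsHole G n f) : False := by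
  have h4 := h.1
  have ha : ∀ k < n, a ≠ f k := fun k hk e => two_mem hS hW hab hcov h hk e.symm
  by_cases hbu : ∀ k < n, G.Adj b (f k)
  · exact h.hub hW hbu
  have hb : ∀ k < n, b ≠ f k := fun k hk e =>
    two_mem hS hW hab.symm (fun x => (hcov x).symm) h hk e.symm
  push Not at hbu
  obtain ⟨m, hm, hbm⟩ := hbu
  have hnb : ∀ x ∈ S (f m), x ∈ S a := by
    intro x hx
    rcases hcov x with c | c
    · exact c
    · exact absurd ((hS _ _).2 ⟨hb m hm, x, c, hx⟩) hbm
  -- neighbours of `f m` on the hole are neighbours of `a`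
  have hna : ∀ k < n, G.Adj (f m) (f k) → G.Adj a (f k) := by
    intro k hk hadj
    obtain ⟨x, h1, h2, _⟩ := h.wpts hS hm hk hadj
    exact (hS _ _).2 ⟨ha k hk, x, hnb x h1, h2⟩
  by_cases hau : ∀ k < n, G.Adj a (f k)
  · exact h.hub hW hau
  push Not at hau
  obtain ⟨l, hl, hal⟩ := hau
  have key : ∃ n' g, IsHole G n' g ∧ g 0 = a := by
    by_cases hm0 : m = 0
    · exact h.thru ha (hna 1 (by omega) ((h.adj hm (by omega)).2 (by omega)))
        (hna (n - 1) (by omega) ((h.adj hm (by omega)).2 (by omega))) (by omega) (by omega)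
        (by omega) hl hal
    by_cases hmn : m + 1 = n
    · exact h.thru ha (hna 0 (by omega) ((h.adj hm (by omega)).2 (by omega)))
        (hna (n - 2) (by omega) ((h.adj hm (by omega)).2 (by omega))) (by omega) (by omega)
        (by omega) hl hal
    · exact h.thru ha (hna (m - 1) (by omega) ((h.adj hm (by omega)).2 (by omega)))
        (hna (m + 1) (by omega) ((h.adj hm (by omega)).2 (by omega))) (by omega) (by omega)
        (by omega) hl hal
  obtain ⟨n', g, hg, hg0⟩ := key
  exact two_on hS hW hab hcov hg hg0

/-- Two consecutive hole vertices in a three-cover. -/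
theorem three_on2 {a b c : V} (hS : ∀ u v, G.Adj u v ↔ u ≠ v ∧ (S u ∩ S v).Nonempty)
    (hW : ∀ n : ℕ, 4 ≤ n → IsEmpty (wheel n ↪g G)) (hac : G.Adj a c) (hbc : G.Adj b c)
    (hcov : ∀ x, x ∈ S a ∨ x ∈ S b ∨ x ∈ S c) (h : IsHole G n f) (ha : f 0 = a) (hb : f 1 = b) :
    False := by
  have h4 := h.1
  subst ha hb
  have hc : ∀ k < n, c ≠ f k := by
    rintro k hk rfl
    rw [h.adj (by omega) hk] at hac hbc
    omega
  have hs := h.sees hS hc 2 (n - 1) (by omega) (by omega) (by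
    intro k x hk1 hk2 _ _ hx
    rcases hcov x with c | c | c
    · have := hx 0 (by omega) c; omega
    · have := hx 1 (by omega) c; omega
    · exact c)
  refine h.hub hW (v := c) fun k hk => ?_
  by_cases hk0 : k = 0
  · rw [hk0]; exact hac.symm
  by_cases hk1 : k = 1
  · rw [hk1]; exact hbc.symm
  · exact hs k (by omega) (by omega)

theorem three_gap {a b c : V} (hS : ∀ u v, G.Adj u v ↔ u ≠ v ∧ (S u ∩ S v).Nonempty)
    (hW : ∀ n : ℕ, 4 ≤ n → IsEmpty (wheel n ↪g G)) (hac : G.Adj a c) (hbc : G.Adj b c)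
    (hcov : ∀ x, x ∈ S a ∨ x ∈ S b ∨ x ∈ S c) (h : IsHole G n f) (ha : f 0 = a)
    (hb : ∀ k < n, b ≠ f k) (hc : ∀ k < n, c ≠ f k) {i j : ℕ}
    (hi : G.Adj b (f i)) (hj : G.Adj b (f j)) (hij : i + 2 ≤ j) (hjn : j < n)
    (hne : ¬ (i = 0 ∧ j + 1 = n)) (hbet : ∀ k, i < k → k < j → ¬ G.Adj b (f k)) : False := by
  have h4 := h.1
  subst ha
  have hs := h.sees hS hc (max i 1) j (by omega) hjn (by
    intro k x hk1 hk2 x1 x2 hx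
    rcases hcov x with c | c | c
    · have := hx 0 (by omega) c; omega
    · have a1 : G.Adj b (f k) := (hS _ _).2 ⟨hb k (by omega), x, c, x1⟩
      have a2 : G.Adj b (f (k + 1)) := (hS _ _).2 ⟨hb (k + 1) (by omega), x, c, x2⟩
      by_cases hki : i < k
      · exact absurd a1 (hbet k hki hk2)
      · exact absurd a2 (hbet (k + 1) (by omega) (by omega))
    · exact c)
  refine (h.gap hb hi hj hij hjn hne hbet).hub hW (v := c) fun k hk => ?_
  by_cases hk0 : k = 0
  · rw [if_pos hk0]; exact hbc.symm
  rw [if_neg hk0]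
  by_cases hk1 : i + k - 1 = 0
  · rw [hk1]; exact hac.symm
  · exact hs _ (by omega) (by omega)

theorem three_few {a b c : V} (hS : ∀ u v, G.Adj u v ↔ u ≠ v ∧ (S u ∩ S v).Nonempty)
    (hW : ∀ n : ℕ, 4 ≤ n → IsEmpty (wheel n ↪g G)) (hac : G.Adj a c)
    (hcov : ∀ x, x ∈ S a ∨ x ∈ S b ∨ x ∈ S c) (h : IsHole G n f) (ha : f 0 = a)
    (hb : ∀ k < n, b ≠ f k) (hc : ∀ k < n, c ≠ f k)
    (hbet : ∀ k, 0 < k → k + 1 < n → ¬ G.Adj b (f k)) : False := by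
  have h4 := h.1
  subst ha
  have hs := h.sees hS hc 1 (n - 1) (by omega) (by omega) (by
    intro k x hk1 hk2 x1 x2 hx
    rcases hcov x with c | c | c
    · have := hx 0 (by omega) c; omega
    · have a1 : G.Adj b (f k) := (hS _ _).2 ⟨hb k (by omega), x, c, x1⟩
      exact absurd a1 (hbet k (by omega) (by omega))
    · exact c)
  refine h.hub hW (v := c) fun k hk => ?_
  by_cases hk0 : k = 0
  · rw [hk0]; exact hac.symm
  · exact hs _ (by omega) (by omega)

theorem three_off {a b c : V} (hS : ∀ u v, G.Adj u v ↔ u ≠ v ∧ (S u ∩ S v).Nonempty)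
    (hW : ∀ n : ℕ, 4 ≤ n → IsEmpty (wheel n ↪g G)) (hab : G.Adj a b) (hac : G.Adj a c)
    (hbc : G.Adj b c)
    (hcov : ∀ x, x ∈ S a ∨ x ∈ S b ∨ x ∈ S c) (h : IsHole G n f) (ha : f 0 = a)
    (hb : ∀ k < n, b ≠ f k) (hc : ∀ k < n, c ≠ f k) : False := by
  classical
  have h4 := h.1
  by_cases hbu : ∀ k < n, G.Adj b (f k)
  · exact h.hub hW hbu
  push Not at hbu
  obtain ⟨m, hm, hbm⟩ := hbu
  have hb0 : G.Adj b (f 0) := by rw [ha]; exact hab.symm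
  have hm0 : m ≠ 0 := by rintro rfl; exact hbm hb0
  by_cases hj : ∃ j, m < j ∧ j < n ∧ G.Adj b (f j)
  · obtain ⟨j, hmj, hjn, hj⟩ := hj
    obtain ⟨i', j', h1, h2, h3, h4', h5, h6, h7⟩ :=
      h.around hb hb0 hj (by omega) hmj hjn hbm
    by_cases hne : i' = 0 ∧ j' + 1 = n
    · exact three_few hS hW hac hcov h ha hb hc fun k hk hk' => h7 k (by omega) (by omega)
    · exact three_gap hS hW hac hbc hcov h ha hb hc h5 h6 (by omega) (by omega) hne h7
  · push Not at hj
    have e2 : ∃ k, k < m ∧ G.Adj b (f (m - 1 - k)) :=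
      ⟨m - 1, by omega, by rwa [show m - 1 - (m - 1) = 0 by omega]⟩
    have s2 := Nat.find_spec e2
    have m2 := fun k => Nat.find_min e2 (m := k)
    generalize Nat.find e2 = y at *
    obtain ⟨i, hi⟩ : ∃ i, i = m - 1 - y := ⟨_, rfl⟩
    rw [← hi] at s2
    have hbet : ∀ k, i < k → k < n → ¬ G.Adj b (f k) := by
      intro k hk hkn hadj
      rcases lt_trichotomy k m with hl | hl | hl
      · exact m2 (m - 1 - k) (by omega)
          ⟨by omega, by rwa [show m - 1 - (m - 1 - k) = k by omega]⟩
      · exact hbm (hl ▸ hadj)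
      · exact hj k hl hkn hadj
    have hoff : ∀ v, (∀ k < n, v ≠ f k) →
        ∀ k < n, v ≠ (if k = 0 then f 0 else f (n - k)) := by
      intro v hv k hk
      split_ifs
      · exact hv _ (by omega)
      · exact hv _ (by omega)
    by_cases hi0 : i = 0
    · exact three_few hS hW hac hcov h ha hb hc fun k hk hk' => hbet k (by omega) (by omega)
    by_cases hi1 : i = 1
    · refine three_few hS hW hac hcov h.rev (by simpa using ha) (hoff b hb) (hoff c hc) ?_
      intro k hk hk'
      rw [if_neg (by omega)]
      exact hbet _ (by omega) (by omega)
    · refine three_gap hS hW hac hbc hcov h.rev (by simpa using ha) (hoff b hb) (hoff c hc)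
        (i := 0) (j := n - i) (by simpa using hb0) ?_ (by omega) (by omega) (by omega) ?_
      · rw [if_neg (by omega), show n - (n - i) = i by omega]; exact s2.2
      · intro k hk hk'
        rw [if_neg (by omega)]
        exact hbet _ (by omega) (by omega)

theorem three_on {a b c : V} (hS : ∀ u v, G.Adj u v ↔ u ≠ v ∧ (S u ∩ S v).Nonempty)
    (hW : ∀ n : ℕ, 4 ≤ n → IsEmpty (wheel n ↪g G)) (hab : G.Adj a b) (hac : G.Adj a c)
    (hbc : G.Adj b c)
    (hcov : ∀ x, x ∈ S a ∨ x ∈ S b ∨ x ∈ S c) (h : IsHole G n f) (ha : f 0 = a) : False := by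
  have h4 := h.1
  have main : ∀ b c, G.Adj a b → G.Adj a c → G.Adj b c →
      (∀ x, x ∈ S a ∨ x ∈ S b ∨ x ∈ S c) → ∀ k < n, b ≠ f k := by
    rintro b c hab hac hbc hcov k hk rfl
    have hk2 := hab
    rw [← ha, h.adj (by omega) hk] at hk2
    by_cases hk1 : k = 1
    · exact three_on2 hS hW hac hbc hcov h ha (by rw [hk1])
    · refine three_on2 hS hW hac hbc hcov h.rev (by simpa using ha) ?_
      rw [if_neg (by omega), show n - 1 = k by omega]
  exact three_off hS hW hab hac hbc hcov h ha (main b c hab hac hbc hcov)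
    (main c b hac hab hbc.symm fun x => by have := hcov x; tauto)

theorem three_cover_no_hole {a b c : V}
    (hS : ∀ u v, G.Adj u v ↔ u ≠ v ∧ (S u ∩ S v).Nonempty)
    (hW : ∀ n : ℕ, 4 ≤ n → IsEmpty (wheel n ↪g G)) (hab : G.Adj a b) (hac : G.Adj a c)
    (hbc : G.Adj b c)
    (hcov : ∀ x, x ∈ S a ∨ x ∈ S b ∨ x ∈ S c) (h : IsHole G n f) : False := by
  have h4 := h.1
  have fin : ∀ v, v = a ∨ v = b ∨ v = c → ∀ n' g, IsHole G n' g → g 0 = v → False := by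
    rintro v (rfl | rfl | rfl) n' g hg hg0
    · exact three_on hS hW hab hac hbc hcov hg hg0
    · exact three_on hS hW hab.symm hbc hac (fun x => by have := hcov x; tauto) hg hg0
    · exact three_on hS hW hac.symm hbc.symm hab (fun x => by have := hcov x; tauto) hg hg0
  have off : ∀ v, v = a ∨ v = b ∨ v = c → ∀ k < n, v ≠ f k := by
    intro v hv k hk e
    exact fin v hv _ _ (h.shift hk) (by simpa [hk] using e.symm)
  have pair : ∀ v, v = a ∨ v = b ∨ v = c → ∀ i j, i + 2 ≤ j → j < n → ¬ (i = 0 ∧ j + 1 = n) →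
      G.Adj v (f i) → G.Adj v (f j) → False := by
    intro v hv i j hij hj hne h1 h2
    by_cases hu : ∀ k < n, G.Adj v (f k)
    · exact h.hub hW hu
    push Not at hu
    obtain ⟨m, hm, hvm⟩ := hu
    obtain ⟨n', g, hg, hg0⟩ := h.thru (off v hv) h1 h2 hij hj hne hm hvm
    exact fin v hv n' g hg hg0
  have adj : ∀ v, v = a ∨ v = b ∨ v = c → ∀ x k, k < n → x ∈ S v → x ∈ S (f k) →
      G.Adj v (f k) := fun v hv x k hk h1 h2 => (hS _ _).2 ⟨off v hv k hk, x, h1, h2⟩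
  obtain ⟨x0, p0, q0, -⟩ := h.wpt hS 0 (by omega)
  obtain ⟨x1, p1, q1, -⟩ := h.wpt hS 1 (by omega)
  obtain ⟨x2, p2, q2, -⟩ := h.wpt hS 2 (by omega)
  obtain ⟨r, hr, hr'⟩ : ∃ r < n, (r = 4 ∨ (n = 4 ∧ r = 0)) := by
    by_cases hn : n = 4
    · exact ⟨0, by omega, by omega⟩
    · exact ⟨4, by omega, by omega⟩
  obtain ⟨x3, p3, q3, -⟩ := h.wpts hS (i := 3) (k := r) (by omega) hr
    ((h.adj (by omega) hr).2 (by omega))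
  have h01 : ∀ v, v = a ∨ v = b ∨ v = c → x0 ∈ S v → x1 ∈ S v → False := fun v hv y z =>
    pair v hv 0 2 (by omega) (by omega) (by omega) (adj v hv _ _ (by omega) y p0)
      (adj v hv _ _ (by omega) z q1)
  have h02 : ∀ v, v = a ∨ v = b ∨ v = c → x0 ∈ S v → x2 ∈ S v → False := fun v hv y z =>
    pair v hv 0 2 (by omega) (by omega) (by omega) (adj v hv _ _ (by omega) y p0)
      (adj v hv _ _ (by omega) z p2)
  have h03 : ∀ v, v = a ∨ v = b ∨ v = c → x0 ∈ S v → x3 ∈ S v → False := fun v hv y z =>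
    pair v hv 1 3 (by omega) (by omega) (by omega) (adj v hv _ _ (by omega) y q0)
      (adj v hv _ _ (by omega) z p3)
  have h12 : ∀ v, v = a ∨ v = b ∨ v = c → x1 ∈ S v → x2 ∈ S v → False := fun v hv y z =>
    pair v hv 1 3 (by omega) (by omega) (by omega) (adj v hv _ _ (by omega) y p1)
      (adj v hv _ _ (by omega) z q2)
  have h13 : ∀ v, v = a ∨ v = b ∨ v = c → x1 ∈ S v → x3 ∈ S v → False := fun v hv y z =>
    pair v hv 1 3 (by omega) (by omega) (by omega) (adj v hv _ _ (by omega) y p1)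
      (adj v hv _ _ (by omega) z p3)
  have h23 : ∀ v, v = a ∨ v = b ∨ v = c → x2 ∈ S v → x3 ∈ S v → False := fun v hv y z => by
    have a1 := adj v hv _ _ (by omega) y p2
    have a2 := adj v hv _ _ hr z q3
    rcases hr' with rfl | ⟨_, rfl⟩
    · exact pair v hv 2 4 (by omega) (by omega) (by omega) a1 a2
    · exact pair v hv 0 2 (by omega) (by omega) (by omega) a2 a1
  have ea : a = a ∨ a = b ∨ a = c := Or.inl rfl
  have eb : b = a ∨ b = b ∨ b = c := Or.inr (Or.inl rfl)
  have ec : c = a ∨ c = b ∨ c = c := Or.inr (Or.inr rfl)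
  have := h01 a ea; have := h01 b eb; have := h01 c ec
  have := h02 a ea; have := h02 b eb; have := h02 c ec
  have := h03 a ea; have := h03 b eb; have := h03 c ec
  have := h12 a ea; have := h12 b eb; have := h12 c ec
  have := h13 a ea; have := h13 b eb; have := h13 c ec
  have := h23 a ea; have := h23 b eb; have := h23 c ec
  have k0 := hcov x0
  have k1 := hcov x1
  have k2 := hcov x2
  have k3 := hcov x3
  clear pair adj fin off h01 h02 h03 h12 h13 h23 ea eb ec p0 p1 p2 p3 q0 q1 q2 q3 hcov
  grind

end Covers

section Final
variable {V : Type} [Fintype V] {G : SimpleGraph V}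

theorem main_forward (h : IsNHCAGraph G) :
    ((∀ n : ℕ, 4 ≤ n → IsEmpty (wheel n ↪g G)) ∧
       IsEmpty (sun3 ↪g G) ∧
       (∀ n : ℕ, 4 ≤ n → IsEmpty (risingSun n ↪g G)) ∧
       IsEmpty (umbrella ↪g G) ∧
       IsEmpty (tent ↪g G)) := by
  obtain ⟨M, hN, hH, hM⟩ := h
  have hA : AllNbhd G := fun v => exists_nbhd hM hN hH v
  exact ⟨no_wheel hA, no_sun hA, no_rising hA, no_umbrella hA, no_tent hA⟩

theorem main_backward (hG : IsCAGraph G)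
    (hw : ∀ n : ℕ, 4 ≤ n → IsEmpty (wheel n ↪g G)) (hno : NoObs G) : IsNHCAGraph G := by
  obtain ⟨M, hM⟩ := hG
  have hS : ∀ u v, G.Adj u v ↔ u ≠ v ∧ ((M.arc u).pts ∩ (M.arc v).pts).Nonempty := hM
  have fin : (∀ n f, ¬ IsHole G n f) → IsNHCAGraph G := by
    intro hh
    have hCH : CH G := by
      by_contra hc
      obtain ⟨n, f, hf⟩ := hole_of_not_CH hc
      exact hh n f hf
    have hATF := atf_of hCH (tri_of_model hM) hno
    obtain ⟨lt, ho⟩ := (exists_order hCH hATF _).2 Finset.univ rfl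
    exact nhca_of_order hCH ho
  by_cases hN : M.Normal
  · by_cases hH : M.Helly
    · exact ⟨M, hN, hH, hM⟩
    · obtain ⟨u, v, w, huv, huw, hvw, iuv, iuw, ivw, hcov⟩ := three_cover hN hH
      refine fin fun n f hf => ?_
      exact three_cover_no_hole hS hw ((hM _ _).2 ⟨huv, iuv⟩) ((hM _ _).2 ⟨huw, iuw⟩)
        ((hM _ _).2 ⟨hvw, ivw⟩) hcov hf
  · unfold CAModel.Normal at hN
    push Not at hN
    obtain ⟨u, v, huv, hcov⟩ := hN
    refine fin fun n f hf => ?_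
    refine two_cover_no_hole hS hw ((hM _ _).2 ⟨huv, two_cover_inter M hcov⟩) (fun x => ?_) hf
    have : x ∈ (M.arc u).pts ∪ (M.arc v).pts := by rw [hcov]; trivial
    exact this

end Final
end NH

/-- A circular-arc graph is an NHCA graph iff it contains no induced wheel
`W_n` (`n ≥ 4`), 3-sun, rising sun `R_n` (`n ≥ 4`), umbrella, or tent. -/
theorem stmt_8 {V : Type} [Fintype V] (G : SimpleGraph V) (hG : IsCAGraph G) :
    IsNHCAGraph G ↔
      ((∀ n : ℕ, 4 ≤ n → IsEmpty (wheel n ↪g G)) ∧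
       IsEmpty (sun3 ↪g G) ∧
       (∀ n : ℕ, 4 ≤ n → IsEmpty (risingSun n ↪g G)) ∧
       IsEmpty (umbrella ↪g G) ∧
       IsEmpty (tent ↪g G)) := by
  constructor
  · exact NH.main_forward
  · rintro ⟨h1, h2, h3, h4, h5⟩
    exact NH.main_backward hG h1 ⟨h2, h3, h4, h5⟩
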